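/- arXiv:2201.10112 — 6 statements merged into one kernel-verified Lean document; each statement's English description precedes it below -/
import Mathlib

section
/- Let n ≥ 1, c, H > 0 and b, m² ≥ 0 with b² ≥ 4m². Let β ≥ 0 and p > 1 satisfy n/2 − √(b²−4m²)/(2H) ≤ 1/p, let ϱ = ϱ_crit(n,H,b,m²,β,p) := (1/2)(b − √(b²−4m²))((β+1)p − 1) + nH(β+1)(p−1), and let ς = κ_crit(b,m²,β,p), where κ_crit := −1 if b² > 4m² and κ_crit := −1 − (β+1)p if b² = 4m². Take Γ(t) = μ e^{ϱ_crit t}(1+t)^{κ_crit} with μ > 0. Assume v₀, v₁ ∈ L¹_loc(ℝⁿ) are nonnegative, nontrivial, and supported in B_R for some R > 0, and let v be a weak solution of the anti-de Sitter problem with lifespan T(ε). Then there exists ε₀ > 0 such that for every ε ∈ (0, ε₀] the solution v blows up in finite time, and T(ε) ≤ C exp(K ε^{−((β+1)p−1)}), where C, K > 0 are independent of ε. -/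
open MeasureTheory Real Set

noncomputable section

/-- `ℝⁿ` as a Euclidean space. -/
abbrev Eucl (n : ℕ) := EuclideanSpace ℝ (Fin n)

/-- The Laplace operator on functions `ℝⁿ → ℝ`, written as the sum of the second-order
partial derivatives in the coordinate directions. -/
def lapl {n : ℕ} (f : Eucl n → ℝ) (x : Eucl n) : ℝ :=
  ∑ i : Fin n,
    fderiv ℝ (fun y => fderiv ℝ f y (EuclideanSpace.single i 1)) x (EuclideanSpace.single i 1)

/-- A test function `φ ∈ C_0^∞([0,T) × ℝⁿ)`: smooth, compactly supported, with support
contained in `[0,T') × ℝⁿ` for some `T' < T`. -/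
structure IsTestFn {n : ℕ} (T : ℝ) (φ : ℝ → Eucl n → ℝ) : Prop where
  smooth : ContDiff ℝ (⊤ : ℕ∞) (fun q : ℝ × Eucl n => φ q.1 q.2)
  cpt : HasCompactSupport (fun q : ℝ × Eucl n => φ q.1 q.2)
  vanish : ∃ T' : ℝ, T' < T ∧ ∀ s ≥ T', ∀ x, φ s x = 0

/-- Weak solution (with `C¹` regularity in time) on `[0,T)` of the semilinear wave equation
in anti-de Sitter spacetime
`∂_t²v − c²e^{2Ht}Δv + b ∂_t v + m²v = Γ(t) (∫ |v(t,y)|^p dy)^β |v|^p`,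
with data `v(0,·) = ε v₀`, `∂_t v(0,·) = ε v₁` supported in `B_R`.
Here `vt` denotes the time derivative `∂_t v`. -/
structure IsWeakSolADS (n : ℕ) (c H b m2 p β : ℝ) (Γ : ℝ → ℝ) (ε : ℝ)
    (v0 v1 : Eucl n → ℝ) (R T : ℝ) (v vt : ℝ → Eucl n → ℝ) : Prop where
  /-- `v(t,·) ∈ L¹_loc`: by the support condition it is in fact integrable. -/
  integ_v : ∀ t ∈ Ico (0:ℝ) T, Integrable (v t)
  integ_vt : ∀ t ∈ Ico (0:ℝ) T, Integrable (vt t)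
  integ_pow : ∀ t ∈ Ico (0:ℝ) T, Integrable (fun x => |v t x| ^ p)
  /-- `v ∈ C¹([0,T), L¹_loc(ℝⁿ))`, tested against continuous compactly supported functions:
  `vt` is the time derivative of `v` and is continuous in time. -/
  c1 : ∀ g : Eucl n → ℝ, Continuous g → HasCompactSupport g →
      (∀ t ∈ Ico (0:ℝ) T,
        HasDerivWithinAt (fun s => ∫ x, v s x * g x) (∫ x, vt t x * g x) (Ico (0:ℝ) T) t) ∧
      ContinuousOn (fun t => ∫ x, vt t x * g x) (Ico (0:ℝ) T)
  /-- `f(t,v) ∈ L¹_loc((0,T) × ℝⁿ)`. -/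
  nonlin_L1loc : ∀ t ∈ Ico (0:ℝ) T,
      IntervalIntegrable (fun s => Γ s * (∫ y, |v s y| ^ p) ^ β * ∫ x, |v s x| ^ p) volume 0 t
  /-- support condition: `supp v(t,·) ⊆ B_{R + (c/H)(e^{Ht} − 1)}`. -/
  supp : ∀ t ∈ Ioo (0:ℝ) T, ∀ x, v t x ≠ 0 → ‖x‖ ≤ R + (c / H) * (exp (H * t) - 1)
  /-- the weak formulation of the equation. -/
  identity : ∀ t ∈ Ioo (0:ℝ) T, ∀ φ : ℝ → Eucl n → ℝ, IsTestFn T φ →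
      (∫ x, vt t x * φ t x) - (∫ x, v t x * deriv (fun s => φ s x) t)
        + b * (∫ x, v t x * φ t x)
        + (∫ s in (0:ℝ)..t, ∫ x, v s x *
            (deriv (deriv (fun r => φ r x)) s
              - c ^ 2 * exp (2 * H * s) * lapl (fun y => φ s y) x
              - b * deriv (fun r => φ r x) s + m2 * φ s x))
      = ε * (∫ x, v1 x * φ 0 x)
        + ε * (∫ x, v0 x * (b * φ 0 x - deriv (fun s => φ s x) 0))
        + (∫ s in (0:ℝ)..t, Γ s * (∫ y, |v s y| ^ p) ^ β * (∫ x, |v s x| ^ p * φ s x))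


lemma ads_abstract {t1 P D M0 : ℝ} (hP : 1 < P) (hD : 0 ≤ D) (hM0 : 0 < M0) (w : ℝ → ℝ)
    (h0 : ∀ t ∈ Ioo 0 t1, M0 ≤ w t)
    (step : ∀ x0 M h : ℝ, 0 ≤ x0 → 0 < M → 0 < h → h ≤ 1 →
      (∀ t ∈ Ioo 0 t1, x0 ≤ Real.log (1 + t) → M ≤ w t) →
      ∀ t ∈ Ioo 0 t1, x0 + h + D * M ^ (1 - P) / h ≤ Real.log (1 + t) → 2 * M ≤ w t) :
    ∀ t ∈ Ioo 0 t1, Real.log (1 + t) ≤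
      (1 + D * M0 ^ (1 - P)) / (1 - (2:ℝ) ^ (-((P - 1) / 2))) := by
  set q : ℝ := (2:ℝ) ^ (-((P - 1) / 2)) with hq
  have hq0 : 0 < q := by positivity
  have hq1 : q < 1 := Real.rpow_lt_one_of_one_lt_of_neg (by norm_num) (by linarith)
  have hq2 : (2:ℝ) ^ (1 - P) = q ^ 2 := by
    rw [hq, ← Real.rpow_natCast, ← Real.rpow_mul (by norm_num)]
    congr 1; push_cast; ring
  set E := 1 + D * M0 ^ (1 - P) with hE
  have hE0 : 0 < E := by positivity
  have key : ∀ j : ℕ, ∀ t ∈ Ioo 0 t1, E * ∑ i ∈ Finset.range j, q ^ i ≤ Real.log (1 + t) →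
      2 ^ j * M0 ≤ w t := by
    intro j
    induction j with
    | zero => intro t ht _; simpa using h0 t ht
    | succ j ih =>
      intro t ht hl
      have := step (E * ∑ i ∈ Finset.range j, q ^ i) (2 ^ j * M0) (q ^ j) (by positivity)
        (by positivity) (by positivity) (pow_le_one₀ hq0.le hq1.le) ih t ht ?_
      · rw [pow_succ]; linarith
      · refine le_trans (le_of_eq ?_) hl
        have h1 : ((2:ℝ) ^ j * M0) ^ (1 - P) = q ^ j * q ^ j * M0 ^ (1 - P) := by
          rw [Real.mul_rpow (by positivity) hM0.le, ← Real.rpow_natCast 2 j, ← Real.rpow_mul (by norm_num),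
            mul_comm (j:ℝ), Real.rpow_mul (by norm_num), hq2, Real.rpow_natCast]
          ring
        rw [h1, Finset.sum_range_succ, hE]
        field_simp
        ring
  intro t ht
  by_contra hcon
  push Not at hcon
  have hs : ∀ j : ℕ, E * ∑ i ∈ Finset.range j, q ^ i ≤ E / (1 - q) := by
    intro j
    rw [div_eq_mul_inv]
    gcongr
    rw [← tsum_geometric_of_lt_one hq0.le hq1]
    exact (summable_geometric_of_lt_one hq0.le hq1).sum_le_tsum _ (fun i _ => by positivity)
  obtain ⟨j, hj⟩ := pow_unbounded_of_one_lt (w t / M0) (one_lt_two)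
  have := key j t ht ((hs j).trans hcon.le)
  rw [div_lt_iff₀ hM0] at hj
  linarith

lemma ads_incr {a t1 : ℝ} {W W' G G' : ℝ → ℝ}
    (hW : ∀ t ∈ Ioo a t1, HasDerivAt W (W' t) t) (hWc : ContinuousOn W (Ico a t1))
    (hG : ∀ t ∈ Ioo a t1, HasDerivAt G (G' t) t) (hGc : ContinuousOn G (Ico a t1))
    (h : ∀ t ∈ Ioo a t1, G' t ≤ W' t) :
    ∀ t ∈ Ico a t1, W a + (G t - G a) ≤ W t := by
  intro t ht
  have := monotoneOn_of_deriv_nonneg (D := Ico a t1) (f := fun s => W s - G s) (convex_Ico a t1)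
    (hWc.sub hGc) (by
      rw [interior_Ico]
      intro s hs
      exact ((hW s hs).sub (hG s hs)).differentiableAt.differentiableWithinAt) (by
      rw [interior_Ico]
      intro s hs
      have h2 := ((hW s hs).sub (hG s hs)).deriv
      change deriv (W - G) s ≥ 0
      rw [h2]
      linarith [h s hs])
  have h3 := this (left_mem_Ico.2 (ht.1.trans_lt ht.2)) ht ht.1
  simp only at h3
  linarith

lemma ads_intlow {t s0 : ℝ} {f g : ℝ → ℝ} (hs0 : 0 ≤ s0) (hst : s0 ≤ t)
    (hf : IntervalIntegrable f volume 0 t) (hf0 : ∀ s ∈ Ioo 0 t, 0 ≤ f s)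
    (hg : IntervalIntegrable g volume s0 t) (hgf : ∀ s ∈ Ioo s0 t, g s ≤ f s) :
    ∫ s in s0..t, g s ≤ ∫ s in (0:ℝ)..t, f s := by
  have hf1 : IntervalIntegrable f volume s0 t := hf.mono_set (by
    rw [uIcc_of_le hst, uIcc_of_le (hs0.trans hst)]; exact Icc_subset_Icc_left hs0)
  have hf2 : IntervalIntegrable f volume 0 s0 := hf.mono_set (by
    rw [uIcc_of_le hs0, uIcc_of_le (hs0.trans hst)]; exact Icc_subset_Icc_right hst)
  rw [← intervalIntegral.integral_add_adjacent_intervals hf2 hf1]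
  have h1 : 0 ≤ ∫ s in (0:ℝ)..s0, f s := by
    have := intervalIntegral.integral_mono_on_of_le_Ioo (μ := volume) hs0
      (intervalIntegrable_const (c := (0:ℝ))) hf2 (fun s hs => hf0 s ⟨hs.1, hs.2.trans_le hst⟩)
    simpa using this
  have h2 := intervalIntegral.integral_mono_on_of_le_Ioo (μ := volume) hst hg hf1 hgf
  linarith

lemma ads_ode1 {t1 P δ κ M0 A : ℝ} (hP : 1 < P) (hδ : 0 ≤ δ) (hκ : 0 < κ) (hM0 : 0 < M0)
    (hA : 0 ≤ A) {W W' f : ℝ → ℝ} (hW0 : W 0 = M0)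
    (hW : ∀ t ∈ Ioo 0 t1, HasDerivAt W (W' t) t) (hWc : ContinuousOn W (Ico 0 t1))
    (hf : ∀ t ∈ Ioo 0 t1, IntervalIntegrable f volume 0 t)
    (hfl : ∀ s ∈ Ioo 0 t1, κ * (1 + s) ^ (-1:ℝ) * Real.exp (δ * s) * |W s| ^ P ≤ f s)
    (hWi : ∀ t ∈ Ioo 0 t1, Real.exp (δ * t) * W' t = A + ∫ s in (0:ℝ)..t, f s) :
    ∀ t ∈ Ioo 0 t1, Real.log (1 + t) ≤
      (1 + (1 / (κ * Real.exp (-δ))) * M0 ^ (1 - P)) / (1 - (2:ℝ) ^ (-((P - 1) / 2))) := by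
  have hf0 : ∀ s ∈ Ioo 0 t1, 0 ≤ f s := fun s hs => le_trans (by
    have := hs.1
    positivity) (hfl s hs)
  have hint : ∀ t ∈ Ioo 0 t1, 0 ≤ ∫ s in (0:ℝ)..t, f s := by
    intro t ht
    have := ads_intlow (g := fun _ => 0) le_rfl ht.1.le (hf t ht)
      (fun s hs => hf0 s ⟨hs.1, hs.2.trans ht.2⟩)
      intervalIntegrable_const (fun s hs => hf0 s ⟨hs.1, hs.2.trans ht.2⟩)
    simpa using this
  have hW'0 : ∀ t ∈ Ioo 0 t1, 0 ≤ W' t := by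
    intro t ht
    have h1 := hWi t ht
    have h2 := hint t ht
    have h3 := Real.exp_pos (δ * t)
    by_contra hc
    push Not at hc
    nlinarith
  apply ads_abstract hP (by positivity) hM0 W
  · intro t ht
    have := ads_incr hW hWc (G := fun _ => 0) (G' := fun _ => 0) (fun t _ => hasDerivAt_const t 0)
      continuousOn_const hW'0 t ⟨ht.1.le, ht.2⟩
    simpa [hW0] using this
  · intro x0 M h hx0 hM hh hh1 hyp t ht hlog
    have hex : 1 ≤ Real.exp x0 := Real.one_le_exp hx0
    have heh : Real.exp x0 + h ≤ Real.exp (x0 + h) := by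
      rw [Real.exp_add]
      nlinarith [Real.add_one_le_exp h]
    set a := Real.exp (x0 + h) - 1 with ha
    have ha0 : 0 < a := by linarith
    set κ' := κ * Real.exp (-δ) with hκ'
    have hκ'0 : 0 < κ' := by positivity
    have hat : a ≤ t := by
      have h1 : x0 + h ≤ Real.log (1 + t) := by
        have : 0 ≤ 1 / κ' * M ^ (1 - P) / h := by positivity
        linarith
      have := (Real.le_log_iff_exp_le (by linarith [ht.1])).1 h1
      linarith
    have hder : ∀ s ∈ Ioo a t1, κ' * h * M ^ P * (1 / (1 + s)) ≤ W' s := by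
      intro s hs
      have hs1 : 0 < s := ha0.trans hs.1
      have hs' : s ∈ Ioo 0 t1 := ⟨hs1, hs.2⟩
      have h1 := ads_intlow (s0 := s - h)
        (g := fun _ => κ * (1 + s) ^ (-1:ℝ) * Real.exp (δ * (s - h)) * M ^ P)
        (by linarith [hs.1]) (by linarith) (hf s hs')
        (fun r hr => hf0 r ⟨hr.1, hr.2.trans hs.2⟩) intervalIntegrable_const (by
          intro r hr
          have hr0 : 0 < r := by linarith [hs.1, hr.1]
          have hr1 : r ∈ Ioo 0 t1 := ⟨hr0, hr.2.trans hs.2⟩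
          refine le_trans ?_ (hfl r hr1)
          have hMr := hyp r hr1 ((Real.le_log_iff_exp_le (by linarith)).2 (by linarith [hs.1, hr.1]))
          have e1 : (1 + s) ^ (-1:ℝ) ≤ (1 + r) ^ (-1:ℝ) :=
            Real.rpow_le_rpow_of_nonpos (by linarith) (by linarith [hr.2]) (by norm_num)
          have e2 : M ≤ |W r| := hMr.trans (le_abs_self _)
          have e3 := hr.1.le
          gcongr)
      have h2 := hWi s hs'
      rw [intervalIntegral.integral_const, smul_eq_mul] at h1
      have h3 : Real.exp (δ * s) * (κ' * h * M ^ P * (1 / (1 + s))) ≤ Real.exp (δ * s) * W' s := by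
        rw [h2]
        refine le_trans ?_ (le_trans h1 (by linarith))
        have e5 : Real.exp (δ * s) * Real.exp (-δ) ≤ Real.exp (δ * (s - h)) := by
          rw [← Real.exp_add]
          apply Real.exp_le_exp.2
          nlinarith
        have e6 : (0:ℝ) ≤ κ * h * M ^ P * (1 / (1 + s)) := by positivity
        rw [Real.rpow_neg_one]
        calc _ = κ * h * M ^ P * (1 / (1 + s)) * (Real.exp (δ * s) * Real.exp (-δ)) := by
              rw [hκ']; ring
          _ ≤ κ * h * M ^ P * (1 / (1 + s)) * Real.exp (δ * (s - h)) := by gcongr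
          _ = _ := by ring
      exact le_of_mul_le_mul_left h3 (Real.exp_pos _)
    have hG : ∀ s : ℝ, 0 < s → HasDerivAt (fun s => κ' * h * M ^ P * Real.log (1 + s))
        (κ' * h * M ^ P * (1 / (1 + s))) s := by
      intro s hs
      have := ((hasDerivAt_id s).const_add 1).log (by simp; linarith)
      simpa using this.const_mul (κ' * h * M ^ P)
    have hfin := ads_incr (a := a) (t1 := t1) (fun s hs => hW s ⟨ha0.trans hs.1, hs.2⟩)
      (hWc.mono (Ico_subset_Ico_left ha0.le)) (fun s hs => hG s (ha0.trans hs.1))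
      (fun s hs => (hG s (ha0.trans_le hs.1)).continuousAt.continuousWithinAt) hder t ⟨hat, ht.2⟩
    have hMa : M ≤ W a := hyp a ⟨ha0, hat.trans_lt ht.2⟩ ((Real.le_log_iff_exp_le (by linarith)).2 (by linarith))
    have hla : Real.log (1 + a) = x0 + h := by rw [ha]; ring_nf; rw [Real.log_exp]
    simp only [hla] at hfin
    have hc : 0 < κ' * h * M ^ P := by positivity
    have hMP : M ^ P * M ^ (1 - P) = M := by
      rw [← Real.rpow_add hM]; simp
    have : κ' * h * M ^ P * (1 / κ' * M ^ (1 - P) / h) ≤ κ' * h * M ^ P * (Real.log (1 + t) - (x0 + h)) := by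
      apply mul_le_mul_of_nonneg_left _ hc.le
      linarith
    have e : κ' * h * M ^ P * (1 / κ' * M ^ (1 - P) / h) = M := by
      conv_rhs => rw [← hMP]
      field_simp
    linarith

lemma ads_ode2 {t1 P κ M0 A : ℝ} (hP : 1 < P) (hκ : 0 < κ) (hM0 : 0 < M0)
    (hA : M0 ≤ A) {W W' f : ℝ → ℝ} (hW0 : M0 ≤ W 0)
    (hW : ∀ t ∈ Ioo 0 t1, HasDerivAt W (W' t) t) (hWc : ContinuousOn W (Ico 0 t1))
    (hf : ∀ t ∈ Ioo 0 t1, IntervalIntegrable f volume 0 t)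
    (hfl : ∀ s ∈ Ioo 0 t1, κ * (1 + s) ^ (-1 - P) * |W s| ^ P ≤ f s)
    (hWi : ∀ t ∈ Ioo 0 t1, W' t = A + ∫ s in (0:ℝ)..t, f s) :
    ∀ t ∈ Ioo 0 t1, Real.log (1 + t) ≤
      (1 + (4 / κ) * M0 ^ (1 - P)) / (1 - (2:ℝ) ^ (-((P - 1) / 2))) := by
  have hf0 : ∀ s ∈ Ioo 0 t1, 0 ≤ f s := fun s hs => le_trans (by
    have := hs.1
    positivity) (hfl s hs)
  have hint : ∀ t ∈ Ioo 0 t1, 0 ≤ ∫ s in (0:ℝ)..t, f s := by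
    intro t ht
    have := ads_intlow (g := fun _ => 0) le_rfl ht.1.le (hf t ht)
      (fun s hs => hf0 s ⟨hs.1, hs.2.trans ht.2⟩)
      intervalIntegrable_const (fun s hs => hf0 s ⟨hs.1, hs.2.trans ht.2⟩)
    simpa using this
  have hlin : ∀ (k t : ℝ), HasDerivAt (fun s => k * s) k t := by
    intro k t
    simpa using (hasDerivAt_id t).const_mul k
  have hWpos : ∀ t ∈ Ioo 0 t1, M0 * (1 + t) ≤ W t := by
    intro t ht
    have := ads_incr hW hWc (G := fun t => M0 * t) (G' := fun _ => M0) (fun t _ => hlin M0 t)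
      (by fun_prop) (fun s hs => by rw [hWi s hs]; linarith [hint s hs]) t ⟨ht.1.le, ht.2⟩
    linarith
  apply ads_abstract hP (by positivity) hM0 (fun t => W t / (1 + t))
  · intro t ht
    have := ht.1
    rw [le_div_iff₀ (by linarith)]
    exact hWpos t ht
  · intro x0 M h hx0 hM hh hh1 hyp t ht hlog
    have hex : 1 ≤ Real.exp x0 := Real.one_le_exp hx0
    set y := 4 / κ * M ^ (1 - P) / h with hy
    have hy0 : 0 < y := by positivity
    set a := Real.exp (x0 + y) - 1 with ha
    have haa : Real.exp x0 < Real.exp (x0 + y) := Real.exp_lt_exp.2 (by linarith)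
    have ha0 : 0 < a := by linarith
    have hexp := (Real.le_log_iff_exp_le (by linarith [ht.1])).1 hlog
    have hat : a ≤ t := by
      have : Real.exp (x0 + y) ≤ Real.exp (x0 + h + y) := Real.exp_le_exp.2 (by linarith)
      linarith
    have hder : ∀ s ∈ Ioo a t1, κ * M ^ P * y ≤ W' s := by
      intro s hs
      have hs1 : 0 < s := ha0.trans hs.1
      have hs' : s ∈ Ioo 0 t1 := ⟨hs1, hs.2⟩
      have hne : ∀ r ∈ uIcc (Real.exp x0 - 1) s, 0 < 1 + r := by
        intro r hr
        rw [uIcc_of_le (by linarith [hs.1])] at hr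
        linarith [hr.1]
      have hder2 : ∀ r ∈ uIcc (Real.exp x0 - 1) s, HasDerivAt (fun s => κ * M ^ P * Real.log (1 + s))
          (κ * M ^ P * (1 / (1 + r))) r := by
        intro r hr
        have h0 := hne r hr
        have := ((hasDerivAt_id r).const_add 1).log (by simp; linarith)
        simpa using this.const_mul (κ * M ^ P)
      have hgi : IntervalIntegrable (fun r => κ * M ^ P * (1 / (1 + r))) volume (Real.exp x0 - 1) s := by
        apply ContinuousOn.intervalIntegrable
        apply ContinuousOn.mul continuousOn_const
        apply ContinuousOn.div continuousOn_const (by fun_prop)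
        intro r hr; exact (hne r hr).ne'
      have h1 := ads_intlow (s0 := Real.exp x0 - 1)
        (g := fun r => κ * M ^ P * (1 / (1 + r)))
        (by linarith) (by linarith [hs.1]) (hf s hs')
        (fun r hr => hf0 r ⟨hr.1, hr.2.trans hs.2⟩) hgi (by
          intro r hr
          have hr0 : 0 < r := by linarith [hr.1]
          have hr1 : r ∈ Ioo 0 t1 := ⟨hr0, hr.2.trans hs.2⟩
          refine le_trans ?_ (hfl r hr1)
          have hMr := hyp r hr1 ((Real.le_log_iff_exp_le (by linarith)).2 (by linarith [hs.1, hr.1]))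
          rw [le_div_iff₀ (by linarith)] at hMr
          have e2 : M * (1 + r) ≤ |W r| := hMr.trans (le_abs_self _)
          have e3 : (1 + r) ^ (-1 - P) * (M * (1 + r)) ^ P = M ^ P * (1 / (1 + r)) := by
            have : 0 < 1 + r := by linarith
            rw [Real.mul_rpow hM.le this.le, mul_left_comm, ← Real.rpow_add this]
            simp [Real.rpow_neg_one]
          calc κ * M ^ P * (1 / (1 + r)) = κ * (1 + r) ^ (-1 - P) * (M * (1 + r)) ^ P := by
                rw [mul_assoc, ← e3]; ring
            _ ≤ _ := by gcongr)
      rw [intervalIntegral.integral_eq_sub_of_hasDerivAt hder2 hgi] at h1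
      rw [hWi s hs']
      have e1 : Real.log (1 + (Real.exp x0 - 1)) = x0 := by ring_nf; rw [Real.log_exp]
      rw [e1] at h1
      have e2 : x0 + y ≤ Real.log (1 + s) := (Real.le_log_iff_exp_le (by linarith)).2 (by linarith [hs.1])
      have e3 : κ * M ^ P * y ≤ κ * M ^ P * (Real.log (1 + s) - x0) := by
        gcongr; linarith
      linarith
    have hfin := ads_incr (a := a) (t1 := t1) (fun s hs => hW s ⟨ha0.trans hs.1, hs.2⟩)
      (hWc.mono (Ico_subset_Ico_left ha0.le)) (G := fun s => κ * M ^ P * y * s)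
      (fun s hs => hlin _ s) (by fun_prop) hder t ⟨hat, ht.2⟩
    have hMa : 0 ≤ W a := by
      refine le_trans ?_ (hWpos a ⟨ha0, hat.trans_lt ht.2⟩)
      positivity
    have hMP : M ^ P * M ^ (1 - P) = M := by
      rw [← Real.rpow_add hM]; simp
    have e : κ * M ^ P * y = 4 * M / h := by
      conv_rhs => rw [← hMP]
      rw [hy]; field_simp
    rw [e] at hfin
    have ht1 : 0 < 1 + t := by linarith [ht.1]
    rw [le_div_iff₀ ht1]
    -- 1 + a = exp (x0+y) ≤ (1+t) exp(-h)
    have e7 : (1 + a) * (1 + h) ≤ 1 + t := by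
      refine le_trans ?_ hexp
      have : Real.exp (x0 + h + y) = Real.exp (x0 + y) * Real.exp h := by rw [← Real.exp_add]; ring_nf
      rw [this, ha]
      have := Real.add_one_le_exp h
      have h3 := Real.exp_pos (x0 + y)
      nlinarith
    have e8 : (h / 2) * (1 + t) ≤ t - a := by nlinarith
    have e9 : 4 * M / h * ((h / 2) * (1 + t)) ≤ 4 * M / h * (t - a) := by gcongr
    have e10 : 4 * M / h * ((h / 2) * (1 + t)) = 2 * M * (1 + t) := by field_simp; ring
    linarith

lemma ads_ident {n : ℕ} {c H b m2 p β ε R T t1 : ℝ} {Γ : ℝ → ℝ} {v0 v1 : Eucl n → ℝ}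
    {v vt : ℝ → Eucl n → ℝ} (hc : 0 < c) (hH : 0 < H) (hp : 1 < p) (hR : 0 < R)
    (hv0s : ∀ x, v0 x ≠ 0 → ‖x‖ ≤ R) (hv1s : ∀ x, v1 x ≠ 0 → ‖x‖ ≤ R)
    (h : IsWeakSolADS n c H b m2 p β Γ ε v0 v1 R T v vt) (ht1 : 0 < t1) (ht1T : t1 < T) :
    ∃ g : Eucl n → ℝ, Continuous g ∧ HasCompactSupport g ∧
      (∀ s ∈ Ioc 0 t1, ∫ x, v s x * g x = ∫ x, v s x) ∧
      ∀ η : ℝ → ℝ, ContDiff ℝ (⊤ : ℕ∞) η → ∀ t ∈ Ioo 0 t1,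
        (∫ x, vt t x * g x) * η t - (∫ x, v t x * g x) * deriv η t
          + b * ((∫ x, v t x * g x) * η t)
          + (∫ s in (0:ℝ)..t, (∫ x, v s x * g x) * (deriv (deriv η) s - b * deriv η s + m2 * η s))
        = ε * (η 0 * ∫ x, v1 x) + ε * ((b * η 0 - deriv η 0) * ∫ x, v0 x)
          + ∫ s in (0:ℝ)..t, Γ s * (∫ y, |v s y| ^ p) ^ β * (∫ x, |v s x| ^ p) * η s := by
  set R1 := R + (c / H) * Real.exp (H * t1) with hR1
  have hcH : 0 < c / H := by positivity
  have hRR1 : R < R1 := by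
    have : 0 < (c / H) * Real.exp (H * t1) := by positivity
    linarith
  have hsupp : ∀ s ∈ Ioc 0 t1, ∀ x, v s x ≠ 0 → ‖x‖ < R1 := by
    intro s hs x hx
    have h1 := h.supp s ⟨hs.1, hs.2.trans_lt ht1T⟩ x hx
    have h2 : Real.exp (H * s) ≤ Real.exp (H * t1) := Real.exp_le_exp.2 (by
      have := hs.2; gcongr)
    have : c / H * (Real.exp (H * s) - 1) < c / H * Real.exp (H * t1) := by
      apply mul_lt_mul_of_pos_left _ hcH
      linarith
    linarith
  let ψ : ContDiffBump (0 : Eucl n) := ⟨R1, R1 + 1, by linarith, by linarith⟩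
  let χ : ContDiffBump (0 : ℝ) := ⟨t1, (t1 + T) / 2, ht1, by linarith⟩
  have hψ1 : ∀ x : Eucl n, ‖x‖ < R1 → ψ x = 1 := by
    intro x hx
    apply ψ.one_of_mem_closedBall
    simp only [Metric.mem_closedBall, dist_zero_right]
    exact hx.le
  have hχ1 : ∀ s : ℝ, |s| < t1 → χ s = 1 := by
    intro x hx
    apply χ.one_of_mem_closedBall
    simp only [Metric.mem_closedBall, dist_zero_right, Real.norm_eq_abs]
    exact hx.le
  have hvψ : ∀ s ∈ Ioc 0 t1, ∀ x, v s x * ψ x = v s x := by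
    intro s hs x
    by_cases hx : v s x = 0
    · simp [hx]
    · rw [hψ1 x (hsupp s hs x hx), mul_one]
  have hv0ψ : ∀ x, v0 x * ψ x = v0 x := by
    intro x
    by_cases hx : v0 x = 0
    · simp [hx]
    · rw [hψ1 x ((hv0s x hx).trans_lt hRR1), mul_one]
  have hv1ψ : ∀ x, v1 x * ψ x = v1 x := by
    intro x
    by_cases hx : v1 x = 0
    · simp [hx]
    · rw [hψ1 x ((hv1s x hx).trans_lt hRR1), mul_one]
  refine ⟨ψ, ψ.continuous, ψ.hasCompactSupport, ?_, ?_⟩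
  · intro s hs
    exact integral_congr_ae (Filter.Eventually.of_forall (hvψ s hs))
  intro η hη t ht
  have htest : IsTestFn T (fun s x => χ s * η s * ψ x) := by
    refine ⟨?_, ?_, ?_⟩
    · have h1 : ContDiff ℝ (⊤ : ℕ∞) (χ : ℝ → ℝ) := χ.contDiff
      have h2 : ContDiff ℝ (⊤ : ℕ∞) (ψ : Eucl n → ℝ) := ψ.contDiff
      exact ((h1.comp contDiff_fst).mul (hη.comp contDiff_fst)).mul (h2.comp contDiff_snd)
    · apply HasCompactSupport.of_support_subset_isCompact
        ((isCompact_closedBall (0:ℝ) χ.rOut).prod (isCompact_closedBall (0 : Eucl n) ψ.rOut))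
      intro q hq
      simp only [Function.mem_support, ne_eq, mul_eq_zero, not_or] at hq
      constructor
      · have : q.1 ∈ Function.support χ := hq.1.1
        rw [χ.support_eq] at this
        exact Metric.ball_subset_closedBall this
      · have : q.2 ∈ Function.support ψ := hq.2
        rw [ψ.support_eq] at this
        exact Metric.ball_subset_closedBall this
    · refine ⟨(t1 + T) / 2, by linarith, ?_⟩
      intro s hs x
      have : χ s = 0 := χ.zero_of_le_dist (by
        simp only [dist_zero_right, Real.norm_eq_abs]
        exact hs.le.trans (le_abs_self _))
      simp [this]
  have key := h.identity t ⟨ht.1, ht.2.trans ht1T⟩ _ htest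
  have hev : ∀ s : ℝ, |s| < t1 → ∀ᶠ r in nhds s, |r| < t1 := by
    intro s hs
    exact (continuous_abs.continuousAt (x := s)).eventually (gt_mem_nhds hs)
  have hd1 : ∀ s : ℝ, |s| < t1 → ∀ x, deriv (fun r => χ r * η r * ψ x) s = deriv η s * ψ x := by
    intro s hs x
    have : (fun r => χ r * η r * ψ x) =ᶠ[nhds s] fun r => η r * ψ x := by
      filter_upwards [hev s hs] with r hr
      rw [hχ1 r hr, one_mul]
    rw [this.deriv_eq, deriv_mul_const_field]
  have hd2 : ∀ s : ℝ, |s| < t1 → ∀ x,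
      deriv (deriv (fun r => χ r * η r * ψ x)) s = deriv (deriv η) s * ψ x := by
    intro s hs x
    have : deriv (fun r => χ r * η r * ψ x) =ᶠ[nhds s] fun r => deriv η r * ψ x := by
      filter_upwards [hev s hs] with r hr
      exact hd1 r hr x
    rw [this.deriv_eq, deriv_mul_const_field]
  have hlap : ∀ s : ℝ, ∀ x : Eucl n, ‖x‖ < R1 → lapl (fun y => χ s * η s * ψ y) x = 0 := by
    intro s x hx
    unfold lapl
    apply Finset.sum_eq_zero
    intro i _
    have hev2 : ∀ z : Eucl n, ‖z‖ < R1 → ∀ᶠ y in nhds z, ‖y‖ < R1 := fun z hz =>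
      (continuous_norm.continuousAt (x := z)).eventually (gt_mem_nhds hz)
    have hf1 : ∀ z : Eucl n, ‖z‖ < R1 → fderiv ℝ (fun y => χ s * η s * ψ y) z = 0 := by
      intro z hz
      have : (fun y => χ s * η s * ψ y) =ᶠ[nhds z] fun y => χ s * η s * 1 := by
        filter_upwards [hev2 z hz] with y hy
        rw [hψ1 y hy]
      rw [this.fderiv_eq]
      simp
    have : (fun y => fderiv ℝ (fun y => χ s * η s * ψ y) y (EuclideanSpace.single i 1))
        =ᶠ[nhds x] fun y => (0:ℝ) := by
      filter_upwards [hev2 x hx] with y hy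
      rw [hf1 y hy]; simp
    rw [this.fderiv_eq]
    simp
  have ht' : |t| < t1 := by rw [abs_of_pos ht.1]; exact ht.2
  have h0' : |(0:ℝ)| < t1 := by simpa using ht1
  have hs' : ∀ s ∈ Ioc 0 t, |s| < t1 ∧ s ∈ Ioc 0 t1 := by
    intro s hs
    rw [abs_of_pos hs.1]
    exact ⟨hs.2.trans_lt ht.2, hs.1, hs.2.trans ht.2.le⟩
  have i1 : ∫ x, vt t x * (χ t * η t * ψ x) = (∫ x, vt t x * ψ x) * η t := by
    rw [← integral_mul_const]
    congr 1; ext x; rw [hχ1 t ht']; ring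
  have i2 : ∫ x, v t x * deriv (fun s => χ s * η s * ψ x) t = (∫ x, v t x * ψ x) * deriv η t := by
    rw [← integral_mul_const]
    congr 1; ext x; rw [hd1 t ht']; ring
  have i3 : ∫ x, v t x * (χ t * η t * ψ x) = (∫ x, v t x * ψ x) * η t := by
    rw [← integral_mul_const]
    congr 1; ext x; rw [hχ1 t ht']; ring
  have i4 : ∫ x, v1 x * (χ 0 * η 0 * ψ x) = η 0 * ∫ x, v1 x := by
    rw [← integral_const_mul]
    congr 1; ext x; rw [hχ1 0 h0']
    linear_combination η 0 * hv1ψ x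
  have i5 : ∫ x, v0 x * (b * (χ 0 * η 0 * ψ x) - deriv (fun s => χ s * η s * ψ x) 0)
      = (b * η 0 - deriv η 0) * ∫ x, v0 x := by
    rw [← integral_const_mul]
    congr 1; ext x; rw [hχ1 0 h0', hd1 0 h0']
    linear_combination (b * η 0 - deriv η 0) * hv0ψ x
  have i6 : (∫ s in (0:ℝ)..t, ∫ x, v s x *
            (deriv (deriv (fun r => χ r * η r * ψ x)) s
              - c ^ 2 * exp (2 * H * s) * lapl (fun y => χ s * η s * ψ y) x
              - b * deriv (fun r => χ r * η r * ψ x) s + m2 * (χ s * η s * ψ x)))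
      = ∫ s in (0:ℝ)..t, (∫ x, v s x * ψ x) * (deriv (deriv η) s - b * deriv η s + m2 * η s) := by
    apply intervalIntegral.integral_congr_ae
    refine Filter.Eventually.of_forall ?_
    intro s hs
    rw [uIoc_of_le ht.1.le] at hs
    obtain ⟨hs1, hs2⟩ := hs' s hs
    rw [← integral_mul_const]
    congr 1; ext x
    by_cases hx : v s x = 0
    · simp [hx]
    · rw [hd2 s hs1, hd1 s hs1, hlap s x (hsupp s hs2 x hx), hχ1 s hs1]; ring
  have i7 : (∫ s in (0:ℝ)..t, Γ s * (∫ y, |v s y| ^ p) ^ β * (∫ x, |v s x| ^ p * (χ s * η s * ψ x)))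
      = ∫ s in (0:ℝ)..t, Γ s * (∫ y, |v s y| ^ p) ^ β * (∫ x, |v s x| ^ p) * η s := by
    apply intervalIntegral.integral_congr_ae
    refine Filter.Eventually.of_forall ?_
    intro s hs
    rw [uIoc_of_le ht.1.le] at hs
    obtain ⟨hs1, hs2⟩ := hs' s hs
    rw [mul_assoc _ (∫ x, |v s x| ^ p), ← integral_mul_const]
    congr 2; ext x
    by_cases hx : v s x = 0
    · have : p ≠ 0 := by linarith
      simp [hx, Real.zero_rpow this]
    · rw [hψ1 x (hsupp s hs2 x hx), hχ1 s hs1]; ring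
  rw [i1, i2, i3, i4, i5, i6, i7] at key
  exact key

lemma ads_holder {n : ℕ} {p r : ℝ} (hp : 1 < p) (hr : 0 < r) {u : Eucl n → ℝ} (hu : Integrable u)
    (hup : Integrable (fun x => |u x| ^ p)) (hs : ∀ x, u x ≠ 0 → ‖x‖ ≤ r) :
    |∫ x, u x| ^ p ≤ (∫ x, |u x| ^ p) * (volume.real (Metric.closedBall (0 : Eucl n) r)) ^ (p - 1) := by
  set B := Metric.closedBall (0 : Eucl n) r
  have hq := Real.HolderConjugate.conjExponent hp
  set q := p.conjExponent
  have hp0 : 0 < p := by linarith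
  have hBm : MeasurableSet B := measurableSet_closedBall
  have hBf : volume B ≠ ⊤ := measure_closedBall_lt_top.ne
  have h1 : MemLp (fun x => |u x|) (ENNReal.ofReal p) volume := by
    have := (integrable_norm_rpow_iff (f := fun x => |u x|) (μ := volume) (p := ENNReal.ofReal p)
      (hu.abs.aestronglyMeasurable)
      (by simpa using hp0) (by simp)).1 (by
        rw [ENNReal.toReal_ofReal hp0.le]
        simpa using hup)
    exact this
  have h2 : MemLp (B.indicator (fun _ => (1:ℝ))) (ENNReal.ofReal q) volume :=
    memLp_indicator_const _ hBm 1 (Or.inr hBf)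
  have h3 := integral_mul_le_Lp_mul_Lq_of_nonneg hq
    (Filter.Eventually.of_forall fun x => abs_nonneg (u x))
    (Filter.Eventually.of_forall fun x => Set.indicator_nonneg (fun _ _ => zero_le_one) x) h1 h2
  have e1 : ∀ x, |u x| * B.indicator (fun _ => (1:ℝ)) x = |u x| := by
    intro x
    by_cases hx : u x = 0
    · simp [hx]
    · have : x ∈ B := by simpa [B] using hs x hx
      simp [this]
  have e2 : ∀ x, (B.indicator (fun _ => (1:ℝ)) x) ^ q = B.indicator (fun _ => (1:ℝ)) x := by
    intro x
    by_cases hx : x ∈ B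
    · simp [hx]
    · simp [hx, Real.zero_rpow hq.symm.ne_zero]
  simp only [e1, e2] at h3
  have e3 : ∫ a, B.indicator (fun _ => (1:ℝ)) a = volume.real B := integral_indicator_one hBm
  rw [e3] at h3
  set N := ∫ x, |u x| ^ p
  have hN : 0 ≤ N := integral_nonneg fun x => by positivity
  have hB0 : 0 ≤ volume.real B := measureReal_nonneg
  calc |∫ x, u x| ^ p ≤ (N ^ (1 / p) * (volume.real B) ^ (1 / q)) ^ p := by
        gcongr
        exact (abs_integral_le_integral_abs).trans h3
    _ = N * (volume.real B) ^ (p - 1) := by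
        rw [Real.mul_rpow (by positivity) (by positivity), ← Real.rpow_mul hN, ← Real.rpow_mul hB0]
        congr 1
        · rw [one_div, inv_mul_cancel₀ hp0.ne', Real.rpow_one]
        · congr 1
          have := hq.inv_add_inv_eq_one
          have h4 : 1 / q = 1 - p⁻¹ := by rw [one_div]; linarith
          rw [h4]; field_simp

lemma ads_low {n : ℕ} {c H b m2 p β ε R T : ℝ} {Γ : ℝ → ℝ} {v0 v1 : Eucl n → ℝ}
    {v vt : ℝ → Eucl n → ℝ} (hc : 0 < c) (hH : 0 < H) (hβ : 0 ≤ β) (hp : 1 < p) (hR : 0 < R)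
    (h : IsWeakSolADS n c H b m2 p β Γ ε v0 v1 R T v vt) {s : ℝ} (hs : s ∈ Ioo 0 T) :
    ((R + c / H) ^ n * volume.real (Metric.closedBall (0 : Eucl n) 1)) ^ (-((p - 1) * (β + 1)))
      * Real.exp (-(n * H * (p - 1) * (β + 1)) * s) * |∫ x, v s x| ^ ((β + 1) * p)
      ≤ (∫ y, |v s y| ^ p) ^ β * (∫ x, |v s x| ^ p) := by
  have hs' : s ∈ Ico 0 T := ⟨hs.1.le, hs.2⟩
  set Λ := (R + c / H) ^ n * volume.real (Metric.closedBall (0 : Eucl n) 1) with hΛ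
  have hcH : 0 < c / H := by positivity
  have hvol1 : 0 < volume.real (Metric.closedBall (0 : Eucl n) 1) :=
    ENNReal.toReal_pos (Metric.measure_closedBall_pos _ _ one_pos).ne' measure_closedBall_lt_top.ne
  have hΛ0 : 0 < Λ := by positivity
  set r := (R + c / H) * Real.exp (H * s) with hr
  have hr0 : 0 < r := by positivity
  have he1 : 1 ≤ Real.exp (H * s) := Real.one_le_exp (by have := hs.1; positivity)
  have h1 := ads_holder hp hr0 (h.integ_v s hs') (h.integ_pow s hs') (by
    intro x hx
    refine (h.supp s hs x hx).trans ?_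
    rw [hr]
    nlinarith)
  have hvr : volume.real (Metric.closedBall (0 : Eucl n) r) = Λ * Real.exp (n * H * s) := by
    rw [Measure.addHaar_real_closedBall' _ _ hr0.le, finrank_euclideanSpace_fin, hr, mul_pow,
      ← Real.exp_nat_mul, hΛ]
    ring_nf
  rw [hvr] at h1
  set N := ∫ x, |v s x| ^ p
  have hN : 0 ≤ N := integral_nonneg fun x => by positivity
  set V := |∫ x, v s x|
  have hV : 0 ≤ V := abs_nonneg _
  have h2 : V ^ ((β + 1) * p) ≤ N ^ (β + 1) * (Λ * Real.exp (n * H * s)) ^ ((p - 1) * (β + 1)) := by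
    have := Real.rpow_le_rpow (by positivity) h1 (show 0 ≤ β + 1 by linarith)
    rw [← Real.rpow_mul hV, Real.mul_rpow hN (by positivity), ← Real.rpow_mul (by positivity)] at this
    rwa [mul_comm p] at this
  have h3 : N ^ β * N = N ^ (β + 1) := by
    rw [Real.rpow_add_one' hN (by linarith)]
  rw [h3]
  have h4 : Λ ^ (-((p - 1) * (β + 1))) * Real.exp (-(n * H * (p - 1) * (β + 1)) * s)
      * (Λ * Real.exp (n * H * s)) ^ ((p - 1) * (β + 1)) = 1 := by
    rw [Real.mul_rpow hΛ0.le (by positivity), ← Real.exp_mul, Real.rpow_neg hΛ0.le]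
    have : Real.exp (-(n * H * (p - 1) * (β + 1)) * s) * Real.exp (n * H * s * ((p - 1) * (β + 1))) = 1 := by
      rw [← Real.exp_add, ← Real.exp_zero]; ring_nf
    have h5 : Λ ^ ((p - 1) * (β + 1)) ≠ 0 := by positivity
    calc _ = ((Λ ^ ((p - 1) * (β + 1)))⁻¹ * Λ ^ ((p - 1) * (β + 1))) * (Real.exp (-(n * H * (p - 1) * (β + 1)) * s) * Real.exp (n * H * s * ((p - 1) * (β + 1)))) := by ring
      _ = 1 := by rw [this, inv_mul_cancel₀ h5, one_mul]
  calc _ ≤ Λ ^ (-((p - 1) * (β + 1))) * Real.exp (-(n * H * (p - 1) * (β + 1)) * s)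
        * (N ^ (β + 1) * (Λ * Real.exp (n * H * s)) ^ ((p - 1) * (β + 1))) := by gcongr
    _ = N ^ (β + 1) * (Λ ^ (-((p - 1) * (β + 1))) * Real.exp (-(n * H * (p - 1) * (β + 1)) * s)
      * (Λ * Real.exp (n * H * s)) ^ ((p - 1) * (β + 1))) := by ring
    _ = _ := by rw [h4, mul_one]

lemma ads_core {n : ℕ} {c H b m2 p β ε R T t1 μ ς δ : ℝ} {v0 v1 : Eucl n → ℝ}
    {v vt : ℝ → Eucl n → ℝ} (hc : 0 < c) (hH : 0 < H) (hβ : 0 ≤ β) (hp : 1 < p) (hR : 0 < R)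
    (hμ : 0 < μ) (hδ : δ ^ 2 = b ^ 2 - 4 * m2)
    (hv0s : ∀ x, v0 x ≠ 0 → ‖x‖ ≤ R) (hv1s : ∀ x, v1 x ≠ 0 → ‖x‖ ≤ R)
    (h : IsWeakSolADS n c H b m2 p β
      (fun t => μ * exp (((1/2) * (b - δ) * ((β + 1) * p - 1)
              + n * H * (β + 1) * (p - 1)) * t) * (1 + t) ^ ς) ε v0 v1 R T v vt)
    (ht1 : 0 < t1) (ht1T : t1 < T) :
    ∃ W W' f : ℝ → ℝ, W 0 = ε * ∫ x, v0 x ∧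
      (∀ t ∈ Ioo 0 t1, HasDerivAt W (W' t) t) ∧ ContinuousOn W (Ico 0 t1) ∧
      (∀ t ∈ Ioo 0 t1, IntervalIntegrable f volume 0 t) ∧
      (∀ s ∈ Ioo 0 t1, (μ * ((R + c / H) ^ n * volume.real (Metric.closedBall (0 : Eucl n) 1)) ^
        (-((p - 1) * (β + 1)))) * (1 + s) ^ ς * Real.exp (δ * s) * |W s| ^ ((β + 1) * p) ≤ f s) ∧
      (∀ t ∈ Ioo 0 t1, Real.exp (δ * t) * W' t =
        ε * ((∫ x, v1 x) + (b - δ) / 2 * ∫ x, v0 x) + ∫ s in (0:ℝ)..t, f s) := by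
  set Γ := (fun t => μ * exp (((1/2) * (b - δ) * ((β + 1) * p - 1)
              + n * H * (β + 1) * (p - 1)) * t) * (1 + t) ^ ς) with hΓ
  obtain ⟨g, hg, hgc, hgV, hid⟩ := ads_ident hc hH hp hR hv0s hv1s h ht1 ht1T
  obtain ⟨hder, hcont⟩ := h.c1 g hg hgc
  set V := fun t => ∫ x, v t x * g x with hV
  set U := fun t => ∫ x, vt t x * g x with hU
  set F := fun s => Γ s * (∫ y, |v s y| ^ p) ^ β * (∫ x, |v s x| ^ p) with hF
  have hVc : ContinuousOn V (Ico 0 T) := fun t ht => (hder t ht).continuousWithinAt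
  have hsub : Icc 0 t1 ⊆ Ico 0 T := fun t ht => ⟨ht.1, ht.2.trans_lt ht1T⟩
  have hVd : ∀ t ∈ Ioo 0 t1, HasDerivAt V (U t) t := fun t ht =>
    (hder t ⟨ht.1.le, ht.2.trans ht1T⟩).hasDerivAt (Ico_mem_nhds ht.1 (ht.2.trans ht1T))
  have hFi1 : IntervalIntegrable F volume 0 t1 := h.nonlin_L1loc t1 ⟨ht1.le, ht1T⟩
  have hFi : ∀ t ∈ Ioo 0 t1, IntervalIntegrable F volume 0 t := fun t ht =>
    h.nonlin_L1loc t ⟨ht.1.le, ht.2.trans ht1T⟩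
  -- initial value
  have hV0 : V 0 = ε * ∫ x, v0 x := by
    have hident := hid (fun s => s) contDiff_id
    have hu : Icc (0:ℝ) t1 = uIcc 0 t1 := (uIcc_of_le ht1.le).symm
    let Q := fun t => U t * t - V t * 1 + b * (V t * t)
      + (∫ s in (0:ℝ)..t, V s * (0 - b * 1 + m2 * s)) - ∫ s in (0:ℝ)..t, F s * s
    have hQ : ∀ t ∈ Ioo 0 t1, Q t = - (ε * ∫ x, v0 x) := by
      intro t ht
      have := hident t ht
      simp only [deriv_id'', deriv_const'] at this
      simp only [Q, hU, hV, hF]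
      linarith
    have hQc : ContinuousOn Q (Icc 0 t1) := by
      have hV1 := hVc.mono hsub
      have hU1 : ContinuousOn U (Icc 0 t1) := hcont.mono hsub
      have a1 : ContinuousOn (fun t => ∫ s in (0:ℝ)..t, V s * (0 - b * 1 + m2 * s)) (Icc 0 t1) := by
        rw [hu]
        apply intervalIntegral.continuousOn_primitive_interval
        rw [← hu]
        apply ContinuousOn.integrableOn_Icc
        fun_prop
      have a2 : ContinuousOn (fun t => ∫ s in (0:ℝ)..t, F s * s) (Icc 0 t1) := by
        rw [hu]
        apply intervalIntegral.continuousOn_primitive_interval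
        have := hFi1.mul_continuousOn (g := fun s => s) continuousOn_id
        rw [intervalIntegrable_iff_integrableOn_Icc_of_le ht1.le] at this
        rw [← hu]; exact this
      fun_prop
    have hQ0 : Q 0 = - V 0 := by simp [Q]
    have hlim : Filter.Tendsto Q (nhdsWithin 0 (Ioo 0 t1)) (nhds (Q 0)) :=
      (hQc 0 ⟨le_rfl, ht1.le⟩).mono_left (nhdsWithin_mono _ Ioo_subset_Icc_self)
    have hlim2 : Filter.Tendsto Q (nhdsWithin 0 (Ioo 0 t1)) (nhds (- (ε * ∫ x, v0 x))) := by
      refine tendsto_const_nhds.congr' ?_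
      filter_upwards [self_mem_nhdsWithin] with t ht
      exact (hQ t ht).symm
    haveI : (nhdsWithin (0:ℝ) (Ioo 0 t1)).NeBot := by
      rw [nhdsWithin_Ioo_eq_nhdsGT ht1]; infer_instance
    have := tendsto_nhds_unique hlim hlim2
    linarith
  set a := (b - δ) / 2 with ha
  set l := (b + δ) / 2 with hl
  have hexpd : ∀ k t : ℝ, HasDerivAt (fun s => Real.exp (k * s)) (k * Real.exp (k * t)) t := by
    intro k t
    have := ((hasDerivAt_id t).const_mul k).exp
    simp only [id, mul_one] at this
    rw [mul_comm]; exact this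
  refine ⟨fun t => Real.exp (a * t) * V t, fun t => a * Real.exp (a * t) * V t + Real.exp (a * t) * U t,
    fun s => F s * Real.exp (l * s), ?_, ?_, ?_, ?_, ?_, ?_⟩
  · simp [hV0]
  · intro t ht
    exact (hexpd a t).mul (hVd t ht)
  · have : ContinuousOn V (Ico 0 t1) := hVc.mono (Ico_subset_Ico_right ht1T.le)
    exact ContinuousOn.mul (by fun_prop) this
  · intro t ht
    exact (hFi t ht).mul_continuousOn (by fun_prop)
  · intro s hs
    have hlow := ads_low hc hH hβ hp hR h (s := s) ⟨hs.1, hs.2.trans ht1T⟩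
    have hVs : V s = ∫ x, v s x := hgV s ⟨hs.1, hs.2.le⟩
    rw [← hVs] at hlow
    set Λ := ((R + c / H) ^ n * volume.real (Metric.closedBall (0 : Eucl n) 1)) ^
        (-((p - 1) * (β + 1)))
    have h1s : 0 < 1 + s := by linarith [hs.1]
    have hΓ0 : 0 ≤ Γ s := by
      simp only [hΓ]; positivity
    have habs : |Real.exp (a * s) * V s| ^ ((β + 1) * p) = Real.exp (a * s * ((β + 1) * p)) * |V s| ^ ((β + 1) * p) := by
      rw [abs_mul, abs_of_pos (Real.exp_pos _), Real.mul_rpow (by positivity) (by positivity), ← Real.exp_mul]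
    have hexps : Real.exp (δ * s) * Real.exp (a * s * ((β + 1) * p)) =
        exp (((1/2) * (b - δ) * ((β + 1) * p - 1) + n * H * (β + 1) * (p - 1)) * s)
        * Real.exp (-(n * H * (p - 1) * (β + 1)) * s) * Real.exp (l * s) := by
      rw [← Real.exp_add, ← Real.exp_add, ← Real.exp_add]
      congr 1
      rw [ha, hl]; ring
    calc μ * Λ * (1 + s) ^ ς * Real.exp (δ * s) * |Real.exp (a * s) * V s| ^ ((β + 1) * p)
        = μ * Λ * (1 + s) ^ ς * (Real.exp (δ * s) * Real.exp (a * s * ((β + 1) * p))) * |V s| ^ ((β + 1) * p) := by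
          rw [habs]; ring
      _ = Γ s * (Λ * Real.exp (-(n * H * (p - 1) * (β + 1)) * s) * |V s| ^ ((β + 1) * p)) * Real.exp (l * s) := by
          rw [hexps, hΓ]; ring
      _ ≤ Γ s * ((∫ y, |v s y| ^ p) ^ β * (∫ x, |v s x| ^ p)) * Real.exp (l * s) := by
          gcongr
      _ = F s * Real.exp (l * s) := by rw [hF]; ring
  · intro t ht
    have := hid (fun s => Real.exp (l * s)) (by fun_prop) t ht
    have hd1 : deriv (fun s => Real.exp (l * s)) = fun s => l * Real.exp (l * s) :=
      funext fun s => (hexpd l s).deriv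
    have hd2 : deriv (fun s => l * Real.exp (l * s)) = fun s => l * (l * Real.exp (l * s)) :=
      funext fun s => ((hexpd l s).const_mul l).deriv
    have hz : ∀ s, l * (l * Real.exp (l * s)) - b * (l * Real.exp (l * s)) + m2 * Real.exp (l * s) = 0 := by
      intro s
      have : l * l - b * l + m2 = 0 := by rw [hl]; linear_combination hδ / 4
      linear_combination Real.exp (l * s) * this
    simp only [hd1, hd2, hz, mul_zero, intervalIntegral.integral_zero, add_zero, Real.exp_zero] at this
    have hE : Real.exp (δ * t) * Real.exp (a * t) = Real.exp (l * t) := by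
      rw [← Real.exp_add]; congr 1; rw [ha, hl]; ring
    change U t * _ - V t * _ + b * (V t * _) = _ + ∫ s in (0:ℝ)..t, F s * Real.exp (l * s) at this
    have e1 : b - l = a := by rw [ha, hl]; ring
    calc Real.exp (δ * t) * (a * Real.exp (a * t) * V t + Real.exp (a * t) * U t)
        = (Real.exp (δ * t) * Real.exp (a * t)) * (a * V t + U t) := by ring
      _ = _ := by
        rw [hE]
        linear_combination this - V t * Real.exp (l * t) * e1 + (ε * ∫ x, v0 x) * e1
/-- **Theorem 6 (anti-de Sitter, logarithmic growth, low-dimensional case).**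
Blow-up and lifespan estimate for the semilinear wave equation in anti-de Sitter spacetime
when `n/2 − √(b²−4m²)/(2H) ≤ 1/p` and `Γ(t) = μ e^{ϱ_crit t}(1+t)^{κ_crit}` with
`ϱ_crit = ½(b−√(b²−4m²))((β+1)p−1) + nH(β+1)(p−1)` and `κ_crit = −1` if `b² > 4m²`,
`κ_crit = −1−(β+1)p` if `b² = 4m²`. The lifespan satisfies
`T(ε) ≤ C exp(K ε^{−((β+1)p−1)})`. -/
theorem antiDeSitter_blowup_logarithmic_growth_low_dim
    (n : ℕ) (hn : 1 ≤ n) (c H b m2 β p ς μ R : ℝ)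
    (hc : 0 < c) (hH : 0 < H) (hb : 0 ≤ b) (hm2 : 0 ≤ m2) (hdom : 4 * m2 ≤ b ^ 2)
    (hβ : 0 ≤ β) (hp : 1 < p)
    (hdim : (n : ℝ) / 2 - Real.sqrt (b ^ 2 - 4 * m2) / (2 * H) ≤ 1 / p)
    (hς₁ : 4 * m2 < b ^ 2 → ς = -1)
    (hς₂ : b ^ 2 = 4 * m2 → ς = -1 - (β + 1) * p)
    (hμ : 0 < μ) (hR : 0 < R)
    (v0 v1 : Eucl n → ℝ)
    (hv0 : ∀ x, 0 ≤ v0 x) (hv1 : ∀ x, 0 ≤ v1 x)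
    (hv0i : Integrable v0) (hv1i : Integrable v1)
    (hv0s : ∀ x, v0 x ≠ 0 → ‖x‖ ≤ R) (hv1s : ∀ x, v1 x ≠ 0 → ‖x‖ ≤ R)
    (hv0nt : 0 < ∫ x, v0 x) (hv1nt : 0 < ∫ x, v1 x) :
    ∃ ε₀ > 0, ∃ C > 0, ∃ K > 0, ∀ ε : ℝ, 0 < ε → ε ≤ ε₀ →
      -- the weak solution blows up in finite time: there is no global-in-time weak solution
      (¬ ∃ v vt : ℝ → Eucl n → ℝ, ∀ T : ℝ, 0 < T →
          IsWeakSolADS n c H b m2 p β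
            (fun t => μ * exp (((1/2) * (b - Real.sqrt (b ^ 2 - 4 * m2)) * ((β + 1) * p - 1)
              + n * H * (β + 1) * (p - 1)) * t) * (1 + t) ^ ς) ε v0 v1 R T v vt) ∧
      -- upper bound estimate for the lifespan
      (∀ T : ℝ, 0 < T → ∀ v vt : ℝ → Eucl n → ℝ,
        IsWeakSolADS n c H b m2 p β
          (fun t => μ * exp (((1/2) * (b - Real.sqrt (b ^ 2 - 4 * m2)) * ((β + 1) * p - 1)
            + n * H * (β + 1) * (p - 1)) * t) * (1 + t) ^ ς) ε v0 v1 R T v vt →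
        T ≤ C * exp (K * ε ^ (-((β + 1) * p - 1)))) := by
  set δ := Real.sqrt (b ^ 2 - 4 * m2) with hδd
  have hδ0 : 0 ≤ δ := Real.sqrt_nonneg _
  have hδ : δ ^ 2 = b ^ 2 - 4 * m2 := Real.sq_sqrt (by linarith)
  have hδb : δ ≤ b := by
    rw [hδd]; exact Real.sqrt_le_iff.2 ⟨hb, by linarith⟩
  set P := (β + 1) * p with hPd
  have hP : 1 < P := by rw [hPd]; nlinarith
  set q : ℝ := (2:ℝ) ^ (-((P - 1) / 2)) with hq
  have hq1 : q < 1 := Real.rpow_lt_one_of_one_lt_of_neg (by norm_num) (by linarith)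
  have hvol1 : 0 < volume.real (Metric.closedBall (0 : Eucl n) 1) :=
    ENNReal.toReal_pos (Metric.measure_closedBall_pos _ _ one_pos).ne' measure_closedBall_lt_top.ne
  set κ := μ * ((R + c / H) ^ n * volume.real (Metric.closedBall (0 : Eucl n) 1)) ^
        (-((p - 1) * (β + 1))) with hκd
  have hκ : 0 < κ := by positivity
  obtain ⟨D, I, hD, hI, hmain⟩ : ∃ D I : ℝ, 0 < D ∧ 0 < I ∧ ∀ ε : ℝ, 0 < ε → ∀ T : ℝ, 0 < T →
      ∀ v vt : ℝ → Eucl n → ℝ, IsWeakSolADS n c H b m2 p β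
          (fun t => μ * exp (((1/2) * (b - δ) * (P - 1)
            + n * H * (β + 1) * (p - 1)) * t) * (1 + t) ^ ς) ε v0 v1 R T v vt →
      ∀ t1, 0 < t1 → t1 < T → ∀ t ∈ Ioo 0 t1,
        Real.log (1 + t) ≤ (1 + D * (ε * I) ^ (1 - P)) / (1 - q) := by
    rcases hdom.lt_or_eq with hlt | heq
    · refine ⟨1 / (κ * Real.exp (-δ)), ∫ x, v0 x, by positivity, hv0nt, ?_⟩
      intro ε hε T hT v vt hsol t1 ht1 ht1T
      obtain ⟨W, W', f, hW0, hW, hWc, hf, hfl, hWi⟩ :=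
        ads_core hc hH hβ hp hR hμ hδ hv0s hv1s hsol ht1 ht1T
      rw [hς₁ hlt] at hfl
      refine ads_ode1 hP hδ0 hκ (by positivity) ?_ hW0 hW hWc hf hfl hWi
      have : 0 ≤ (b - δ) / 2 := by linarith
      positivity
    · have hδz : δ = 0 := by
        have : δ ^ 2 = 0 := by rw [hδ]; linarith
        exact pow_eq_zero_iff (two_ne_zero) |>.1 this
      refine ⟨4 / κ, min (∫ x, v0 x) (∫ x, v1 x), by positivity, lt_min hv0nt hv1nt, ?_⟩
      intro ε hε T hT v vt hsol t1 ht1 ht1T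
      obtain ⟨W, W', f, hW0, hW, hWc, hf, hfl, hWi⟩ :=
        ads_core hc hH hβ hp hR hμ hδ hv0s hv1s hsol ht1 ht1T
      have hm := lt_min hv0nt hv1nt
      rw [hς₂ heq.symm] at hfl
      refine ads_ode2 (A := ε * ((∫ x, v1 x) + (b - δ) / 2 * ∫ x, v0 x)) hP hκ (by positivity) ?_ ?_ hW hWc hf ?_ ?_
      · gcongr
        have : 0 ≤ (b - δ) / 2 * ∫ x, v0 x := mul_nonneg (by linarith) hv0nt.le
        linarith [min_le_right (∫ x, v0 x) (∫ x, v1 x)]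
      · rw [hW0]; gcongr; exact min_le_left _ _
      · intro s hs
        have := hfl s hs
        rw [hδz] at this
        simpa using this
      · intro t ht
        have := hWi t ht
        rw [← this, hδz]; simp
  have hbound : ∀ ε : ℝ, 0 < ε → ∀ T : ℝ, 0 < T →
      ∀ v vt : ℝ → Eucl n → ℝ, IsWeakSolADS n c H b m2 p β
          (fun t => μ * exp (((1/2) * (b - δ) * (P - 1)
            + n * H * (β + 1) * (p - 1)) * t) * (1 + t) ^ ς) ε v0 v1 R T v vt →
      T ≤ Real.exp (1 / (1 - q)) * Real.exp (D * I ^ (1 - P) / (1 - q) * ε ^ (-(P - 1))) := by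
    intro ε hε T hT v vt hsol
    apply le_of_forall_lt_imp_le_of_dense
    intro t htT
    rcases le_or_gt t 0 with h0 | h0
    · exact h0.trans (by positivity)
    have h1 := hmain ε hε T hT v vt hsol ((t + T) / 2) (by linarith) (by linarith) t ⟨h0, by linarith⟩
    rw [Real.log_le_iff_le_exp (by linarith), Real.mul_rpow hε.le hI.le] at h1
    rw [← Real.exp_add]
    refine le_trans (by linarith) (h1.trans (le_of_eq ?_))
    congr 1
    rw [neg_sub]; ring
  refine ⟨1, one_pos, Real.exp (1 / (1 - q)), Real.exp_pos _, D * I ^ (1 - P) / (1 - q), ?_, ?_⟩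
  · have : 0 < 1 - q := by linarith
    positivity
  intro ε hε _
  refine ⟨?_, fun T hT v vt hsol => hbound ε hε T hT v vt hsol⟩
  rintro ⟨v, vt, hall⟩
  have hpos : 0 < Real.exp (1 / (1 - q)) * Real.exp (D * I ^ (1 - P) / (1 - q) * ε ^ (-(P - 1))) := by
    positivity
  have := hbound ε hε _ (by linarith) v vt (hall
    (Real.exp (1 / (1 - q)) * Real.exp (D * I ^ (1 - P) / (1 - q) * ε ^ (-(P - 1))) + 1) (by linarith))
  linarith
end
end

section
/- (Induction step of the slicing iteration, exponential case.) Let q > 1, α₁ ≤ α₂ real, r ∈ ℝ, μ, C > 0, κ ∈ ℝ with positive part κ₊ and negative part κ₋, and let U : [0,T) → ℝ be continuous and nonnegative and satisfy U(t) ≥ μ C (1+t)^{−κ₋} e^{−α₂ t} ∫₀ᵗ e^{(α₂−α₁)s} ∫₀ˢ e^{(α₁+r)τ} τ^{κ₊} U(τ)^q dτ ds for all t ∈ [0,T). Suppose that for some constants C' > 0, a ∈ ℝ, b' ≥ 0, β' ≥ 0 and L > 0 one has U(t) ≥ C' e^{at}(t − L)^{b'}(1+t)^{−β'} for all t ∈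 [L, T). Let ℓ, ℓ' > 1 and assume (α₁ + r + qa) L ≥ 1 and (α₂ + r + qa) ℓ L ≥ 1. Then for all t ∈ [ℓℓ'L, T): U(t) ≥ [ μ C (C')^q (ℓℓ')^{−(κ₊ + q b')} (1 − e^{−(ℓ−1)})(1 − e^{−(ℓ'−1)}) / ((α₁ + r + qa)(α₂ + r + qa)) ] · e^{(r + qa)t} (t − ℓℓ'L)^{κ₊ + q b'} (1+t)^{−(κ₋ + qβ')}. -/
open Real Set

noncomputable section

theorem key_lower (f : ℝ → ℝ) (s m B D x : ℝ) (hm : 1 < m) (hB : 0 < B) (hD : 0 ≤ D)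
    (hx : 0 < x) (hxs : m * x ≤ s) (h1 : 1 ≤ B * x) (hf : ContinuousOn f (Icc 0 s))
    (hf0 : ∀ y ∈ Icc 0 s, 0 ≤ f y) (hlow : ∀ y ∈ Icc (s / m) s, D * exp (B * y) ≤ f y) :
    D * (exp (B * s) * (1 - exp (-(m - 1))) / B) ≤ ∫ y in (0:ℝ)..s, f y := by
  have hm0 : 0 < m := by linarith
  have hs : 0 < s := lt_of_lt_of_le (by positivity) hxs
  have hsm0 : 0 < s / m := by positivity
  have hsm : s / m ≤ s := div_le_self hs.le hm.le
  have hxm : x ≤ s / m := by rw [le_div_iff₀ hm0]; linarith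
  have i1 : IntervalIntegrable f MeasureTheory.volume 0 (s / m) :=
    (hf.mono (Icc_subset_Icc le_rfl hsm)).intervalIntegrable_of_Icc hsm0.le
  have i2 : IntervalIntegrable f MeasureTheory.volume (s / m) s :=
    (hf.mono (Icc_subset_Icc hsm0.le le_rfl)).intervalIntegrable_of_Icc hsm
  rw [← intervalIntegral.integral_add_adjacent_intervals i1 i2]
  have e1 : 0 ≤ ∫ y in (0:ℝ)..(s / m), f y :=
    intervalIntegral.integral_nonneg hsm0.le
      (fun y hy => hf0 y ⟨hy.1, hy.2.trans hsm⟩)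
  have e2 : (∫ y in (s / m)..s, D * exp (B * y)) ≤ ∫ y in (s / m)..s, f y :=
    intervalIntegral.integral_mono_on hsm
      ((by fun_prop : Continuous fun y => D * exp (B * y)).intervalIntegrable _ _) i2 hlow
  have e3 : (∫ y in (s / m)..s, D * exp (B * y))
      = D * ((exp (B * s) - exp (B * (s / m))) / B) := by
    rw [intervalIntegral.integral_const_mul, intervalIntegral.integral_comp_mul_left _ hB.ne',
      integral_exp, smul_eq_mul]
    ring
  have e4 : exp (B * s) * (1 - exp (-(m - 1))) ≤ exp (B * s) - exp (B * (s / m)) := by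
    have : exp (B * (s / m)) ≤ exp (B * s) * exp (-(m - 1)) := by
      rw [← exp_add]
      apply exp_le_exp.2
      have h3 : 1 ≤ B * (s / m) := h1.trans (by gcongr)
      have h4 : B * s = B * (s / m) * m := by field_simp
      nlinarith
    linarith
  have e5 : D * (exp (B * s) * (1 - exp (-(m - 1))) / B)
      ≤ D * ((exp (B * s) - exp (B * (s / m))) / B) := by gcongr
  linarith

/-- **Induction step of the slicing iteration argument (exponential case).**
Let `q > 1`, `α₁ ≤ α₂`, `r ∈ ℝ`, `μ, C > 0`, `κ ∈ ℝ` with positive part `κ₊ = max κ 0`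
and negative part `κ₋ = max (−κ) 0`, and let `U : [0,T) → ℝ` (with `T ∈ (0,∞]`) be
continuous, nonnegative and satisfy the iteration frame
`U(t) ≥ μC(1+t)^{−κ₋}e^{−α₂t} ∫₀ᵗ e^{(α₂−α₁)s} ∫₀ˢ e^{(α₁+r)τ} τ^{κ₊} U(τ)^q dτ ds`.
If `U(t) ≥ C' e^{at}(t−L)^{b'}(1+t)^{−β'}` on `[L,T)` and `ℓ, ℓ' > 1` satisfy
`(α₁+r+qa)L ≥ 1` and `(α₂+r+qa)ℓL ≥ 1`, then for every `t ∈ [ℓℓ'L, T)`: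
`U(t) ≥ [μC(C')^q (ℓℓ')^{−(κ₊+qb')} (1−e^{−(ℓ−1)})(1−e^{−(ℓ'−1)}) /
  ((α₁+r+qa)(α₂+r+qa))] e^{(r+qa)t}(t−ℓℓ'L)^{κ₊+qb'}(1+t)^{−(κ₋+qβ')}`. -/
theorem slicing_iteration_induction_step
    (T : EReal) (hT : 0 < T) (q α₁ α₂ r μ C κ : ℝ)
    (hq : 1 < q) (hα : α₁ ≤ α₂) (hμ : 0 < μ) (hC : 0 < C)
    (U : ℝ → ℝ)
    (hUcont : ContinuousOn U {s : ℝ | 0 ≤ s ∧ (s : EReal) < T})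
    (hUnonneg : ∀ t : ℝ, 0 ≤ t → (t : EReal) < T → 0 ≤ U t)
    (hframe : ∀ t : ℝ, 0 ≤ t → (t : EReal) < T →
      μ * C * (1 + t) ^ (-(max (-κ) 0)) * exp (-(α₂ * t)) *
          (∫ s in (0:ℝ)..t, exp ((α₂ - α₁) * s) *
            ∫ τ in (0:ℝ)..s, exp ((α₁ + r) * τ) * τ ^ (max κ 0) * U τ ^ q)
        ≤ U t)
    (C' a b' β' L : ℝ) (hC' : 0 < C') (hb' : 0 ≤ b') (hβ' : 0 ≤ β') (hL : 0 < L)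
    (hlow : ∀ t : ℝ, L ≤ t → (t : EReal) < T →
      C' * exp (a * t) * (t - L) ^ b' * (1 + t) ^ (-β') ≤ U t)
    (ℓ ℓ' : ℝ) (hℓ : 1 < ℓ) (hℓ' : 1 < ℓ')
    (h1 : 1 ≤ (α₁ + r + q * a) * L) (h2 : 1 ≤ (α₂ + r + q * a) * (ℓ * L)) :
    ∀ t : ℝ, ℓ * ℓ' * L ≤ t → (t : EReal) < T →
      (μ * C * C' ^ q * (ℓ * ℓ') ^ (-(max κ 0 + q * b')) *
          (1 - exp (-(ℓ - 1))) * (1 - exp (-(ℓ' - 1))) /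
          ((α₁ + r + q * a) * (α₂ + r + q * a))) *
        exp ((r + q * a) * t) * (t - ℓ * ℓ' * L) ^ (max κ 0 + q * b') *
        (1 + t) ^ (-(max (-κ) 0 + q * β'))
      ≤ U t := by
  intro t ht htT
  set k := max κ 0 with hk
  have hk0 : 0 ≤ k := le_max_right _ _
  set A := α₁ + r + q * a with hA
  set B := α₂ + r + q * a with hB
  have hA0 : 0 < A := by
    by_contra h
    nlinarith
  have hB0 : 0 < B := by linarith
  have hl0 : 0 < ℓ := by linarith
  have hl0' : 0 < ℓ' := by linarith
  have hq0 : 0 < q := by linarith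
  have hp0 : 0 ≤ k + q * b' := by positivity
  have ht0 : 0 < t := lt_of_lt_of_le (by positivity) ht
  have hsT : ∀ s : ℝ, s ≤ t → (s : EReal) < T := fun s hs =>
    lt_of_le_of_lt (EReal.coe_le_coe_iff.2 hs) htT
  set g : ℝ → ℝ := fun τ => exp ((α₁ + r) * τ) * τ ^ k * U τ ^ q with hg
  have hgc : ContinuousOn g (Icc 0 t) := by
    have hU : ContinuousOn U (Icc 0 t) :=
      hUcont.mono (fun s hs => ⟨hs.1, hsT s hs.2⟩)
    refine ContinuousOn.mul (ContinuousOn.mul ?_ ?_) ?_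
    · exact (by fun_prop : Continuous fun τ : ℝ => exp ((α₁ + r) * τ)).continuousOn
    · exact (Real.continuous_rpow_const hk0).continuousOn
    · exact hU.rpow_const (fun x _ => Or.inr hq0.le)
  have hg0 : ∀ y ∈ Icc 0 t, 0 ≤ g y := by
    intro y hy
    have h1 := hUnonneg y hy.1 (hsT y hy.2)
    have h2 := hy.1
    simp only [hg]
    positivity
  have hglow : ∀ y, L ≤ y → y ≤ t →
      C' ^ q * (1 + t) ^ (-(q * β')) * (y - L) ^ (k + q * b') * exp (A * y) ≤ g y := by
    intro y hLy hyt
    have hy0 : 0 < y := by linarith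
    have hyL : 0 ≤ y - L := by linarith
    have h1 := hlow y hLy (hsT y hyt)
    have h2 : (C' * exp (a * y) * (y - L) ^ b' * (1 + y) ^ (-β')) ^ q ≤ U y ^ q :=
      Real.rpow_le_rpow (by positivity) h1 hq0.le
    have h3 : (C' * exp (a * y) * (y - L) ^ b' * (1 + y) ^ (-β')) ^ q
        = C' ^ q * exp (q * a * y) * (y - L) ^ (q * b') * (1 + y) ^ (-(q * β')) := by
      rw [Real.mul_rpow (by positivity) (by positivity),
        Real.mul_rpow (by positivity) (by positivity),
        Real.mul_rpow (by positivity) (by positivity), ← Real.exp_mul,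
        ← Real.rpow_mul hyL, ← Real.rpow_mul (by positivity)]
      rw [show a * y * q = q * a * y by ring, show b' * q = q * b' by ring,
        show -β' * q = -(q * β') by ring]
    have h4 : (1 + t) ^ (-(q * β')) ≤ (1 + y) ^ (-(q * β')) :=
      Real.rpow_le_rpow_of_nonpos (by positivity) (by linarith)
        (by have : 0 ≤ q * β' := by positivity
            linarith)
    have h5 : (y - L) ^ k ≤ y ^ k := Real.rpow_le_rpow hyL (by linarith) hk0
    have h6 : exp (A * y) = exp ((α₁ + r) * y) * exp (q * a * y) := by
      rw [← exp_add]; congr 1; rw [hA]; ring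
    rw [Real.rpow_add_of_nonneg hyL hk0 (by positivity), h6]
    calc _ = exp ((α₁ + r) * y) * (y - L) ^ k *
          (C' ^ q * exp (q * a * y) * (y - L) ^ (q * b') * (1 + t) ^ (-(q * β'))) := by ring
      _ ≤ exp ((α₁ + r) * y) * y ^ k *
          (C' ^ q * exp (q * a * y) * (y - L) ^ (q * b') * (1 + y) ^ (-(q * β'))) := by
          gcongr
      _ ≤ exp ((α₁ + r) * y) * y ^ k * U y ^ q := by
          rw [← h3]; gcongr
  have he : 0 < 1 - exp (-(ℓ - 1)) := by
    have : exp (-(ℓ - 1)) < 1 := by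
      simpa using hℓ
    linarith
  have hin : ∀ s, ℓ * L ≤ s → s ≤ t →
      C' ^ q * (1 + t) ^ (-(q * β')) * (s / ℓ - L) ^ (k + q * b') *
        (exp (A * s) * (1 - exp (-(ℓ - 1))) / A) ≤ ∫ τ in (0:ℝ)..s, g τ := by
    intro s hs hst
    have hsl : L ≤ s / ℓ := by rw [le_div_iff₀ hl0]; linarith
    have hsl0 : 0 ≤ s / ℓ - L := by linarith
    refine key_lower g s ℓ A _ L hℓ hA0 (by positivity) hL hs h1
      (hgc.mono (Icc_subset_Icc le_rfl hst)) (fun y hy => hg0 y ⟨hy.1, hy.2.trans hst⟩) ?_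
    intro y hy
    refine le_trans ?_ (hglow y (hsl.trans hy.1) (hy.2.trans hst))
    have := hy.1
    gcongr
  have hGc : ContinuousOn (fun s => exp ((α₂ - α₁) * s) * ∫ τ in (0:ℝ)..s, g τ) (Icc 0 t) := by
    refine ContinuousOn.mul
      (by fun_prop : Continuous fun s : ℝ => exp ((α₂ - α₁) * s)).continuousOn ?_
    have := intervalIntegral.continuousOn_primitive_interval (μ := MeasureTheory.volume)
      (f := g) (a := 0) (b := t) (by
        rw [uIcc_of_le ht0.le]
        exact hgc.integrableOn_Icc)
    rwa [uIcc_of_le ht0.le] at this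
  have htl : ℓ * L ≤ t / ℓ' := by rw [le_div_iff₀ hl0']; linarith
  have htl2 : 0 ≤ t / ℓ' / ℓ - L := by
    have : L ≤ t / ℓ' / ℓ := by rw [le_div_iff₀ hl0]; linarith
    linarith
  have hout := key_lower (fun s => exp ((α₂ - α₁) * s) * ∫ τ in (0:ℝ)..s, g τ) t ℓ' B
    (C' ^ q * (1 + t) ^ (-(q * β')) * (t / ℓ' / ℓ - L) ^ (k + q * b') *
        ((1 - exp (-(ℓ - 1))) / A)) (ℓ * L) hℓ' hB0 (by positivity) (by positivity)
    (by linarith) h2 hGc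
    (fun y hy => mul_nonneg (exp_pos _).le (intervalIntegral.integral_nonneg hy.1
      (fun z hz => hg0 z ⟨hz.1, hz.2.trans hy.2⟩)))
    (by
      intro s hs
      have h3 := hs.1
      have h4 : exp (B * s) = exp ((α₂ - α₁) * s) * exp (A * s) := by
        rw [← exp_add]; congr 1; rw [hA, hB]; ring
      refine le_trans ?_ (mul_le_mul_of_nonneg_left (hin s (htl.trans hs.1) hs.2)
        (exp_pos ((α₂ - α₁) * s)).le)
      rw [h4]
      calc _ = exp ((α₂ - α₁) * s) * (C' ^ q * (1 + t) ^ (-(q * β')) *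
            (t / ℓ' / ℓ - L) ^ (k + q * b') *
            (exp (A * s) * (1 - exp (-(ℓ - 1))) / A)) := by ring
        _ ≤ _ := by gcongr)
  refine le_trans ?_ (hframe t ht0.le htT)
  refine le_trans (le_of_eq ?_) (mul_le_mul_of_nonneg_left hout (by positivity))
  have e1 : t / ℓ' / ℓ - L = (ℓ * ℓ')⁻¹ * (t - ℓ * ℓ' * L) := by field_simp
  have e2 : (t / ℓ' / ℓ - L) ^ (k + q * b')
      = (ℓ * ℓ') ^ (-(k + q * b')) * (t - ℓ * ℓ' * L) ^ (k + q * b') := by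
    rw [e1, Real.mul_rpow (by positivity) (by linarith), Real.inv_rpow (by positivity),
      Real.rpow_neg (by positivity)]
  have e3 : (1 + t) ^ (-(max (-κ) 0 + q * β'))
      = (1 + t) ^ (-(max (-κ) 0)) * (1 + t) ^ (-(q * β')) := by
    rw [← Real.rpow_add (by positivity)]; congr 1; ring
  have e4 : exp ((r + q * a) * t) = exp (-(α₂ * t)) * exp (B * t) := by
    rw [← exp_add]; congr 1; rw [hB]; ring
  rw [e2, e3, e4]
  field_simp
end
end

section
/- Let q > 1, D > 0, σ > 0 and let (C_j)_{j≥0} be a sequence of positive real numbers satisfying C_j ≥ D q^{−σ j} C_{j−1}^q for all j ≥ 1. Then for every j ≥ 0: ln C_j ≥ q^j ( ln C₀ − σ q ln q/(q−1)² + ln D/(q−1) ) + σ q ln q/(q−1)² + σ j ln q/(q−1) − ln D/(q−1). In particular, for every integer j ≥ (ln D)/(σ ln q) − q/(q−1) one has ln C_j ≥ q^j ( ln C₀ − σ q ln q/(q−1)² + ln D/(q−1) ). -/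
open Real

noncomputable section

/-- **Logarithmic lower bound for the iteratively defined constants.**
If `q > 1`, `D > 0`, `σ > 0` and `(C_j)` is a sequence of positive reals with
`C_j ≥ D q^{−σj} C_{j−1}^q` for all `j ≥ 1`, then for all `j ≥ 0`
`ln C_j ≥ q^j (ln C₀ − σq ln q/(q−1)² + ln D/(q−1)) + σq ln q/(q−1)²
  + σ j ln q/(q−1) − ln D/(q−1)`,
and in particular `ln C_j ≥ q^j (ln C₀ − σq ln q/(q−1)² + ln D/(q−1))` for every integer
`j ≥ (ln D)/(σ ln q) − q/(q−1)`. -/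
theorem iterative_constants_log_lower_bound
    (q D σ : ℝ) (hq : 1 < q) (hD : 0 < D) (hσ : 0 < σ)
    (C : ℕ → ℝ) (hpos : ∀ j, 0 < C j)
    (hrec : ∀ j : ℕ, 1 ≤ j → D * q ^ (-(σ * (j : ℝ))) * C (j - 1) ^ q ≤ C j) :
    (∀ j : ℕ,
      q ^ j * (Real.log (C 0) - σ * q * Real.log q / (q - 1) ^ 2
          + Real.log D / (q - 1))
        + σ * q * Real.log q / (q - 1) ^ 2
        + σ * (j : ℝ) * Real.log q / (q - 1) - Real.log D / (q - 1)
      ≤ Real.log (C j)) ∧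
    (∀ j : ℕ, Real.log D / (σ * Real.log q) - q / (q - 1) ≤ (j : ℝ) →
      q ^ j * (Real.log (C 0) - σ * q * Real.log q / (q - 1) ^ 2
          + Real.log D / (q - 1))
        ≤ Real.log (C j)) := by
  have hq0 : 0 < q := by linarith
  have hq1 : 0 < q - 1 := by linarith
  have hne : q - 1 ≠ 0 := hq1.ne'
  have hl : 0 < Real.log q := Real.log_pos hq
  have key : ∀ j : ℕ,
      q ^ j * (Real.log (C 0) - σ * q * Real.log q / (q - 1) ^ 2
          + Real.log D / (q - 1))
        + σ * q * Real.log q / (q - 1) ^ 2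
        + σ * (j : ℝ) * Real.log q / (q - 1) - Real.log D / (q - 1)
      ≤ Real.log (C j) := by
    intro j
    induction j with
    | zero => simp; linarith
    | succ j ih =>
      have h := hrec (j + 1) (by omega)
      rw [Nat.add_sub_cancel] at h
      have h1 : 0 < q ^ (-(σ * ((j + 1 : ℕ) : ℝ))) := Real.rpow_pos_of_pos hq0 _
      have h2 : 0 < C j ^ q := Real.rpow_pos_of_pos (hpos j) _
      have h3 := Real.log_le_log (by positivity) h
      rw [Real.log_mul (by positivity) h2.ne', Real.log_mul hD.ne' h1.ne',
        Real.log_rpow hq0, Real.log_rpow (hpos j)] at h3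
      refine le_trans ?_ h3
      have h4 := mul_le_mul_of_nonneg_left ih hq0.le
      refine le_trans (le_of_eq ?_) (add_le_add_right h4 _)
      generalize Real.log (C 0) = c
      generalize Real.log D = d
      generalize Real.log q = l
      push_cast
      rw [pow_succ]
      field_simp
      ring
  refine ⟨key, fun j hj => le_trans ?_ (key j)⟩
  have h5 : Real.log D ≤ ((j : ℝ) + q / (q - 1)) * (σ * Real.log q) := by
    rw [← div_le_iff₀ (by positivity)]
    linarith
  have h6 := div_le_div_of_nonneg_right h5 hq1.le
  have h7 : ((j : ℝ) + q / (q - 1)) * (σ * Real.log q) / (q - 1)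
      = σ * q * Real.log q / (q - 1) ^ 2 + σ * (j : ℝ) * Real.log q / (q - 1) := by
    field_simp
    ring
  linarith
end
end

section
/- Let c, H > 0 and b, m² ≥ 0 with b² ≥ 4m². Then there exist a twice continuously differentiable, strictly positive function λ : [0,∞) → ℝ and constants 0 < λ₀ ≤ Λ₀ such that: (i) λ''(t) − b λ'(t) + (m² − c² e^{2Ht}) λ(t) = 0 for all t ≥ 0; (ii) λ₀ e^{(b−H)t/2} exp(−(c/H) e^{Ht}) ≤ λ(t) ≤ Λ₀ e^{(b−H)t/2} exp(−(c/H) e^{Ht}) for all t ≥ 0; (iii) b λ(t) − λ'(t) ≥ 0 for all t ≥ 0. -/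
open Real Set

noncomputable section

open MeasureTheory

lemma bk_cosh_lower (s : ℝ) : 1 + s ^ 2 / 2 ≤ cosh s := by
  have h1 : cosh s = 1 + 2 * sinh (s / 2) ^ 2 := by
    have h := Real.cosh_two_mul (s / 2)
    rw [Real.cosh_sq] at h
    rw [show 2 * (s / 2) = s by ring] at h
    rw [h]; ring
  have h2 : (s / 2) ^ 2 ≤ sinh (s / 2) ^ 2 := by
    apply sq_le_sq.2
    rw [Real.abs_sinh]
    exact Real.self_le_sinh_iff.2 (abs_nonneg _)
  rw [h1]; nlinarith

lemma bk_cosh_upper (s : ℝ) (h0 : 0 ≤ s) (h1 : s ≤ 1) : cosh s ≤ 1 + s ^ 2 := by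
  have h := Real.cosh_le_exp_half_sq s
  have hs : s ^ 2 ≤ 1 := by nlinarith
  have h2 := Real.abs_exp_sub_one_sub_id_le (x := s ^ 2 / 2)
    (by rw [abs_of_nonneg (by positivity)]; linarith)
  have h3 := (abs_le.1 h2).2
  nlinarith [sq_nonneg s]

/-- The integrand. -/
def bkI (ν : ℝ) (j : ℕ) (z s : ℝ) : ℝ := cosh s ^ j * exp (-(z * cosh s) + ν * s)

/-- The integral. -/
def bkJ (ν : ℝ) (j : ℕ) (z : ℝ) : ℝ := ∫ s, bkI ν j z s

lemma bkI_cont (ν : ℝ) (j : ℕ) (z : ℝ) : Continuous (bkI ν j z) := by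
  unfold bkI
  have := Real.continuous_cosh
  fun_prop

lemma bkI_pos (ν : ℝ) (j : ℕ) (z s : ℝ) : 0 < bkI ν j z s := by
  unfold bkI
  have := Real.cosh_pos s
  positivity

lemma bkI_integrable (ν : ℝ) (j : ℕ) {z : ℝ} (hz : 0 < z) : Integrable (bkI ν j z) := by
  have hg := (integrable_exp_neg_mul_sq (show 0 < z / 4 by positivity)).const_mul
    ((j.factorial : ℝ) * (4 / z) ^ j * exp (2 * ν ^ 2 / z))
  refine hg.mono' (bkI_cont ν j z).aestronglyMeasurable (Filter.Eventually.of_forall fun s => ?_)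
  rw [Real.norm_of_nonneg (bkI_pos ν j z s).le]
  have hx := Real.cosh_pos s
  have h1 := Real.pow_div_factorial_le_exp _ (show 0 ≤ z / 4 * cosh s by positivity) j
  have hf : (0:ℝ) < j.factorial := by exact_mod_cast j.factorial_pos
  rw [div_le_iff₀ hf] at h1
  have h2 : cosh s ^ j ≤ (j.factorial : ℝ) * (4 / z) ^ j * exp (z / 4 * cosh s) := by
    calc cosh s ^ j = (4 / z) ^ j * (z / 4 * cosh s) ^ j := by
          rw [← mul_pow]; congr 1; field_simp
      _ ≤ (4 / z) ^ j * (exp (z / 4 * cosh s) * j.factorial) := by gcongr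
      _ = _ := by ring
  have h3 : ν * s ≤ 2 * ν ^ 2 / z + z * s ^ 2 / 8 := by
    have : 2 * ν ^ 2 / z + z * s ^ 2 / 8 - ν * s = 2 / z * (ν - z * s / 4) ^ 2 := by
      field_simp; ring
    have h : 0 ≤ 2 / z * (ν - z * s / 4) ^ 2 := by positivity
    linarith
  have h4 := mul_le_mul_of_nonneg_left (bk_cosh_lower s) hz.le
  unfold bkI
  calc cosh s ^ j * exp (-(z * cosh s) + ν * s)
      ≤ ((j.factorial : ℝ) * (4 / z) ^ j * exp (z / 4 * cosh s))
          * exp (-(z * cosh s) + ν * s) := by gcongr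
    _ = (j.factorial : ℝ) * (4 / z) ^ j *
          exp (z / 4 * cosh s + (-(z * cosh s) + ν * s)) := by rw [exp_add (z / 4 * cosh s)]; ring
    _ ≤ (j.factorial : ℝ) * (4 / z) ^ j * exp (2 * ν ^ 2 / z + -(z / 4) * s ^ 2) := by
        refine mul_le_mul_of_nonneg_left (exp_le_exp.2 ?_) (by positivity)
        nlinarith
    _ = _ := by rw [exp_add]; ring

lemma bkJ_deriv (ν : ℝ) (j : ℕ) {z : ℝ} (hz : 0 < z) :
    HasDerivAt (bkJ ν j) (-bkJ ν (j + 1) z) z := by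
  have h := (hasDerivAt_integral_of_dominated_loc_of_deriv_le (μ := volume)
    (F := fun x s => bkI ν j x s) (F' := fun x s => -bkI ν (j + 1) x s) (x₀ := z)
    (bound := bkI ν (j + 1) (z / 2)) (s := Ioi (z / 2)) (Ioi_mem_nhds (by linarith))
    (Filter.Eventually.of_forall fun x => (bkI_cont ν j x).aestronglyMeasurable)
    (bkI_integrable ν j hz) (bkI_cont ν (j + 1) z).neg.aestronglyMeasurable
    (Filter.Eventually.of_forall fun s x hx => ?_)
    (bkI_integrable ν (j + 1) (by positivity))
    (Filter.Eventually.of_forall fun s x hx => ?_)).2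
  · rw [integral_neg] at h
    exact h
  · rw [norm_neg, Real.norm_of_nonneg (bkI_pos _ _ _ _).le]
    have hc := Real.cosh_pos s
    have hx' : z / 2 ≤ x := le_of_lt hx
    unfold bkI
    gcongr
  · unfold bkI
    have h1 : HasDerivAt (fun x : ℝ => -(x * cosh s) + ν * s) (-(1 * cosh s)) x :=
      (((hasDerivAt_id x).mul_const (cosh s)).neg).add_const _
    have h2 := (h1.exp).const_mul (cosh s ^ j)
    refine h2.congr_deriv ?_
    ring

lemma bkJ_ode (ν : ℝ) {z : ℝ} (hz : 0 < z) :
    z ^ 2 * bkJ ν 2 z - z * bkJ ν 1 z - (z ^ 2 + ν ^ 2) * bkJ ν 0 z = 0 := by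
  have i0 := bkI_integrable ν 0 hz
  have i1 := bkI_integrable ν 1 hz
  have i2 := bkI_integrable ν 2 hz
  have i20 := (i2.const_mul (z ^ 2)).sub (i1.const_mul z)
  have i3 := i20.sub (i0.const_mul (z ^ 2 + ν ^ 2))
  have key := integral_eq_zero_of_hasDerivAt_of_integrable
    (f := fun s => -((z * sinh s + ν) * bkI ν 0 z s)) (fun s => ?_) i3 ?_
  · rw [integral_sub' i20 (i0.const_mul _),
      integral_sub' (i2.const_mul _) (i1.const_mul _)] at key
    simp only [integral_const_mul] at key
    exact key
  · have h1 : HasDerivAt (fun s : ℝ => -(z * cosh s) + ν * s) (-(z * sinh s) + ν * 1) s :=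
      (((Real.hasDerivAt_cosh s).const_mul z).neg).add ((hasDerivAt_id s).const_mul ν)
    have h2 := (((((Real.hasDerivAt_sinh s).const_mul z).add_const ν).mul h1.exp)).neg
    have e : (fun s => -((z * sinh s + ν) * bkI ν 0 z s)) =
      -((fun s => z * sinh s + ν) * fun s => exp (-(z * cosh s) + ν * s)) := by
      funext s; simp [bkI]
    rw [e]
    convert h2 using 1
    simp only [Pi.sub_apply, bkI]
    have := Real.cosh_sq s
    linear_combination (exp (-(z * cosh s) + ν * s)) * z ^ 2 * this
  · refine ((i1.const_mul z).add (i0.const_mul |ν|)).mono' ?_ (Filter.Eventually.of_forall fun s => ?_)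
    · have := bkI_cont ν 0 z
      have h := Real.continuous_sinh
      exact Continuous.aestronglyMeasurable (by fun_prop)
    · rw [norm_neg, norm_mul, Real.norm_of_nonneg (bkI_pos _ _ _ _).le, Real.norm_eq_abs]
      have hs : |sinh s| ≤ cosh s := by
        rw [Real.abs_sinh, ← Real.cosh_abs s]; exact (Real.sinh_lt_cosh _).le
      have h3 : |z * sinh s + ν| ≤ z * cosh s + |ν| := by
        refine (abs_add_le _ _).trans ?_
        rw [abs_mul, abs_of_pos hz]
        gcongr
      have h4 := mul_le_mul_of_nonneg_right h3 (bkI_pos ν 0 z s).le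
      refine h4.trans (le_of_eq ?_)
      simp only [bkI, Pi.add_apply]
      ring

lemma bkJ_nonneg (ν : ℝ) (j : ℕ) (z : ℝ) : 0 ≤ bkJ ν j z :=
  integral_nonneg fun s => (bkI_pos ν j z s).le

lemma bkJ_upper (ν : ℝ) {w₀ w : ℝ} (h0 : 0 < w₀) (hw : w₀ ≤ w) :
    bkJ ν 0 (w ^ 2) ≤ exp (ν ^ 2 / w₀ ^ 2) * (2 * √π) * (w⁻¹ * exp (-w ^ 2)) := by
  have hw' : 0 < w := h0.trans_le hw
  have hq : 0 < w ^ 2 / 4 := by positivity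
  have hg := (integrable_exp_neg_mul_sq hq).const_mul (exp (ν ^ 2 / w₀ ^ 2) * exp (-w ^ 2))
  have h := integral_mono (bkI_integrable ν 0 (show 0 < w ^ 2 by positivity)) hg (fun s => ?_)
  · rw [integral_const_mul, integral_gaussian] at h
    refine h.trans (le_of_eq ?_)
    have : √(π / (w ^ 2 / 4)) = 2 * √π * w⁻¹ := by
      rw [show π / (w ^ 2 / 4) = (2 * w⁻¹) ^ 2 * π by field_simp; ring,
        Real.sqrt_mul (by positivity), Real.sqrt_sq (by positivity)]
      ring
    rw [this]; ring
  · have h3 : ν * s ≤ ν ^ 2 / w ^ 2 + w ^ 2 * s ^ 2 / 4 := by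
      have : ν ^ 2 / w ^ 2 + w ^ 2 * s ^ 2 / 4 - ν * s = (ν / w - w * s / 2) ^ 2 := by
        field_simp; ring
      have h : 0 ≤ (ν / w - w * s / 2) ^ 2 := by positivity
      linarith
    have h4 := mul_le_mul_of_nonneg_left (bk_cosh_lower s) (sq_nonneg w)
    have h5 : ν ^ 2 / w ^ 2 ≤ ν ^ 2 / w₀ ^ 2 := by gcongr
    simp only [bkI, pow_zero, one_mul]
    rw [← exp_add, ← exp_add]
    apply exp_le_exp.2
    nlinarith

lemma bkJ_lower {ν : ℝ} (hν : 0 ≤ ν) {w₀ w δ : ℝ} (h0 : 0 < w₀) (hw : w₀ ≤ w) (hδ : 0 < δ)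
    (hδ1 : δ ≤ w₀) :
    δ * exp (-δ ^ 2) * (w⁻¹ * exp (-w ^ 2)) ≤ bkJ ν 0 (w ^ 2) := by
  have hw' : 0 < w := h0.trans_le hw
  have hi := bkI_integrable ν 0 (show 0 < w ^ 2 by positivity)
  have h1 : ∫ s in Icc 0 (δ / w), bkI ν 0 (w ^ 2) s ≤ bkJ ν 0 (w ^ 2) :=
    setIntegral_le_integral hi (Filter.Eventually.of_forall fun s => (bkI_pos _ _ _ _).le)
  refine le_trans ?_ h1
  have h2 := setIntegral_ge_of_const_le (μ := volume) (s := Icc 0 (δ / w))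
    (f := bkI ν 0 (w ^ 2)) (c := exp (-w ^ 2 + -δ ^ 2)) measurableSet_Icc (by simp)
    (fun s hs => ?_) hi.integrableOn
  · refine le_trans (le_of_eq ?_) h2
    rw [Real.volume_real_Icc_of_le (by positivity), exp_add, smul_eq_mul]
    ring
  · obtain ⟨hs0, hs1⟩ := hs
    have hd : δ / w ≤ 1 := by rw [div_le_one hw']; linarith
    have hc := mul_le_mul_of_nonneg_left (bk_cosh_upper s hs0 (hs1.trans hd)) (sq_nonneg w)
    have hws : (w * s) ^ 2 ≤ δ ^ 2 := by
      have : w * s ≤ δ := by rw [le_div_iff₀ hw'] at hs1; linarith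
      gcongr
    have : 0 ≤ ν * s := by positivity
    simp only [bkI, pow_zero, one_mul]
    apply exp_le_exp.2
    nlinarith

/-- **Existence of the positive solution `λ` of the adjoint time equation.**
For `c, H > 0` and `b, m² ≥ 0` with `b² ≥ 4m²` there exist a twice continuously
differentiable strictly positive function `λ : [0,∞) → ℝ` and constants `0 < λ₀ ≤ Λ₀`
such that
(i)  `λ'' − bλ' + (m² − c²e^{2Ht})λ = 0` on `[0,∞)`;
(ii) `λ₀ e^{(b−H)t/2} e^{−(c/H)e^{Ht}} ≤ λ(t) ≤ Λ₀ e^{(b−H)t/2} e^{−(c/H)e^{Ht}}` on `[0,∞)`;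
(iii) `bλ(t) − λ'(t) ≥ 0` on `[0,∞)`.
(In the paper, `λ(t) = e^{(b/2)t} K_ν((c/H)e^{Ht})` with `ν = √(b²−4m²)/(2H)`.) -/
theorem exists_adjoint_multiplier
    (c H b m2 : ℝ) (hc : 0 < c) (hH : 0 < H) (hb : 0 ≤ b) (hm2 : 0 ≤ m2)
    (hdom : 4 * m2 ≤ b ^ 2) :
    ∃ (lam lam' lam'' : ℝ → ℝ) (lam₀ Lam₀ : ℝ),
      0 < lam₀ ∧ lam₀ ≤ Lam₀ ∧
      (∀ t ∈ Ici (0:ℝ), HasDerivWithinAt lam (lam' t) (Ici (0:ℝ)) t) ∧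
      (∀ t ∈ Ici (0:ℝ), HasDerivWithinAt lam' (lam'' t) (Ici (0:ℝ)) t) ∧
      ContinuousOn lam' (Ici (0:ℝ)) ∧
      ContinuousOn lam'' (Ici (0:ℝ)) ∧
      (∀ t ∈ Ici (0:ℝ), 0 < lam t) ∧
      (∀ t ∈ Ici (0:ℝ),
        lam'' t - b * lam' t + (m2 - c ^ 2 * exp (2 * H * t)) * lam t = 0) ∧
      (∀ t ∈ Ici (0:ℝ),
        lam₀ * exp ((b - H) * t / 2) * exp (-(c / H) * exp (H * t)) ≤ lam t ∧
        lam t ≤ Lam₀ * exp ((b - H) * t / 2) * exp (-(c / H) * exp (H * t))) ∧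
      (∀ t ∈ Ici (0:ℝ), 0 ≤ b * lam t - lam' t) := by
  set ν : ℝ := √(b ^ 2 - 4 * m2) / (2 * H) with hνdef
  have hν : 0 ≤ ν := by positivity
  have hν2 : H ^ 2 * ν ^ 2 = b ^ 2 / 4 - m2 := by
    rw [hνdef, div_pow, Real.sq_sqrt (by linarith)]
    field_simp
    ring
  set w₀ : ℝ := √(c / H) with hw₀def
  have hw₀ : 0 < w₀ := Real.sqrt_pos.2 (by positivity)
  have hw₀2 : w₀ ^ 2 = c / H := Real.sq_sqrt (by positivity)
  set z : ℝ → ℝ := fun t => c / H * exp (H * t) with hzdef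
  have hz : ∀ t, 0 < z t := fun t => by simp only [hzdef]; positivity
  have hzw : ∀ t, z t = (w₀ * exp (H * t / 2)) ^ 2 := fun t => by
    rw [mul_pow, hw₀2, ← exp_nat_mul]
    simp only [hzdef]
    congr 2; push_cast; ring
  have hzd : ∀ t, HasDerivAt z (H * z t) t := fun t => by
    have h := ((((hasDerivAt_id t).const_mul H).exp).const_mul (c / H))
    refine h.congr_deriv ?_
    simp only [hzdef, id]; ring
  set L : ℝ → ℝ := fun t => exp (b / 2 * t) * bkJ ν 0 (z t) with hL
  set L' : ℝ → ℝ := fun t =>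
    exp (b / 2 * t) * (b / 2 * bkJ ν 0 (z t) - H * (z t * bkJ ν 1 (z t))) with hL'
  set L'' : ℝ → ℝ := fun t => b * L' t - (m2 - c ^ 2 * exp (2 * H * t)) * L t with hL''
  have hE : ∀ t, HasDerivAt (fun t => exp (b / 2 * t)) (exp (b / 2 * t) * (b / 2 * 1)) t :=
    fun t => ((hasDerivAt_id t).const_mul (b / 2)).exp
  have hJ : ∀ j t, HasDerivAt (fun t => bkJ ν j (z t)) (-bkJ ν (j + 1) (z t) * (H * z t)) t :=
    fun j t => (bkJ_deriv ν j (hz t)).comp t (hzd t)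
  have hd1 : ∀ t, HasDerivAt L (L' t) t := fun t => by
    refine ((hE t).mul (hJ 0 t)).congr_deriv ?_
    simp only [hL']; ring
  have hd2 : ∀ t, HasDerivAt L' (L'' t) t := fun t => by
    refine ((hE t).mul (((hJ 0 t).const_mul (b / 2)).sub
      (((hzd t).mul (hJ 1 t)).const_mul H))).congr_deriv ?_
    have ode := bkJ_ode ν (hz t)
    have hcz : c ^ 2 * exp (2 * H * t) = H ^ 2 * z t ^ 2 := by
      simp only [hzdef]
      rw [mul_pow, ← exp_nat_mul]
      have : ((2:ℕ):ℝ) * (H * t) = 2 * H * t := by push_cast; ring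
      rw [this]; field_simp
    simp only [hL'', hL', hL, hcz, Pi.mul_apply]
    norm_num
    linear_combination exp (b / 2 * t) * H ^ 2 * ode + exp (b / 2 * t) * bkJ ν 0 (z t) * hν2
  have hcL : Continuous L := continuous_iff_continuousAt.2 fun t => (hd1 t).continuousAt
  have hcL' : Continuous L' := continuous_iff_continuousAt.2 fun t => (hd2 t).continuousAt
  have hcL'' : Continuous L'' := by simp only [hL'']; fun_prop
  have hww : ∀ t ∈ Ici (0:ℝ), w₀ ≤ w₀ * exp (H * t / 2) := fun t ht => by
    have ht' : 0 ≤ t := ht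
    exact le_mul_of_one_le_right hw₀.le (one_le_exp (by positivity))
  have hform : ∀ (A t : ℝ), exp (b / 2 * t) * (A * ((w₀ * exp (H * t / 2))⁻¹ *
      exp (-(w₀ * exp (H * t / 2)) ^ 2))) =
      A * w₀⁻¹ * exp ((b - H) * t / 2) * exp (-(c / H) * exp (H * t)) := fun A t => by
    rw [← hzw, mul_inv, ← exp_neg,
      show (b - H) * t / 2 = b / 2 * t + -(H * t / 2) by ring, exp_add (b / 2 * t)]
    simp only [hzdef, neg_mul]
    ring
  have hbound : ∀ t ∈ Ici (0:ℝ),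
      w₀ * exp (-w₀ ^ 2) * w₀⁻¹ * exp ((b - H) * t / 2) * exp (-(c / H) * exp (H * t)) ≤ L t ∧
      L t ≤ exp (ν ^ 2 / w₀ ^ 2) * (2 * √π) * w₀⁻¹ * exp ((b - H) * t / 2) *
        exp (-(c / H) * exp (H * t)) := fun t ht => by
    rw [← hform, ← hform]
    simp only [hL]
    rw [hzw]
    exact ⟨mul_le_mul_of_nonneg_left (bkJ_lower hν hw₀ (hww t ht) hw₀ le_rfl) (exp_pos _).le,
      mul_le_mul_of_nonneg_left (bkJ_upper ν hw₀ (hww t ht)) (exp_pos _).le⟩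
  refine ⟨L, L', L'', w₀ * exp (-w₀ ^ 2) * w₀⁻¹, exp (ν ^ 2 / w₀ ^ 2) * (2 * √π) * w₀⁻¹,
    by positivity, ?_, fun t _ => (hd1 t).hasDerivWithinAt, fun t _ => (hd2 t).hasDerivWithinAt,
    hcL'.continuousOn, hcL''.continuousOn, fun t ht => ?_, fun t _ => ?_, hbound, fun t _ => ?_⟩
  · have h := (hbound 0 self_mem_Ici).1.trans (hbound 0 self_mem_Ici).2
    exact le_of_mul_le_mul_right (le_of_mul_le_mul_right h (exp_pos _)) (exp_pos _)
  · exact lt_of_lt_of_le (by positivity) (hbound t ht).1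
  · simp only [hL'']; ring
  · have h0 := bkJ_nonneg ν 0 (z t)
    have h1 := bkJ_nonneg ν 1 (z t)
    have hz' := hz t
    have : b * L t - L' t =
        exp (b / 2 * t) * (b / 2 * bkJ ν 0 (z t) + H * (z t * bkJ ν 1 (z t))) := by
      simp only [hL, hL']; ring
    rw [this]
    positivity
end
end

section
/- Let c, H > 0, b ≥ 0, let λ : [0,∞) → ℝ be a continuously differentiable strictly positive function satisfying λ₀ e^{(b−H)t/2} exp(−(c/H) e^{Ht}) ≤ λ(t) ≤ Λ₀ e^{(b−H)t/2} exp(−(c/H) e^{Ht}) for all t ≥ 0, for some constants 0 < λ₀ ≤ Λ₀. Let T ∈ (0,∞], ε > 0, I > 0, J > 0, and let y ∈ C¹([0,T)) satisfy y(0) ≥ εJ and the differential inequality y'(t) + (b − 2λ'(t)/λ(t)) y(t) ≥ εI for all t ∈ [0,T). Then y(t) ≥ (y(0)/λ(0)²) e^{−bt} λ(t)² + εI e^{−bt} λ(t)² ∫₀ᵗ e^{bs}/λ(s)² ds for all t ∈ [0,T), and consequently there exists a constant K > 0, depending only on c, H, b, λ₀, Λ₀, I, J, such that y(t) ≥ K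 ε e^{−Ht} for all t ∈ [0,T). -/
open Real Set intervalIntegral

noncomputable section

/-- Hypotheses of the ODE-inequality lemma for the weighted functional: `λ` is a `C¹`
strictly positive function on `[0,∞)` with two-sided bounds given by `λ₀, Λ₀`, and `y` is a
`C¹` function on `[0,T)` (with `T ∈ (0,∞]`) satisfying `y(0) ≥ εJ` and
`y' + (b − 2λ'/λ)y ≥ εI` on `[0,T)`. -/
structure Hyp18 (c H b lam₀ Lam₀ I J : ℝ) (T : EReal)
    (lam lam' : ℝ → ℝ) (ε : ℝ) (y y' : ℝ → ℝ) : Prop where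
  hT : 0 < T
  hε : 0 < ε
  hlam_deriv : ∀ t ∈ Ici (0:ℝ), HasDerivWithinAt lam (lam' t) (Ici (0:ℝ)) t
  hlam'_cont : ContinuousOn lam' (Ici (0:ℝ))
  hlam_pos : ∀ t ∈ Ici (0:ℝ), 0 < lam t
  hlam_bounds : ∀ t ∈ Ici (0:ℝ),
    lam₀ * exp ((b - H) * t / 2) * exp (-(c / H) * exp (H * t)) ≤ lam t ∧
    lam t ≤ Lam₀ * exp ((b - H) * t / 2) * exp (-(c / H) * exp (H * t))
  hy_deriv : ∀ t : ℝ, 0 ≤ t → (t : EReal) < T →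
    HasDerivWithinAt y (y' t) {s : ℝ | 0 ≤ s ∧ (s : EReal) < T} t
  hy'_cont : ContinuousOn y' {s : ℝ | 0 ≤ s ∧ (s : EReal) < T}
  hy0 : ε * J ≤ y 0
  hineq : ∀ t : ℝ, 0 ≤ t → (t : EReal) < T →
    ε * I ≤ y' t + (b - 2 * lam' t / lam t) * y t


theorem aux_int {b : ℝ} {lam lam' : ℝ → ℝ}
    (hd : ∀ t ∈ Ici (0:ℝ), HasDerivWithinAt lam (lam' t) (Ici (0:ℝ)) t)
    (hp : ∀ t ∈ Ici (0:ℝ), 0 < lam t) :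
    ContinuousOn (fun s => exp (b * s) / lam s ^ 2) (Ici 0) := by
  have h1 : ContinuousOn lam (Ici 0) := fun t ht => (hd t ht).continuousWithinAt
  refine ContinuousOn.div (by fun_prop) (h1.pow 2) (fun t ht => ?_)
  have := hp t ht
  positivity

theorem aux_part1 {c H b lam₀ Lam₀ I J : ℝ} {T : EReal} {lam lam' : ℝ → ℝ} {ε : ℝ}
    {y y' : ℝ → ℝ} (h : Hyp18 c H b lam₀ Lam₀ I J T lam lam' ε y y')
    (t : ℝ) (ht : 0 ≤ t) (htT : (t : EReal) < T) :
    (y 0 / lam 0 ^ 2) * exp (-(b * t)) * lam t ^ 2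
          + ε * I * exp (-(b * t)) * lam t ^ 2 *
              (∫ s in (0:ℝ)..t, exp (b * s) / lam s ^ 2)
        ≤ y t := by
  have hsub : Icc 0 t ⊆ {s : ℝ | 0 ≤ s ∧ (s : EReal) < T} := fun s hs =>
    ⟨hs.1, lt_of_le_of_lt (by exact_mod_cast hs.2) htT⟩
  have hD : ∀ s ∈ Icc 0 t, HasDerivWithinAt (fun s => exp (b * s) * y s / lam s ^ 2)
      (((exp (b * s) * b * y s + exp (b * s) * y' s) * lam s ^ 2
        - exp (b * s) * y s * (2 * lam s * lam' s)) / (lam s ^ 2) ^ 2) (Icc 0 t) s := by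
    intro s hs
    have e1 : HasDerivAt (fun s => exp (b * s)) (exp (b * s) * b) s := by
      simpa using ((hasDerivAt_id s).const_mul b).exp
    have e2 := (h.hy_deriv s (hsub hs).1 (hsub hs).2).mono hsub
    have e3 := (h.hlam_deriv s hs.1).mono (show Icc 0 t ⊆ Ici 0 from fun x hx => hx.1)
    have e4 := e3.pow 2
    have hp := h.hlam_pos s hs.1
    have := (e1.hasDerivWithinAt.mul e2).div e4 (by simp; positivity)
    refine HasDerivWithinAt.congr_deriv this ?_
    simp
  have key := integral_le_sub_of_hasDeriv_right_of_le
    (φ := fun s => ε * I * (exp (b * s) / lam s ^ 2)) ht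
    (fun s hs => (hD s hs).continuousWithinAt)
    (fun s hs => ((hD s ⟨hs.1.le, hs.2.le⟩).hasDerivAt
      (Icc_mem_nhds hs.1 hs.2)).hasDerivWithinAt)
    ((((aux_int h.hlam_deriv h.hlam_pos).mono
      (fun x hx => hx.1)).const_mul (ε * I)).integrableOn_Icc)
    (fun s hs => by
      have hp := h.hlam_pos s hs.1.le
      have hs' := hsub ⟨hs.1.le, hs.2.le⟩
      have hi := h.hineq s hs'.1 hs'.2
      have : ((exp (b * s) * b * y s + exp (b * s) * y' s) * lam s ^ 2
        - exp (b * s) * y s * (2 * lam s * lam' s)) / (lam s ^ 2) ^ 2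
        = (exp (b * s) / lam s ^ 2) * (y' s + (b - 2 * lam' s / lam s) * y s) := by
        field_simp
        ring
      rw [this, mul_comm]
      exact mul_le_mul_of_nonneg_left hi (by positivity))
  rw [intervalIntegral.integral_const_mul] at key
  have hp := h.hlam_pos t ht
  have hp0 := h.hlam_pos 0 (by simp)
  have hk := mul_le_mul_of_nonneg_left key
    (show 0 ≤ exp (-(b * t)) * lam t ^ 2 by positivity)
  have hee : exp (-(b * t)) * exp (b * t) = 1 := by rw [← Real.exp_add]; simp
  have : exp (-(b * t)) * lam t ^ 2 * (exp (b * t) * y t / lam t ^ 2) = y t := by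
    field_simp
    linear_combination y t * hee
  rw [mul_sub, this] at hk
  simp only [mul_zero, Real.exp_zero, one_mul] at hk
  linarith

theorem aux_part2 {c H b lam₀ Lam₀ I J : ℝ} {T : EReal} {lam lam' : ℝ → ℝ} {ε : ℝ}
    {y y' : ℝ → ℝ} (hc : 0 < c) (hH : 0 < H)
    (hlam₀ : 0 < lam₀) (hLL : lam₀ ≤ Lam₀) (hI : 0 < I) (hJ : 0 < J)
    (h : Hyp18 c H b lam₀ Lam₀ I J T lam lam' ε y y')
    (t : ℝ) (ht : 0 ≤ t) (htT : (t : EReal) < T) :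
    (lam₀ ^ 2 / Lam₀ ^ 2 * min J (I / (2 * c))) * ε * exp (-(H * t)) ≤ y t := by
  have hL : 0 < Lam₀ := hlam₀.trans_le hLL
  have hε := h.hε
  set E : ℝ → ℝ := fun s => exp (2 * c / H * exp (H * s)) with hE
  have hEpos : ∀ s, 0 < E s := fun s => Real.exp_pos _
  -- squared bounds
  have sq : ∀ (A s : ℝ), (A * exp ((b - H) * s / 2) * exp (-(c / H) * exp (H * s))) ^ 2
      = A ^ 2 * (exp (b * s) * exp (-(H * s))) / E s := by
    intro A s
    have : (E s)⁻¹ = exp (-(c / H) * exp (H * s)) ^ 2 := by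
      rw [hE, ← Real.exp_neg, ← Real.exp_nat_mul]; congr 1; push_cast; ring
    rw [div_eq_mul_inv (_ * _) (E s), this, mul_pow, mul_pow, ← Real.exp_nat_mul, ← Real.exp_add]
    congr 3; congr 1; push_cast; ring
  have up : ∀ s, 0 ≤ s → lam s ^ 2 ≤ Lam₀ ^ 2 * (exp (b * s) * exp (-(H * s))) / E s := by
    intro s hs
    rw [← sq]
    exact pow_le_pow_left₀ (h.hlam_pos s hs).le (h.hlam_bounds s hs).2 2
  have lo : ∀ s, 0 ≤ s → lam₀ ^ 2 * (exp (b * s) * exp (-(H * s))) / E s ≤ lam s ^ 2 := by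
    intro s hs
    rw [← sq]
    exact pow_le_pow_left₀ (by positivity) (h.hlam_bounds s hs).1 2
  have hD : ∀ s, HasDerivAt (fun s => E s / (2 * c * Lam₀ ^ 2))
      (E s * exp (H * s) / Lam₀ ^ 2) s := by
    intro s
    have e1 : HasDerivAt (fun s => exp (H * s)) (exp (H * s) * H) s := by
      simpa using ((hasDerivAt_id s).const_mul H).exp
    have := ((e1.const_mul (2 * c / H)).exp).div_const (2 * c * Lam₀ ^ 2)
    refine HasDerivAt.congr_deriv this ?_
    simp only [hE]
    field_simp
  have key := sub_le_integral_of_hasDeriv_right_of_le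
    (φ := fun s => exp (b * s) / lam s ^ 2) ht
    (fun s _ => (hD s).continuousAt.continuousWithinAt)
    (fun s _ => (hD s).hasDerivWithinAt)
    (((aux_int h.hlam_deriv h.hlam_pos).mono (fun x hx => hx.1)).integrableOn_Icc)
    (fun s hs => by
      have hp := h.hlam_pos s hs.1.le
      have hEs := hEpos s
      have hu := up s hs.1.le
      rw [le_div_iff₀ (by positivity)]
      refine (mul_le_mul_of_nonneg_left hu (by positivity)).trans (le_of_eq ?_)
      have hee : exp (H * s) * exp (-(H * s)) = 1 := by rw [← Real.exp_add]; simp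
      field_simp
      linear_combination hee)
  have h1 := aux_part1 h t ht htT
  have hp0 := h.hlam_pos 0 (by simp)
  have hpt := h.hlam_pos t ht
  have hE0 := hEpos 0
  have hEt := hEpos t
  have hEle : E 0 ≤ E t := by
    simp only [hE]
    gcongr
  have hfirst : ε * J * E 0 / Lam₀ ^ 2 ≤ y 0 / lam 0 ^ 2 := by
    have hu := up 0 le_rfl
    simp only [mul_zero, neg_zero, Real.exp_zero, mul_one] at hu
    rw [div_le_div_iff₀ (by positivity) (by positivity)]
    rw [le_div_iff₀ hE0] at hu
    calc ε * J * E 0 * lam 0 ^ 2 = ε * J * (lam 0 ^ 2 * E 0) := by ring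
      _ ≤ ε * J * Lam₀ ^ 2 := by gcongr
      _ ≤ y 0 * Lam₀ ^ 2 := by gcongr; exact h.hy0
  set m := min J (I / (2 * c)) with hm
  have hm0 : 0 < m := lt_min hJ (by positivity)
  have hmJ : m ≤ J := min_le_left _ _
  have hmI : m ≤ I / (2 * c) := min_le_right _ _
  have hsum : ε * m * E t / Lam₀ ^ 2 ≤ y 0 / lam 0 ^ 2
      + ε * I * ∫ s in (0:ℝ)..t, exp (b * s) / lam s ^ 2 := by
    have k2 := mul_le_mul_of_nonneg_left key (show 0 ≤ ε * I by positivity)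
    have k3 : ε * m * E 0 / Lam₀ ^ 2 ≤ ε * J * E 0 / Lam₀ ^ 2 := by gcongr
    have k4 : ε * m * (E t - E 0) / Lam₀ ^ 2 ≤ ε * (I / (2 * c)) * (E t - E 0) / Lam₀ ^ 2 := by
      have : 0 ≤ E t - E 0 := by linarith
      gcongr
    have k5 : ε * (I / (2 * c)) * (E t - E 0) / Lam₀ ^ 2
      = ε * I * (E t / (2 * c * Lam₀ ^ 2) - E 0 / (2 * c * Lam₀ ^ 2)) := by
      field_simp
    have k6 : ε * m * E t / Lam₀ ^ 2 = ε * m * E 0 / Lam₀ ^ 2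
      + ε * m * (E t - E 0) / Lam₀ ^ 2 := by ring
    linarith
  have hl : lam₀ ^ 2 * exp (-(H * t)) / E t ≤ exp (-(b * t)) * lam t ^ 2 := by
    refine le_trans (le_of_eq ?_) (mul_le_mul_of_nonneg_left (lo t ht) (Real.exp_pos _).le)
    have hee : exp (-(b * t)) * exp (b * t) = 1 := by rw [← Real.exp_add]; simp
    linear_combination (-(lam₀ ^ 2 * exp (-(H * t)) / E t)) * hee
  calc lam₀ ^ 2 / Lam₀ ^ 2 * m * ε * exp (-(H * t))
      = (lam₀ ^ 2 * exp (-(H * t)) / E t) * (ε * m * E t / Lam₀ ^ 2) := by field_simp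
    _ ≤ (exp (-(b * t)) * lam t ^ 2) * (y 0 / lam 0 ^ 2
      + ε * I * ∫ s in (0:ℝ)..t, exp (b * s) / lam s ^ 2) := by
        apply mul_le_mul hl hsum <;> positivity
    _ ≤ y t := by linarith

/-- **Lower bound for the weighted functional via an ODE inequality.**
Under the hypotheses above,
`y(t) ≥ (y(0)/λ(0)²)e^{−bt}λ(t)² + εI e^{−bt}λ(t)² ∫₀ᵗ e^{bs}/λ(s)² ds` on `[0,T)`, and
consequently there is `K > 0`, depending only on `c, H, b, λ₀, Λ₀, I, J`, with
`y(t) ≥ K ε e^{−Ht}` on `[0,T)`. -/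
theorem weighted_functional_lower_bound
    (c H b lam₀ Lam₀ I J : ℝ)
    (hc : 0 < c) (hH : 0 < H) (hb : 0 ≤ b)
    (hlam₀ : 0 < lam₀) (hlam₀Lam₀ : lam₀ ≤ Lam₀) (hI : 0 < I) (hJ : 0 < J) :
    (∀ (T : EReal) (lam lam' : ℝ → ℝ) (ε : ℝ) (y y' : ℝ → ℝ),
      Hyp18 c H b lam₀ Lam₀ I J T lam lam' ε y y' →
      ∀ t : ℝ, 0 ≤ t → (t : EReal) < T →
        (y 0 / lam 0 ^ 2) * exp (-(b * t)) * lam t ^ 2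
          + ε * I * exp (-(b * t)) * lam t ^ 2 *
              (∫ s in (0:ℝ)..t, exp (b * s) / lam s ^ 2)
        ≤ y t) ∧
    ∃ K > 0, ∀ (T : EReal) (lam lam' : ℝ → ℝ) (ε : ℝ) (y y' : ℝ → ℝ),
      Hyp18 c H b lam₀ Lam₀ I J T lam lam' ε y y' →
      ∀ t : ℝ, 0 ≤ t → (t : EReal) < T →
        K * ε * exp (-(H * t)) ≤ y t := by
  have hL : 0 < Lam₀ := hlam₀.trans_le hlam₀Lam₀
  refine ⟨fun T lam lam' ε y y' h t ht htT => aux_part1 h t ht htT,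
    lam₀ ^ 2 / Lam₀ ^ 2 * min J (I / (2 * c)), ?_,
    fun T lam lam' ε y y' h t ht htT => aux_part2 hc hH hlam₀ hlam₀Lam₀ hI hJ h t ht htT⟩
  have : 0 < min J (I / (2 * c)) := lt_min hJ (by positivity)
  positivity
end
end

section
/- Let n ≥ 1, c, H > 0 and b, m² ≥ 0 with b² ≥ 4m², let p > 1, β ≥ 0, and let Γ be a continuous nonnegative function. Assume v₀, v₁ ∈ L¹_loc(ℝⁿ) are nonnegative, nontrivial, and supported in B_R for some R > 0, and let v be a weak solution on [0,T) of the anti-de Sitter problem. Then there exists a constant C > 0, independent of ε, such that for all t ∈ (0,T): ∫_{ℝⁿ} |v(t,x)|^p dx ≥ C ε^p e^{−(1/2)(b+H)p t} ( R + (c/H)(e^{Ht} − 1) )^{(n−1)(1 − p/2)}. -/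
open MeasureTheory Real Set

noncomputable section

/-- coefficients of the `0F1` series -/
def gc (α : ℝ) (k : ℕ) : ℝ := ∏ j ∈ Finset.range k, (1 / (((j:ℝ) + 1) * (α + j)))

/-- the `0F1` function -/
def gG (α w : ℝ) : ℝ := ∑' k : ℕ, gc α k * w ^ k

theorem gc_zero (α : ℝ) : gc α 0 = 1 := by simp [gc]

theorem gc_succ (α : ℝ) (k : ℕ) : gc α (k+1) = gc α k * (1 / (((k:ℝ) + 1) * (α + k))) := by
  simp [gc, Finset.prod_range_succ]

theorem gc_pos {α : ℝ} (hα : 0 < α) (k : ℕ) : 0 < gc α k := by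
  unfold gc
  apply Finset.prod_pos
  intro j _
  positivity

theorem gc_shift {α : ℝ} (hα : 0 < α) (k : ℕ) :
    gc α (k+1) * ((k:ℝ)+1) = gc (α+1) k / α := by
  induction k with
  | zero => simp [gc]
  | succ k ih =>
    rw [gc_succ, gc_succ (α+1)]
    push_cast
    have h1 : (k:ℝ) + 1 ≠ 0 := by positivity
    have h2 : (k:ℝ) + 1 + 1 ≠ 0 := by positivity
    have h3 : α + ((k:ℝ)+1) ≠ 0 := by positivity
    have h4 : α + 1 + (k:ℝ) ≠ 0 := by positivity
    have : gc α (k+1) * (1 / (((k:ℝ)+1+1) * (α + (k+1)))) * ((k:ℝ)+1+1)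
        = (gc α (k+1) * ((k:ℝ)+1)) * (1 / (((k:ℝ)+1) * (α+1+k))) := by
      field_simp
      ring
    rw [this, ih]
    ring

theorem gc_le {α : ℝ} (hα : 0 < α) (k : ℕ) : gc α k ≤ (1/α)^k / (k.factorial : ℝ) := by
  induction k with
  | zero => simp [gc]
  | succ k ih =>
    rw [gc_succ, Nat.factorial_succ, pow_succ]
    push_cast
    have h1 : 1 / (((k:ℝ)+1) * (α + k)) ≤ 1 / (((k:ℝ)+1) * α) := by
      apply one_div_le_one_div_of_le (by positivity)
      have : (0:ℝ) ≤ k := by positivity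
      nlinarith
    calc gc α k * (1 / (((k:ℝ)+1) * (α + k)))
        ≤ ((1/α)^k / (k.factorial : ℝ)) * (1 / (((k:ℝ)+1) * α)) := by
          apply mul_le_mul ih h1 (by positivity) (by positivity)
      _ = _ := by field_simp

theorem gc_summable {α : ℝ} (hα : 0 < α) (w : ℝ) : Summable (fun k => gc α k * w ^ k) := by
  have h := Real.summable_pow_div_factorial ((1/α) * |w|)
  refine Summable.of_norm_bounded h ?_
  intro k
  rw [Real.norm_eq_abs, abs_mul, abs_of_pos (gc_pos hα k), abs_pow, mul_pow]
  have := gc_le hα k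
  calc gc α k * |w|^k ≤ ((1/α)^k / (k.factorial : ℝ)) * |w|^k := by gcongr
    _ = _ := by ring

theorem gG_hasDerivAt {α : ℝ} (hα : 0 < α) (w : ℝ) :
    HasDerivAt (gG α) (gG (α+1) w / α) w := by
  have hα1 : 0 < α + 1 := by linarith
  set M := |w| + 1 with hM
  have hM0 : 0 < M := by positivity
  let u : ℕ → ℝ := fun k => gc α k * ((k:ℝ) * M^(k-1))
  have hu : Summable u := by
    rw [← summable_nat_add_iff 1]
    have := (gc_summable hα1 M).div_const α
    refine this.congr ?_
    intro k
    simp only [u]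
    push_cast
    try rw [Nat.add_sub_cancel]
    rw [← mul_assoc, gc_shift hα]
    ring
  have hd := hasDerivAt_tsum_of_isPreconnected (g := fun k x => gc α k * x^k)
    (g' := fun k x => gc α k * ((k:ℝ) * x^(k-1))) (t := Metric.ball (0:ℝ) M) (y₀ := 0) (y := w)
    hu Metric.isOpen_ball (convex_ball _ _).isPreconnected
    (fun k y _ => (hasDerivAt_pow k y).const_mul _)
    (by
      intro k y hy
      rw [Real.norm_eq_abs, abs_mul, abs_of_pos (gc_pos hα k), abs_mul, abs_pow, Nat.abs_cast]
      have : |y| ≤ M := by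
        have := mem_ball_zero_iff.1 hy
        exact this.le
      simp only [u]
      have := (gc_pos hα k).le
      gcongr)
    (Metric.mem_ball_self hM0) (gc_summable hα 0)
    (by rw [mem_ball_zero_iff, Real.norm_eq_abs]; linarith)
  have e : (∑' k, gc α k * ((k:ℝ) * w^(k-1))) = gG (α+1) w / α := by
    have hs : Summable (fun k => gc α k * ((k:ℝ) * w^(k-1))) := by
      rw [← summable_nat_add_iff 1]
      refine ((gc_summable hα1 w).div_const α).congr ?_
      intro k
      push_cast
      try rw [Nat.add_sub_cancel]
      rw [← mul_assoc, gc_shift hα]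
      ring
    rw [hs.tsum_eq_zero_add]
    simp only [gG]
    rw [← tsum_div_const]
    simp only [Nat.cast_zero, zero_mul, mul_zero, zero_add]
    congr 1
    ext k
    push_cast
    try rw [Nat.add_sub_cancel]
    rw [← mul_assoc, gc_shift hα]
    ring
  rw [e] at hd
  exact hd

theorem gG_ode {α : ℝ} (hα : 0 < α) (w : ℝ) :
    w * (gG (α+1+1) w / (α+1) / α) + α * (gG (α+1) w / α) = gG α w := by
  have hα1 : 0 < α + 1 := by linarith
  have hα2 : 0 < α + 1 + 1 := by linarith
  have e1 : w * (gG (α+1+1) w / (α+1) / α) = ∑' k : ℕ, gc (α+1) (k+1) * (k+1) / α * w^(k+1) := by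
    simp only [gG]
    rw [← tsum_div_const, ← tsum_div_const, ← tsum_mul_left]
    congr 1
    ext k
    rw [gc_shift hα1]
    ring
  rw [e1, mul_div_cancel₀ _ hα.ne']
  unfold gG
  rw [(gc_summable hα1 w).tsum_eq_zero_add, (gc_summable hα w).tsum_eq_zero_add]
  have s1 : Summable (fun k : ℕ => gc (α+1) (k+1) * (k+1) / α * w^(k+1)) := by
    refine (((gc_summable hα2 w).div_const (α+1)).div_const α |>.mul_left w).congr ?_
    intro k
    rw [gc_shift hα1]
    ring
  have s2 := (summable_nat_add_iff 1).2 (gc_summable hα1 w)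
  rw [add_left_comm, ← s1.tsum_add s2]
  simp only [gc_zero]
  congr 2
  ext k
  rw [← add_mul]
  congr 1
  rw [gc_succ (α+1)]
  have h := gc_shift hα k
  have h1 : (k:ℝ) + 1 ≠ 0 := by positivity
  have h2 : gc α (k+1) = gc (α+1) k / α / (k+1) := by rw [← h]; field_simp
  rw [h2]
  have h4 : α + 1 + (k:ℝ) ≠ 0 := by positivity
  field_simp
  ring

theorem gG_one_le {α : ℝ} (hα : 0 < α) {w : ℝ} (hw : 0 ≤ w) : 1 ≤ gG α w := by
  unfold gG
  have := (gc_summable hα w).le_tsum 0 (fun k _ => mul_nonneg (gc_pos hα k).le (pow_nonneg hw k))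
  simpa [gc_zero] using this

theorem gG_contDiff_nat (N : ℕ) : ∀ {α : ℝ}, 0 < α → ContDiff ℝ N (gG α) := by
  induction N with
  | zero =>
    intro α hα
    exact contDiff_zero.2 (continuous_iff_continuousAt.2 fun w => (gG_hasDerivAt hα w).continuousAt)
  | succ N ih =>
    intro α hα
    push_cast
    rw [contDiff_succ_iff_deriv]
    refine ⟨fun w => (gG_hasDerivAt hα w).differentiableAt, by simp, ?_⟩
    have : deriv (gG α) = fun w => gG (α+1) w / α := by
      ext w; exact (gG_hasDerivAt hα w).deriv
    rw [this]
    exact (ih (by linarith)).div_const α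

theorem gG_contDiff {α : ℝ} (hα : 0 < α) : ContDiff ℝ (⊤ : ℕ∞) (gG α) :=
  contDiff_infty.2 fun N => gG_contDiff_nat N hα

/-- Two-sided exponential bounds for a Bessel-type equation. -/
theorem ode_bounds (P P1 : ℝ → ℝ) (δ τ0 : ℝ) (h0 : 0 < τ0)
    (hP : ∀ τ, 0 < τ → HasDerivAt P (P1 τ) τ)
    (hP1 : ∀ τ, 0 < τ → HasDerivAt P1 (P τ + δ * P τ / τ^2) τ)
    (hpos : ∀ τ, 0 < τ → 0 < P τ) (hnn : ∀ τ, 0 < τ → 0 ≤ P1 τ) :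
    (∃ C > 0, ∀ τ ≥ τ0, P τ ≤ C * exp τ) ∧ (∃ C > 0, ∀ τ ≥ τ0, C * exp τ ≤ P τ) := by
  have hE : ∀ (k τ : ℝ), 0 < τ →
      HasDerivAt (fun τ => (P1 τ + P τ) * exp (-τ + k / τ))
        ((δ * P τ - k * (P1 τ + P τ)) / τ^2 * exp (-τ + k / τ)) τ := by
    intro k τ hτ
    have h1 : HasDerivAt (fun τ : ℝ => -τ + k / τ) (-1 + k * (-(τ^2)⁻¹)) τ := by
      simp only [div_eq_mul_inv]
      exact (hasDerivAt_neg τ).fun_add ((hasDerivAt_inv hτ.ne').const_mul k)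
    have h2 := ((hP1 τ hτ).fun_add (hP τ hτ)).fun_mul h1.exp
    refine h2.congr_deriv ?_
    have := hτ.ne'
    field_simp
    ring
  have hPδ : ∀ τ, 0 < τ → |δ * P τ| ≤ |δ| * (P1 τ + P τ) := by
    intro τ hτ
    rw [abs_mul, abs_of_pos (hpos τ hτ)]
    have := hnn τ hτ
    gcongr
    linarith
  have hsub : ∀ τ ∈ Ici τ0, 0 < τ := fun τ hτ => lt_of_lt_of_le h0 hτ
  have hup : AntitoneOn (fun τ => (P1 τ + P τ) * exp (-τ + |δ| / τ)) (Ici τ0) := by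
    apply antitoneOn_of_hasDerivWithinAt_nonpos (convex_Ici τ0)
      (fun τ hτ => (hE |δ| τ (hsub τ hτ)).continuousAt.continuousWithinAt)
      (fun τ hτ => (hE |δ| τ (hsub τ (interior_subset hτ))).hasDerivWithinAt)
    intro τ hτ
    have hτ0 := hsub τ (interior_subset hτ)
    have := (abs_le.1 (hPδ τ hτ0)).2
    apply mul_nonpos_of_nonpos_of_nonneg _ (exp_pos _).le
    apply div_nonpos_of_nonpos_of_nonneg <;> [linarith; positivity]
  have hlo : MonotoneOn (fun τ => (P1 τ + P τ) * exp (-τ + (-|δ|) / τ)) (Ici τ0) := by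
    apply monotoneOn_of_hasDerivWithinAt_nonneg (convex_Ici τ0)
      (fun τ hτ => (hE (-|δ|) τ (hsub τ hτ)).continuousAt.continuousWithinAt)
      (fun τ hτ => (hE (-|δ|) τ (hsub τ (interior_subset hτ))).hasDerivWithinAt)
    intro τ hτ
    have hτ0 := hsub τ (interior_subset hτ)
    have := (abs_le.1 (hPδ τ hτ0)).1
    apply mul_nonneg _ (exp_pos _).le
    apply div_nonneg <;> [linarith; positivity]
  have hS0 : 0 < P1 τ0 + P τ0 := by linarith [hpos τ0 h0, hnn τ0 h0]
  constructor
  · refine ⟨(P1 τ0 + P τ0) * exp (-τ0 + |δ| / τ0), by positivity, ?_⟩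
    intro τ hτ
    have hτ0 : 0 < τ := hsub τ hτ
    have h := hup (mem_Ici.2 le_rfl) (mem_Ici.2 hτ) hτ
    simp only at h
    have h1 : P τ * exp (-τ) ≤ (P1 τ + P τ) * exp (-τ + |δ| / τ) := by
      apply mul_le_mul (by linarith [hnn τ hτ0]) _ (exp_pos _).le
        (by linarith [hpos τ hτ0, hnn τ hτ0])
      apply exp_le_exp.2
      have : 0 ≤ |δ| / τ := by positivity
      linarith
    have h2 : P τ = P τ * exp (-τ) * exp τ := by
      rw [mul_assoc, ← exp_add]; simp
    rw [h2]
    exact mul_le_mul_of_nonneg_right (by linarith) (exp_pos _).le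
  · set C1 := (P1 τ0 + P τ0) * exp (-τ0 + (-|δ|) / τ0) with hC1
    have hC1pos : 0 < C1 := by positivity
    set C := min C1 (P τ0 * exp (-τ0)) with hC
    have hCpos : 0 < C := lt_min hC1pos (mul_pos (hpos _ h0) (exp_pos _))
    have hS : ∀ τ ≥ τ0, C * exp τ ≤ P1 τ + P τ := by
      intro τ hτ
      have hτ0 : 0 < τ := hsub τ hτ
      have h := hlo (mem_Ici.2 le_rfl) (mem_Ici.2 hτ) hτ
      simp only at h
      have h1 : (P1 τ + P τ) * exp (-τ + (-|δ|) / τ) ≤ (P1 τ + P τ) * exp (-τ) := by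
        apply mul_le_mul_of_nonneg_left _ (by linarith [hpos τ hτ0, hnn τ hτ0])
        apply exp_le_exp.2
        have : 0 ≤ |δ| / τ := by positivity
        rw [neg_div]
        linarith
      have h2 : P1 τ + P τ = (P1 τ + P τ) * exp (-τ) * exp τ := by
        rw [mul_assoc, ← exp_add]; simp
      rw [h2]
      have := min_le_left C1 (P τ0 * exp (-τ0))
      exact mul_le_mul_of_nonneg_right (by linarith) (exp_pos _).le
    have hE2 : ∀ τ, 0 < τ → HasDerivAt (fun τ => P τ * exp τ - C / 2 * exp (2 * τ))
        ((P1 τ + P τ - C * exp τ) * exp τ) τ := by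
      intro τ hτ
      have h1 : HasDerivAt (fun τ : ℝ => exp (2*τ)) (exp (2*τ) * (2*1)) τ :=
        ((hasDerivAt_id τ).const_mul 2).exp
      have h2 := ((hP τ hτ).fun_mul (Real.hasDerivAt_exp τ)).fun_sub (h1.const_mul (C/2))
      refine h2.congr_deriv ?_
      have : exp (2*τ) = exp τ * exp τ := by rw [← exp_add]; ring_nf
      rw [this]; ring
    have hm : MonotoneOn (fun τ => P τ * exp τ - C / 2 * exp (2 * τ)) (Ici τ0) := by
      apply monotoneOn_of_hasDerivWithinAt_nonneg (convex_Ici τ0)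
        (fun τ hτ => (hE2 τ (hsub τ hτ)).continuousAt.continuousWithinAt)
        (fun τ hτ => (hE2 τ (hsub τ (interior_subset hτ))).hasDerivWithinAt)
      intro τ hτ
      have := hS τ (interior_subset hτ)
      apply mul_nonneg (by linarith) (exp_pos _).le
    refine ⟨C/2, by positivity, ?_⟩
    intro τ hτ
    have h := hm (mem_Ici.2 le_rfl) (mem_Ici.2 hτ) hτ
    simp only at h
    have e2 : ∀ x : ℝ, exp (2*x) = exp x * exp x := fun x => by rw [← exp_add]; ring_nf
    rw [e2, e2] at h
    have h3 : C * exp τ0 ≤ P τ0 := by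
      have := min_le_right C1 (P τ0 * exp (-τ0))
      calc C * exp τ0 ≤ (P τ0 * exp (-τ0)) * exp τ0 := by gcongr
        _ = _ := by rw [mul_assoc, ← exp_add]; simp
    have h4 : 0 ≤ P τ0 * exp τ0 - C / 2 * (exp τ0 * exp τ0) := by
      have := exp_pos τ0
      nlinarith [mul_pos hCpos (mul_pos this this)]
    have h5 : (C/2 * exp τ) * exp τ ≤ P τ * exp τ := by linarith
    exact le_of_mul_le_mul_right h5 (exp_pos τ)

theorem gG_bounds {α : ℝ} (hα : 1/2 ≤ α) (τ0 : ℝ) (h0 : 0 < τ0) :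
    (∃ C > 0, ∀ τ ≥ τ0, τ ^ (α - 1/2) * gG α (τ^2/4) ≤ C * exp τ) ∧
    (∃ C > 0, ∀ τ ≥ τ0, C * exp τ ≤ τ ^ (α - 1/2) * gG α (τ^2/4)) := by
  have hα0 : 0 < α := by linarith
  have hα1 : 0 < α + 1 := by linarith
  set a := α - 1/2 with ha
  have ha0 : 0 ≤ a := by linarith
  have hsq : ∀ τ : ℝ, HasDerivAt (fun τ : ℝ => τ^2/4) (τ/2) τ := by
    intro τ
    have := (hasDerivAt_pow 2 τ).div_const 4
    refine this.congr_deriv ?_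
    norm_num; ring
  have hF : ∀ τ : ℝ, HasDerivAt (fun τ => gG α (τ^2/4)) (gG (α+1) (τ^2/4) / α * (τ/2)) τ :=
    fun τ => HasDerivAt.comp (h₂ := gG α) τ (gG_hasDerivAt hα0 (τ^2/4)) (hsq τ)
  have hF1 : ∀ τ : ℝ, HasDerivAt (fun τ => gG (α+1) (τ^2/4) / α * (τ/2))
      ((gG (α+1+1) (τ^2/4) / (α+1) * (τ/2)) / α * (τ/2) + gG (α+1) (τ^2/4) / α * (1/2)) τ :=
    fun τ => ((HasDerivAt.comp (h₂ := gG (α+1)) τ (gG_hasDerivAt hα1 (τ^2/4))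
      (hsq τ)).div_const α).fun_mul ((hasDerivAt_id τ).div_const 2)
  have hr : ∀ (e τ : ℝ), 0 < τ → HasDerivAt (fun τ : ℝ => τ^e) (e * τ^(e-1)) τ :=
    fun e τ hτ => Real.hasDerivAt_rpow_const (Or.inl hτ.ne')
  apply ode_bounds (fun τ => τ^a * gG α (τ^2/4))
    (fun τ => a * τ^(a-1) * gG α (τ^2/4) + τ^a * (gG (α+1) (τ^2/4) / α * (τ/2))) (a^2 - a) τ0 h0
  · intro τ hτ
    exact (hr a τ hτ).fun_mul (hF τ)
  · intro τ hτ
    have h := (((hr (a-1) τ hτ).const_mul a).fun_mul (hF τ)).fun_add ((hr a τ hτ).fun_mul (hF1 τ))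
    refine h.congr_deriv ?_
    symm
    have ho := gG_ode hα0 (τ^2/4)
    have e1 : τ^(a-1) = τ^a / τ := by rw [Real.rpow_sub hτ, Real.rpow_one]
    have e2 : τ^(a-1-1) = τ^a / τ / τ := by rw [Real.rpow_sub hτ, e1, Real.rpow_one]
    simp only [e2, e1]
    rw [← ho]
    have hατ : α = a + 1/2 := by linarith
    generalize gG (α+1+1) (τ^2/4) = X
    generalize gG (α+1) (τ^2/4) = Y
    have := hτ.ne'
    field_simp
    rw [hατ]
    ring
  · intro τ hτ
    have := gG_one_le hα0 (w := τ^2/4) (by positivity)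
    have : 0 < gG α (τ^2/4) := by linarith
    positivity
  · intro τ hτ
    have := gG_one_le hα0 (w := τ^2/4) (by positivity)
    have h1 : 0 < gG α (τ^2/4) := by linarith
    have := gG_one_le hα1 (w := τ^2/4) (by positivity)
    have h2 : 0 < gG (α+1) (τ^2/4) := by linarith
    positivity

theorem y_exists (c H κ : ℝ) (hc : 0 < c) (hH : 0 < H) (hκ : 0 ≤ κ) :
    ∃ y y1 : ℝ → ℝ, (∀ s, HasDerivAt y (y1 s) s) ∧
      (∀ s, HasDerivAt y1 ((κ^2 + c^2 * exp (2*H*s)) * y s) s) ∧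
      ContDiff ℝ (⊤ : ℕ∞) y ∧ (∀ s, 0 < y s) ∧ (∀ s, 0 < y1 s) ∧
      ∃ C > 0, ∀ t ≥ 0, C * exp (-(H*t/2)) * exp ((c/H) * exp (H*t)) ≤ y t := by
  set α := 1 + κ / H with hα
  have hα0 : 0 < α := by positivity
  have hα1 : 0 < α + 1 := by positivity
  have hα2 : 0 < α + 1 + 1 := by positivity
  set w : ℝ → ℝ := fun s => c^2/(4*H^2) * exp (2*H*s) with hw
  have hwpos : ∀ s, 0 < w s := fun s => by simp only [hw]; positivity
  have hwd : ∀ s, HasDerivAt w (2*H*w s) s := by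
    intro s
    have := (((hasDerivAt_id s).const_mul (2*H)).exp).const_mul (c^2/(4*H^2))
    refine this.congr_deriv ?_
    simp only [hw, id]; ring
  have hκd : ∀ s, HasDerivAt (fun s => exp (κ*s)) (κ * exp (κ*s)) s := by
    intro s
    have := ((hasDerivAt_id s).const_mul κ).exp
    refine this.congr_deriv ?_
    simp only [id]; ring
  have hG : ∀ s, HasDerivAt (fun s => gG α (w s)) (gG (α+1) (w s) / α * (2*H*w s)) s :=
    fun s => HasDerivAt.comp (h₂ := gG α) s (gG_hasDerivAt hα0 (w s)) (hwd s)
  have hG1 : ∀ s, HasDerivAt (fun s => gG (α+1) (w s))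
      (gG (α+1+1) (w s) / (α+1) * (2*H*w s)) s :=
    fun s => HasDerivAt.comp (h₂ := gG (α+1)) s (gG_hasDerivAt hα1 (w s)) (hwd s)
  have p0 : ∀ s, 0 < gG α (w s) := fun s => lt_of_lt_of_le one_pos (gG_one_le hα0 (hwpos s).le)
  have p1 : ∀ s, 0 < gG (α+1) (w s) :=
    fun s => lt_of_lt_of_le one_pos (gG_one_le hα1 (hwpos s).le)
  refine ⟨fun s => exp (κ*s) * gG α (w s),
    fun s => κ * exp (κ*s) * gG α (w s) + exp (κ*s) * (gG (α+1) (w s) / α * (2*H*w s)),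
    fun s => (hκd s).fun_mul (hG s), ?_, ?_, ?_, ?_, ?_⟩
  · intro s
    have h := (((hκd s).const_mul κ).fun_mul (hG s)).fun_add
      ((hκd s).fun_mul (((hG1 s).div_const α).fun_mul ((hwd s).const_mul (2*H))))
    refine h.congr_deriv ?_
    have ho := gG_ode hα0 (w s)
    have e : c^2 * exp (2*H*s) = 4*H^2*w s := by simp only [hw]; field_simp
    rw [e, add_mul]
    beta_reduce
    have hκα : κ = (α - 1) * H := by rw [hα]; field_simp; ring
    have : 4*H^2*w s * (exp (κ*s) * gG α (w s)) = 4*H^2*w s * (exp (κ*s) *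
      (w s * (gG (α+1+1) (w s) / (α+1) / α) + α * (gG (α+1) (w s) / α))) := by rw [ho]
    rw [this]
    generalize gG (α+1+1) (w s) = X
    generalize gG (α+1) (w s) = Y
    generalize gG (α) (w s) = Z
    generalize exp (κ*s) = E
    rw [hκα]
    field_simp
    ring
  · have : ContDiff ℝ (⊤ : ℕ∞) w := by simp only [hw]; fun_prop
    exact ContDiff.mul (by fun_prop) ((gG_contDiff hα0).comp this)
  · intro s
    have := p0 s
    positivity
  · intro s
    have := p0 s
    have := p1 s
    have := hwpos s
    positivity
  · have hhalf : 1/2 ≤ α := by have : 0 ≤ κ/H := by positivity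
                               linarith
    obtain ⟨C, hC, hb⟩ := (gG_bounds hhalf (c/H) (by positivity)).2
    refine ⟨C / (c/H)^(α-1/2), by positivity, ?_⟩
    intro t ht
    have hτ : c/H ≤ c/H * exp (H*t) := by
      have : 1 ≤ exp (H*t) := one_le_exp (by positivity)
      have h2 : 0 < c/H := by positivity
      nlinarith
    have h := hb _ hτ
    have ew : (c/H * exp (H*t))^2/4 = w t := by
      simp only [hw]
      have : exp (2*H*t) = exp (H*t)^2 := by rw [← exp_nat_mul]; ring_nf
      rw [this]; field_simp
    rw [ew, Real.mul_rpow (by positivity) (by positivity), ← exp_mul] at h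
    have e3 : exp (H*t*(α-1/2)) = exp (κ*t) * exp (H*t/2) := by
      rw [← exp_add]; congr 1; rw [hα]; field_simp; ring
    rw [e3] at h
    have e4 : exp (H*t/2) * exp (-(H*t/2)) = 1 := by rw [← exp_add]; simp
    have hD : 0 < (c/H)^(α-1/2) := by positivity
    simp only
    generalize (c/H)^(α-1/2) = D at *
    rw [div_mul_eq_mul_div, div_mul_eq_mul_div, div_le_iff₀ hD]
    calc C * exp (-(H*t/2)) * exp (c/H*exp (H*t)) = (C * exp (c/H*exp (H*t))) * exp (-(H*t/2)) := by ring
      _ ≤ (D * (exp (κ*t) * exp (H*t/2)) * gG α (w t)) * exp (-(H*t/2)) := by gcongr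
      _ = (exp (κ*t) * gG α (w t)) * D * (exp (H*t/2) * exp (-(H*t/2))) := by ring
      _ = _ := by rw [e4, mul_one]

theorem time_fn (c H b m2 A B : ℝ) (hc : 0 < c) (hH : 0 < H) (hb : 0 ≤ b)
    (hdom : 4 * m2 ≤ b ^ 2) (hA : 0 < A) (hB : 0 < B) :
    ∃ K > 0, ∀ t > 0, ∃ l : ℝ → ℝ, ContDiff ℝ (⊤ : ℕ∞) l ∧
      (∀ s, deriv (deriv l) s - c^2 * exp (2*H*s) * l s - b * deriv l s + m2 * l s = 0) ∧
      l t = 0 ∧ deriv l t = -1 ∧ (∀ s ∈ Icc 0 t, 0 ≤ l s) ∧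
      0 ≤ b * l 0 - deriv l 0 ∧
      K * exp (-((b+H)*t/2)) * exp ((c/H) * exp (H*t)) ≤ A * l 0 + B * (b * l 0 - deriv l 0) := by
  obtain ⟨y, y1, hy, hy1, hyc, ypos, y1pos, C, hC, hlow⟩ :=
    y_exists c H (√(b^2/4 - m2)) hc hH (Real.sqrt_nonneg _)
  have hκ2 : (√(b^2/4 - m2))^2 = b^2/4 - m2 := Real.sq_sqrt (by linarith)
  rw [hκ2] at hy1
  set k := min (A / y1 0) (B / y 0) with hk
  have hkpos : 0 < k := lt_min (div_pos hA (y1pos 0)) (div_pos hB (ypos 0))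
  refine ⟨k * C, by positivity, ?_⟩
  intro t ht
  have hyi : ContDiff ℝ (⊤ : ℕ∞) (fun s => (y s)⁻¹ ^ 2) :=
    (hyc.inv (fun s => (ypos s).ne')).pow 2
  set θ : ℝ → ℝ := fun s => ∫ r in s..t, (y r)⁻¹ ^ 2 with hθ
  have hθd : ∀ s, HasDerivAt θ (-((y s)⁻¹ ^ 2)) s := fun s =>
    intervalIntegral.integral_hasDerivAt_left (hyi.continuous.intervalIntegrable _ _)
      (hyi.continuous.stronglyMeasurableAtFilter _ _) hyi.continuous.continuousAt
  have hθc : ContDiff ℝ (⊤ : ℕ∞) θ := by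
    rw [contDiff_infty_iff_deriv]
    refine ⟨fun s => (hθd s).differentiableAt, ?_⟩
    have : deriv θ = fun s => -((y s)⁻¹ ^ 2) := by ext s; exact (hθd s).deriv
    rw [this]
    exact hyi.neg
  have hθt : θ t = 0 := by simp [hθ]
  have hθ0 : ∀ s ≤ t, 0 ≤ θ s := fun s hs =>
    intervalIntegral.integral_nonneg hs (fun r _ => by positivity)
  set μ : ℝ → ℝ := fun s => y t * (y s * θ s) with hμ
  set μ1 : ℝ → ℝ := fun s => y t * (y1 s * θ s - (y s)⁻¹) with hμ1
  have hμd : ∀ s, HasDerivAt μ (μ1 s) s := by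
    intro s
    refine (((hy s).fun_mul (hθd s)).const_mul (y t)).congr_deriv ?_
    have := (ypos s).ne'
    simp only [hμ1]; field_simp; ring
  have hμ1d : ∀ s, HasDerivAt μ1 ((b^2/4 - m2 + c^2 * exp (2*H*s)) * μ s) s := by
    intro s
    refine ((((hy1 s).fun_mul (hθd s)).fun_sub ((hy s).fun_inv (ypos s).ne')).const_mul
      (y t)).congr_deriv ?_
    have := (ypos s).ne'
    simp only [hμ]; field_simp; ring
  have hμ0 : ∀ s ≤ t, 0 ≤ μ s := fun s hs =>
    mul_nonneg (ypos t).le (mul_nonneg (ypos s).le (hθ0 s hs))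
  have hμt : μ t = 0 := by simp [hμ, hθt]
  have hμ1t : μ1 t = -1 := by
    have := (ypos t).ne'
    simp only [hμ1, hθt]; field_simp; ring
  have hmono : MonotoneOn μ1 (Icc 0 t) := by
    apply monotoneOn_of_hasDerivWithinAt_nonneg (convex_Icc 0 t)
      (fun s _ => (hμ1d s).continuousAt.continuousWithinAt)
      (fun s _ => (hμ1d s).hasDerivWithinAt)
    intro s hs
    have := hμ0 s (interior_subset hs).2
    have h2 : 0 ≤ b^2/4 - m2 := by linarith
    positivity
  have hμ10 : μ1 0 ≤ -1 := by
    rw [← hμ1t]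
    exact hmono ⟨le_rfl, ht.le⟩ ⟨ht.le, le_rfl⟩ ht.le
  have hwr : -(y 0 * μ1 0) + y1 0 * μ 0 = y t := by
    have := (ypos 0).ne'
    simp only [hμ, hμ1]; field_simp; ring
  have hE : ∀ s, HasDerivAt (fun s => exp (b*(s-t)/2)) (b/2 * exp (b*(s-t)/2)) s := by
    intro s
    have := ((((hasDerivAt_id s).sub_const t).const_mul b).div_const 2).exp
    refine this.congr_deriv ?_
    simp only [id]; ring
  have hl : ∀ s, HasDerivAt (fun s => exp (b*(s-t)/2) * μ s)
      (exp (b*(s-t)/2) * (b/2 * μ s + μ1 s)) s := by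
    intro s
    refine ((hE s).fun_mul (hμd s)).congr_deriv ?_
    ring
  have hl1 : ∀ s, HasDerivAt (fun s => exp (b*(s-t)/2) * (b/2 * μ s + μ1 s))
      (exp (b*(s-t)/2) * (b/2 * (b/2 * μ s + μ1 s) +
        (b/2 * μ1 s + (b^2/4 - m2 + c^2 * exp (2*H*s)) * μ s))) s := by
    intro s
    refine ((hE s).fun_mul (((hμd s).const_mul (b/2)).fun_add (hμ1d s))).congr_deriv ?_
    ring
  have hdl : deriv (fun s => exp (b*(s-t)/2) * μ s) =
      fun s => exp (b*(s-t)/2) * (b/2 * μ s + μ1 s) := by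
    ext s; exact (hl s).deriv
  refine ⟨fun s => exp (b*(s-t)/2) * μ s, ?_, ?_, ?_, ?_, ?_, ?_, ?_⟩
  · have : ContDiff ℝ (⊤ : ℕ∞) μ := contDiff_const.mul (hyc.mul hθc)
    fun_prop
  · intro s
    rw [hdl, (hl1 s).deriv]
    ring
  · simp [hμt]
  · rw [hdl]
    simp [hμt, hμ1t]
  · intro s hs
    have := hμ0 s hs.2
    positivity
  · rw [hdl]
    have := hμ0 0 ht.le
    have e : b * (exp (b*(0-t)/2) * μ 0) - exp (b*(0-t)/2) * (b/2 * μ 0 + μ1 0)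
      = exp (b*(0-t)/2) * (b/2 * μ 0 + -μ1 0) := by ring
    simp only [e]
    have : 0 ≤ b/2*μ 0 := by positivity
    apply mul_nonneg (exp_pos _).le
    linarith
  · rw [hdl]
    have h0 := hμ0 0 ht.le
    have e : A * (exp (b*(0-t)/2) * μ 0) + B * (b * (exp (b*(0-t)/2) * μ 0)
        - exp (b*(0-t)/2) * (b/2 * μ 0 + μ1 0))
      = exp (b*(0-t)/2) * (A * μ 0 + B * (-μ1 0) + B * (b/2 * μ 0)) := by ring
    simp only [e]
    have e1 : exp (-((b+H)*t/2)) = exp (b*(0-t)/2) * exp (-(H*t/2)) := by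
      rw [← exp_add]; ring_nf
    rw [e1]
    have h1 : k * y t ≤ A * μ 0 + B * (-μ1 0) := by
      rw [← hwr]
      have k1 : k * y1 0 ≤ A := by
        have := min_le_left (A / y1 0) (B / y 0)
        exact (le_div_iff₀ (y1pos 0)).1 this
      have k2 : k * y 0 ≤ B := by
        have := min_le_right (A / y1 0) (B / y 0)
        exact (le_div_iff₀ (ypos 0)).1 this
      have := mul_le_mul_of_nonneg_right k1 h0
      have := mul_le_mul_of_nonneg_right k2 (show 0 ≤ -μ1 0 by linarith)
      linarith
    have h2 : 0 ≤ B * (b/2 * μ 0) := by positivity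
    have h3 := mul_le_mul_of_nonneg_left (hlow t ht.le) hkpos.le
    calc k * C * (exp (b*(0-t)/2) * exp (-(H*t/2))) * exp (c/H*exp (H*t))
        = exp (b*(0-t)/2) * (k * (C * exp (-(H*t/2)) * exp (c/H*exp (H*t)))) := by ring
      _ ≤ _ := by
        apply mul_le_mul_of_nonneg_left _ (exp_pos _).le
        linarith

/-- the positive radial eigenfunction of the Laplacian -/
def phi (n : ℕ) (x : Eucl n) : ℝ := gG ((n:ℝ)/2) (‖x‖^2/4)

theorem phi_contDiff (n : ℕ) (hn : 1 ≤ n) : ContDiff ℝ (⊤ : ℕ∞) (phi n) := by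
  have h0 : 0 < (n:ℝ)/2 := by positivity
  exact (gG_contDiff h0).comp ((contDiff_norm_sq ℝ).div_const 4)

theorem phi_one_le (n : ℕ) (hn : 1 ≤ n) (x : Eucl n) : 1 ≤ phi n x :=
  gG_one_le (by positivity) (by positivity)

theorem phi_lapl (n : ℕ) (hn : 1 ≤ n) (x : Eucl n) : lapl (phi n) x = phi n x := by
  have h0 : 0 < (n:ℝ)/2 := by positivity
  have h1 : 0 < (n:ℝ)/2 + 1 := by positivity
  have hN : ∀ (x : Eucl n), HasFDerivAt (fun y : Eucl n => ‖y‖^2/4) ((1/2:ℝ) • innerSL ℝ x) x := by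
    intro x
    have h := (hasStrictFDerivAt_norm_sq x).hasFDerivAt.mul_const (1/4:ℝ)
    have h2 : HasFDerivAt (fun y : Eucl n => ‖y‖^2/4) ((1/4:ℝ) • ((2:ℕ) • innerSL ℝ x)) x := by
      simpa [div_eq_mul_inv] using h
    refine h2.congr_fderiv ?_
    ext z
    simp
    ring
  have hG : ∀ (α : ℝ), 0 < α → ∀ x : Eucl n, HasFDerivAt (fun y : Eucl n => gG α (‖y‖^2/4))
      ((gG (α+1) (‖x‖^2/4) / α) • ((1/2:ℝ) • innerSL ℝ x)) x := by
    intro α hα x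
    exact HasDerivAt.comp_hasFDerivAt (h₂ := gG α) x (gG_hasDerivAt hα _) (hN x)
  have hin : ∀ (x : Eucl n) (i : Fin n), inner ℝ x (EuclideanSpace.single i (1:ℝ)) = x i := by
    intro x i
    rw [EuclideanSpace.inner_single_right]
    simp
  have hd1 : ∀ i : Fin n, (fun y => fderiv ℝ (phi n) y (EuclideanSpace.single i 1)) =
      fun y => gG ((n:ℝ)/2+1) (‖y‖^2/4) * ((1 / ((n:ℝ)/2) / 2) * y i) := by
    intro i
    ext y
    have : fderiv ℝ (phi n) y = _ := (hG _ h0 y).fderiv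
    rw [this]
    simp only [smul_apply, innerSL_apply_apply, hin, smul_eq_mul]
    ring
  unfold lapl
  simp only [hd1]
  have hd2 : ∀ i : Fin n, fderiv ℝ (fun y : Eucl n => gG ((n:ℝ)/2+1) (‖y‖^2/4) *
      ((1 / ((n:ℝ)/2) / 2) * y i)) x (EuclideanSpace.single i 1) =
      gG ((n:ℝ)/2+1) (‖x‖^2/4) * (1 / ((n:ℝ)/2) / 2)
      + gG ((n:ℝ)/2+1+1) (‖x‖^2/4) / ((n:ℝ)/2+1) / ((n:ℝ)/2) / 4 * (x i)^2 := by
    intro i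
    have hc : HasFDerivAt (fun y : Eucl n => (1 / ((n:ℝ)/2) / 2) * y i)
        ((1 / ((n:ℝ)/2) / 2) • (EuclideanSpace.proj i : Eucl n →L[ℝ] ℝ)) x :=
      ((EuclideanSpace.proj i : Eucl n →L[ℝ] ℝ).hasFDerivAt).const_mul _
    have h := (hG _ h1 x).fun_mul hc
    rw [h.fderiv]
    simp only [add_apply, smul_apply, innerSL_apply_apply,
      hin, smul_eq_mul]
    simp
    ring
  simp only [hd2]
  rw [Finset.sum_add_distrib, ← Finset.mul_sum (s := Finset.univ) (f := fun i => (x i)^2)]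
  have hs : ∑ i, (x i)^2 = ‖x‖^2 := by
    rw [EuclideanSpace.norm_sq_eq]; simp
  rw [hs]
  have ho := gG_ode h0 (‖x‖^2/4)
  unfold phi
  rw [← ho]
  simp
  have : (n:ℝ) ≠ 0 := by positivity
  field_simp
  ring

/-- pointwise bound -/
theorem phi_le (n : ℕ) (hn : 1 ≤ n) :
    ∃ C > 0, ∀ x : Eucl n, phi n x ≤ C * ((1 + ‖x‖) ^ (-(((n:ℝ) - 1)/2)) * exp ‖x‖) := by
  have hn' : (1:ℝ) ≤ n := by exact_mod_cast hn
  obtain ⟨C1, hC1, hb⟩ := (gG_bounds (α := (n:ℝ)/2) (by linarith) 1 one_pos).1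
  have hcont : Continuous (fun τ : ℝ => gG ((n:ℝ)/2) (τ^2/4)) :=
    (gG_contDiff (by positivity)).continuous.comp (by fun_prop)
  obtain ⟨M, hM⟩ := (isCompact_Icc (a := (0:ℝ)) (b := 1)).exists_bound_of_continuousOn hcont.continuousOn
  set a := ((n:ℝ)-1)/2 with ha
  have ha0 : 0 ≤ a := by rw [ha]; linarith
  have hea : (n:ℝ)/2 - 1/2 = a := by rw [ha]; ring
  rw [hea] at hb
  have key : ∀ τ : ℝ, 0 ≤ τ → (1+τ)^a * gG ((n:ℝ)/2) (τ^2/4) ≤ (2^a * (C1 + |M|)) * exp τ := by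
    intro τ hτ
    have hg : 0 < gG ((n:ℝ)/2) (τ^2/4) :=
      lt_of_lt_of_le one_pos (gG_one_le (by positivity) (by positivity))
    rcases le_total τ 1 with h | h
    · have h1 := hM τ ⟨hτ, h⟩
      rw [Real.norm_eq_abs, abs_of_pos hg] at h1
      have h2 : (1+τ)^a ≤ 2^a := Real.rpow_le_rpow (by positivity) (by linarith) ha0
      have h3 : 1 ≤ exp τ := one_le_exp hτ
      calc (1+τ)^a * gG ((n:ℝ)/2) (τ^2/4) ≤ 2^a * (C1 + |M|) := by
            gcongr
            linarith [le_abs_self M]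
        _ ≤ _ := le_mul_of_one_le_right (by positivity) h3
    · have h1 := hb τ h
      have h2 : (1+τ)^a ≤ 2^a * τ^a := by
        rw [← Real.mul_rpow (by norm_num) hτ]
        exact Real.rpow_le_rpow (by positivity) (by linarith) ha0
      calc (1+τ)^a * gG ((n:ℝ)/2) (τ^2/4) ≤ (2^a * τ^a) * gG ((n:ℝ)/2) (τ^2/4) := by gcongr
        _ = 2^a * (τ^a * gG ((n:ℝ)/2) (τ^2/4)) := by ring
        _ ≤ 2^a * (C1 * exp τ) := by gcongr
        _ ≤ 2^a * ((C1 + |M|) * exp τ) := by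
            gcongr
            linarith [abs_nonneg M]
        _ = _ := by ring
  refine ⟨2^a * (C1 + |M|), by positivity, ?_⟩
  intro x
  have h := key ‖x‖ (norm_nonneg x)
  have hp : 0 < (1 + ‖x‖)^a := by positivity
  rw [Real.rpow_neg (by positivity)]
  unfold phi
  calc gG ((n:ℝ)/2) (‖x‖^2/4) = ((1 + ‖x‖)^a * gG ((n:ℝ)/2) (‖x‖^2/4)) * ((1 + ‖x‖)^a)⁻¹ := by
        field_simp
    _ ≤ (2^a * (C1 + |M|)) * exp ‖x‖ * ((1 + ‖x‖)^a)⁻¹ := by gcongr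
    _ = _ := by ring

theorem radial_bound (σ q : ℝ) (hq : 0 < q) :
    ∃ D > 0, ∀ r y : ℝ, 0 ≤ y → y ≤ r →
      (1+y)^σ * exp (q*y) ≤ D * (1+r)^σ * exp (q*r/2) * exp (q*y/2) := by
  set k := |σ| + 1 with hk
  have hk0 : 0 < k := by positivity
  set δ := q / (2*k) with hδ
  have hδ0 : 0 < δ := by positivity
  refine ⟨(δ⁻¹)^k * exp (k*δ), by positivity, ?_⟩
  intro r y hy hyr
  have h1 : (1+y)^σ ≤ (1+r)^σ * (1+(r-y))^k := by
    have hu : 1 ≤ 1+(r-y) := by linarith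
    have hle : (1+(r-y))^|σ| ≤ (1+(r-y))^k := Real.rpow_le_rpow_of_exponent_le hu (by linarith)
    have h2 : (1+y)^σ ≤ (1+r)^σ * (1+(r-y))^|σ| := by
      rcases le_total 0 σ with h | h
      · rw [abs_of_nonneg h]
        calc (1+y)^σ ≤ (1+r)^σ := Real.rpow_le_rpow (by linarith) (by linarith) h
          _ ≤ _ := le_mul_of_one_le_right (Real.rpow_nonneg (by linarith) _)
              (Real.one_le_rpow hu h)
      · rw [abs_of_nonpos h]
        have h3 : (1+r) ≤ (1+y) * (1+(r-y)) := by nlinarith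
        have h4 : ((1+y) * (1+(r-y)))^σ ≤ (1+r)^σ :=
          Real.rpow_le_rpow_of_nonpos (by linarith) h3 h
        rw [Real.mul_rpow (by linarith) (by linarith)] at h4
        have hpos : 0 < (1+(r-y))^(-σ) := Real.rpow_pos_of_pos (by linarith) _
        calc (1+y)^σ = ((1+y)^σ * (1+(r-y))^σ) * (1+(r-y))^(-σ) := by
              rw [mul_assoc, ← Real.rpow_add (by linarith)]; simp
          _ ≤ _ := by gcongr
    refine h2.trans ?_
    apply mul_le_mul_of_nonneg_left hle (Real.rpow_nonneg (by linarith) _)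
  have h2 : (1+(r-y))^k ≤ (δ⁻¹)^k * exp (k*δ) * exp (q*(r-y)/2) := by
    have h3 : 1+(r-y) ≤ δ⁻¹ * exp (δ*(1+(r-y))) := by
      rw [← div_eq_inv_mul, le_div_iff₀ hδ0]
      have := add_one_le_exp (δ*(1+(r-y)))
      linarith
    calc (1+(r-y))^k ≤ (δ⁻¹ * exp (δ*(1+(r-y))))^k :=
          Real.rpow_le_rpow (by linarith) h3 hk0.le
      _ = (δ⁻¹)^k * exp (δ*(1+(r-y)) * k) := by
          rw [Real.mul_rpow (by positivity) (by positivity), ← exp_mul]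
      _ = (δ⁻¹)^k * (exp (k*δ) * exp (q*(r-y)/2)) := by
          rw [← exp_add]; congr 2; rw [hδ]; field_simp
      _ = _ := by ring
  have h5 : exp (q*(r-y)/2) * exp (q*y) = exp (q*r/2) * exp (q*y/2) := by
    rw [← exp_add, ← exp_add]; ring_nf
  have hr0 : 0 ≤ (1+r)^σ := Real.rpow_nonneg (by linarith) _
  calc (1+y)^σ * exp (q*y) ≤ ((1+r)^σ * (1+(r-y))^k) * exp (q*y) := by gcongr
    _ ≤ ((1+r)^σ * ((δ⁻¹)^k * exp (k*δ) * exp (q*(r-y)/2))) * exp (q*y) := by gcongr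
    _ = (δ⁻¹)^k * exp (k*δ) * (1+r)^σ * (exp (q*(r-y)/2) * exp (q*y)) := by ring
    _ = _ := by rw [h5]; ring

theorem one_add_rpow_le (σ R : ℝ) (hR : 0 < R) :
    ∃ D > 0, ∀ r ≥ R, (1+r)^σ ≤ D * r^σ := by
  refine ⟨(1/R+1)^|σ|, by positivity, ?_⟩
  intro r hr
  have hr0 : 0 < r := by linarith
  rcases le_total 0 σ with h | h
  · rw [abs_of_nonneg h, ← Real.mul_rpow (by positivity) hr0.le]
    apply Real.rpow_le_rpow (by positivity) _ h
    have : 1 ≤ 1/R * r := by rw [one_div, ← div_eq_inv_mul, le_div_iff₀ hR]; linarith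
    linarith
  · have h1 : (1+r)^σ ≤ r^σ := Real.rpow_le_rpow_of_nonpos hr0 (by linarith) h
    have h2 : 1 ≤ (1/R+1)^|σ| := Real.one_le_rpow (by
      have : 0 < 1/R := by positivity
      linarith) (abs_nonneg _)
    exact h1.trans (le_mul_of_one_le_left (by positivity) h2)

theorem phi_int (n : ℕ) (hn : 1 ≤ n) (q R : ℝ) (hq : 1 < q) (hR : 0 < R) :
    ∃ C > 0, ∀ r ≥ R, ∫ x in Metric.closedBall (0 : Eucl n) r, (phi n x)^q
      ≤ C * r ^ (((n:ℝ)-1) - ((n:ℝ)-1)/2*q) * exp (q*r) := by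
  have : Nonempty (Fin n) := ⟨⟨0, hn⟩⟩
  have hq0 : 0 < q := by linarith
  obtain ⟨C1, hC1, hb⟩ := phi_le n hn
  set a := ((n:ℝ)-1)/2 with ha
  set σ := ((n:ℝ)-1) - a*q with hσ
  obtain ⟨D, hD, hrad⟩ := radial_bound σ q hq0
  obtain ⟨D2, hD2, hone⟩ := one_add_rpow_le σ R hR
  set V := (volume : Measure (Eucl n)).real (Metric.ball 0 1) with hV
  have hV0 : 0 ≤ V := measureReal_nonneg
  set g : ℝ → ℝ := fun ρ => C1^q * ((1+ρ)^(-(a*q)) * exp (q*ρ)) with hg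
  have hgb : ∀ x : Eucl n, (phi n x)^q ≤ g ‖x‖ := by
    intro x
    have h0 := phi_one_le n hn x
    calc (phi n x)^q ≤ (C1 * ((1 + ‖x‖) ^ (-a) * exp ‖x‖))^q :=
          Real.rpow_le_rpow (by linarith) (hb x) hq0.le
      _ = _ := by
        rw [Real.mul_rpow hC1.le (by positivity), Real.mul_rpow (by positivity) (by positivity),
          ← Real.rpow_mul (by positivity), ← exp_mul]
        simp only [hg]; ring_nf
  refine ⟨n * V * (C1^q * D * D2 * (2/q)) + 1, by positivity, ?_⟩
  intro r hr
  have hr0 : 0 < r := by linarith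
  have hgc : ContinuousOn (fun x : Eucl n => g ‖x‖) (Metric.closedBall 0 r) := by
    apply Continuous.continuousOn
    simp only [hg]
    refine continuous_const.mul (Continuous.mul ?_ (by fun_prop))
    refine Continuous.rpow_const (by fun_prop) (fun x => Or.inl ?_)
    positivity
  have hpc : ContinuousOn (fun x : Eucl n => (phi n x)^q) (Metric.closedBall 0 r) :=
    ((phi_contDiff n hn).continuous.rpow_const (fun x => Or.inr hq0.le)).continuousOn
  have hK : IsCompact (Metric.closedBall (0 : Eucl n) r) := isCompact_closedBall _ _
  have s1 : ∫ x in Metric.closedBall (0 : Eucl n) r, (phi n x)^q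
      ≤ ∫ x in Metric.closedBall (0 : Eucl n) r, g ‖x‖ :=
    setIntegral_mono (hpc.integrableOn_compact hK) (hgc.integrableOn_compact hK) hgb
  have s2 : ∫ x in Metric.closedBall (0 : Eucl n) r, g ‖x‖
      = ∫ x : Eucl n, (Iic r).indicator g ‖x‖ := by
    rw [← integral_indicator Metric.isClosed_closedBall.measurableSet]
    congr 1
    ext x
    by_cases h : ‖x‖ ≤ r
    · rw [indicator_of_mem (by simpa using h), indicator_of_mem (by simpa using h)]
    · rw [indicator_of_notMem (by simpa using h), indicator_of_notMem (by simpa using h)]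
  have s3 : ∫ x : Eucl n, (Iic r).indicator g ‖x‖
      = n * V * ∫ y in Ioc 0 r, y^(n-1) * g y := by
    rw [integral_fun_norm_addHaar volume ((Iic r).indicator g)]
    simp only [finrank_euclideanSpace, Fintype.card_fin, nsmul_eq_mul, smul_eq_mul]
    rw [mul_assoc]
    congr 2
    have : ∀ y, y^(n-1) * (Iic r).indicator g y = (Iic r).indicator (fun y => y^(n-1) * g y) y := by
      intro y
      by_cases h : y ∈ Iic r <;> simp [h]
    simp only [this]
    rw [setIntegral_indicator measurableSet_Iic, Ioi_inter_Iic]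
  have hgc1 : ContinuousOn (fun y : ℝ => y^(n-1) * g y) (Icc 0 r) := by
    simp only [hg]
    refine ContinuousOn.mul (by fun_prop) (continuousOn_const.mul (ContinuousOn.mul ?_ (by fun_prop)))
    refine ContinuousOn.rpow_const (by fun_prop) (fun y hy => Or.inl ?_)
    linarith [hy.1]
  set Q := C1^q * (D * (1+r)^σ * exp (q*r/2)) with hQ
  have hQ0 : 0 ≤ Q := by positivity
  have s4 : ∫ y in Ioc 0 r, y^(n-1) * g y ≤ ∫ y in Ioc 0 r, Q * exp (q/2*y) := by
    apply setIntegral_mono_on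
    · exact (hgc1.integrableOn_compact isCompact_Icc).mono_set Ioc_subset_Icc_self
    · exact (Continuous.integrableOn_Ioc (by fun_prop))
    · exact measurableSet_Ioc
    intro y hy
    have hy0 : 0 < y := hy.1
    have h1 : y^(n-1) ≤ (1+y)^((n:ℝ)-1) := by
      have e : ((n:ℝ)-1) = ((n-1:ℕ):ℝ) := by push_cast [hn]; ring
      rw [e, Real.rpow_natCast]
      gcongr
      linarith
    have h2 := hrad r y hy0.le hy.2
    have e2 : (1+y)^((n:ℝ)-1) * (1+y)^(-(a*q)) = (1+y)^σ := by
      rw [← Real.rpow_add (by linarith)]; congr 1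
    calc y^(n-1) * g y ≤ (1+y)^((n:ℝ)-1) * g y := by
          apply mul_le_mul_of_nonneg_right h1
          simp only [hg]; positivity
      _ = C1^q * (((1+y)^((n:ℝ)-1) * (1+y)^(-(a*q))) * exp (q*y)) := by simp only [hg]; ring
      _ = C1^q * ((1+y)^σ * exp (q*y)) := by rw [e2]
      _ ≤ C1^q * (D * (1+r)^σ * exp (q*r/2) * exp (q*y/2)) := by gcongr
      _ = _ := by rw [hQ]; ring_nf
  have s5 : ∫ y in Ioc 0 r, Q * exp (q/2*y) ≤ Q * (2/q * exp (q*r/2)) := by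
    rw [← intervalIntegral.integral_of_le hr0.le, intervalIntegral.integral_const_mul]
    apply mul_le_mul_of_nonneg_left _ hQ0
    rw [intervalIntegral.integral_comp_mul_left (fun z => exp z) (by positivity : q/2 ≠ 0), integral_exp]
    simp only [smul_eq_mul, mul_zero, exp_zero]
    have : q/2*r = q*r/2 := by ring
    rw [this]
    have e : (q/2)⁻¹ = 2/q := by rw [inv_div]
    rw [e]
    have : 0 < 2/q := by positivity
    nlinarith
  have e6 : exp (q*r/2) * exp (q*r/2) = exp (q*r) := by rw [← exp_add]; ring_nf
  have h7 := hone r hr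
  calc ∫ x in Metric.closedBall (0 : Eucl n) r, (phi n x)^q
      ≤ n * V * (Q * (2/q * exp (q*r/2))) := by
        rw [s2, s3] at s1
        refine s1.trans ?_
        apply mul_le_mul_of_nonneg_left (s4.trans s5) (by positivity)
    _ = n * V * (C1^q * D * (1+r)^σ * (2/q)) * (exp (q*r/2) * exp (q*r/2)) := by rw [hQ]; ring
    _ ≤ n * V * (C1^q * D * (D2 * r^σ) * (2/q)) * exp (q*r) := by rw [e6]; gcongr
    _ = (n * V * (C1^q * D * D2 * (2/q))) * r^σ * exp (q*r) := by ring
    _ ≤ _ := by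
      have : 0 ≤ r^σ := by positivity
      gcongr
      linarith

theorem lapl_congr {n : ℕ} {f g : Eucl n → ℝ} {x : Eucl n} (h : f =ᶠ[nhds x] g) :
    lapl f x = lapl g x := by
  unfold lapl
  refine Finset.sum_congr rfl fun i _ => ?_
  have h1 : (fun y => fderiv ℝ f y (EuclideanSpace.single i 1)) =ᶠ[nhds x]
      (fun y => fderiv ℝ g y (EuclideanSpace.single i 1)) := by
    filter_upwards [h.fderiv (𝕜 := ℝ)] with y hy
    rw [hy]
  rw [h1.fderiv_eq]

theorem lapl_const_mul {n : ℕ} {f : Eucl n → ℝ} (hf : ContDiff ℝ (⊤ : ℕ∞) f) (k : ℝ) (x : Eucl n) :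
    lapl (fun y => k * f y) x = k * lapl f x := by
  unfold lapl
  rw [Finset.mul_sum]
  refine Finset.sum_congr rfl fun i _ => ?_
  have hd : Differentiable ℝ f := hf.differentiable (by simp)
  have h1 : (fun y => fderiv ℝ (fun y => k * f y) y (EuclideanSpace.single i 1)) =
      (fun y => k * fderiv ℝ f y (EuclideanSpace.single i 1)) := by
    ext y
    rw [fderiv_const_mul (hd y)]
    simp
  rw [h1, fderiv_const_mul]
  · simp
  · have : ContDiff ℝ 1 (fderiv ℝ f) := hf.fderiv_right (by norm_cast)
    exact ((this.clm_apply contDiff_const).differentiable (by simp)) x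

theorem data_lower {n : ℕ} {u ψ : Eucl n → ℝ} (hu : ∀ x, 0 ≤ u x) (hui : Integrable u)
    (hψ : Continuous ψ) (hψc : HasCompactSupport ψ) (h1 : ∀ x, u x ≠ 0 → 1 ≤ ψ x) :
    ∫ x, u x ≤ ∫ x, u x * ψ x := by
  obtain ⟨M, hM⟩ := hψ.bounded_above_of_compact_support hψc
  apply integral_mono hui
    (hui.mul_bdd (c := M) hψ.aestronglyMeasurable (Filter.Eventually.of_forall hM))
  intro x
  by_cases h : u x = 0
  · simp [h]
  · exact le_mul_of_one_le_right (hu x) (h1 x h)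

theorem weak_lower
    (n : ℕ) (hn : 1 ≤ n) (c H b m2 β p R : ℝ)
    (hc : 0 < c) (hH : 0 < H)
    (hR : 0 < R)
    (Γ : ℝ → ℝ) (hΓ : ∀ t, 0 ≤ Γ t)
    (v0 v1 : Eucl n → ℝ)
    (hv0 : ∀ x, 0 ≤ v0 x) (hv1 : ∀ x, 0 ≤ v1 x)
    (hv0i : Integrable v0) (hv1i : Integrable v1)
    (hv0s : ∀ x, v0 x ≠ 0 → ‖x‖ ≤ R) (hv1s : ∀ x, v1 x ≠ 0 → ‖x‖ ≤ R)
    (ε : ℝ) (hε : 0 < ε) (T : ℝ) (v vt : ℝ → Eucl n → ℝ)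
    (h : IsWeakSolADS n c H b m2 p β Γ ε v0 v1 R T v vt) (t : ℝ) (ht : t ∈ Ioo (0:ℝ) T)
    (l : ℝ → ℝ) (hl : ContDiff ℝ (⊤ : ℕ∞) l)
    (hode : ∀ s, deriv (deriv l) s - c^2 * exp (2*H*s) * l s - b * deriv l s + m2 * l s = 0)
    (hlt : l t = 0) (hlt' : deriv l t = -1) (hl0 : ∀ s ∈ Icc 0 t, 0 ≤ l s)
    (hdat : 0 ≤ b * l 0 - deriv l 0) :
    ε * ((∫ x, v1 x) * l 0 + (∫ x, v0 x) * (b * l 0 - deriv l 0)) ≤ ∫ x, v t x * phi n x := by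
  obtain ⟨ht0, htT⟩ := ht
  set r : ℝ → ℝ := fun s => R + (c / H) * (exp (H * s) - 1) with hr
  have hcH : 0 < c/H := by positivity
  have hrmono : ∀ s ≤ t, r s ≤ r t := by
    intro s hs
    simp only [hr]
    gcongr
  have hRr : R ≤ r t := by
    have : 1 ≤ exp (H*t) := one_le_exp (by positivity)
    simp only [hr]
    nlinarith
  -- cutoffs
  have hδ : 0 < (T - t)/4 := by linarith
  let χ : ContDiffBump (t/2 : ℝ) := ⟨t/2 + (T-t)/4, t/2 + (T-t)/2, by linarith, by linarith⟩
  let η : ContDiffBump (0 : Eucl n) := ⟨r t + 1, r t + 2, by linarith, by linarith⟩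
  set ψ : Eucl n → ℝ := fun x => η x * phi n x with hψ
  have hψd : ContDiff ℝ (⊤ : ℕ∞) ψ := η.contDiff.mul (phi_contDiff n hn)
  have hψc : HasCompactSupport ψ := η.hasCompactSupport.mul_right
  have hψ1 : ∀ x : Eucl n, ‖x‖ < r t + 1 → ψ =ᶠ[nhds x] phi n := by
    intro x hx
    have : η =ᶠ[nhds x] 1 := η.eventuallyEq_one_of_mem_ball (by simpa [η] using hx)
    filter_upwards [this] with y hy
    simp [hψ, hy]
  have hψe : ∀ x : Eucl n, ‖x‖ < r t + 1 → ψ x = phi n x := fun x hx => (hψ1 x hx).eq_of_nhds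
  have hψnn : ∀ x, 0 ≤ ψ x := fun x =>
    mul_nonneg η.nonneg (zero_le_one.trans (phi_one_le n hn x))
  have hχ1 : ∀ s ∈ Icc 0 t, χ =ᶠ[nhds s] 1 := by
    intro s hs
    apply χ.eventuallyEq_one_of_mem_ball
    simp only [χ, Metric.mem_ball, Real.dist_eq]
    rw [abs_lt]
    constructor <;> linarith [hs.1, hs.2]
  have hχe : ∀ s ∈ Icc 0 t, χ s = 1 := fun s hs => (hχ1 s hs).eq_of_nhds
  set φ : ℝ → Eucl n → ℝ := fun s x => (χ s * l s) * ψ x with hφ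
  have hχl : HasCompactSupport (fun s => χ s * l s) := χ.hasCompactSupport.mul_right
  have htest : IsTestFn T φ := by
    refine ⟨?_, ?_, t + (T-t)/2, by linarith, ?_⟩
    · have h1 : ContDiff ℝ (⊤ : ℕ∞) (fun s => χ s * l s) := χ.contDiff.mul hl
      exact (h1.comp contDiff_fst).mul (hψd.comp contDiff_snd)
    · refine HasCompactSupport.intro (hχl.isCompact.prod hψc.isCompact) ?_
      intro q hq
      simp only [hφ]
      by_contra hne
      apply hq
      have := mul_ne_zero_iff.1 hne
      exact ⟨subset_tsupport _ this.1, subset_tsupport _ this.2⟩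
    · intro s hs x
      have : χ s = 0 := by
        apply χ.zero_of_le_dist
        simp only [χ, Real.dist_eq]
        rw [le_abs]
        left
        linarith
      simp [hφ, this]
  have hid := h.identity t ⟨ht0, htT⟩ φ htest
  have hφ1 : ∀ s ∈ Icc 0 t, ∀ x, (fun q => φ q x) =ᶠ[nhds s] fun q => l q * ψ x := by
    intro s hs x
    filter_upwards [hχ1 s hs] with q hq
    simp [hφ, hq]
  have hφe : ∀ s ∈ Icc 0 t, ∀ x, φ s x = l s * ψ x := fun s hs x => (hφ1 s hs x).eq_of_nhds
  have hld : Differentiable ℝ l := hl.differentiable (by simp)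
  have hdl : ∀ x, deriv (fun q => l q * ψ x) = fun q => deriv l q * ψ x := by
    intro x; ext q
    exact deriv_mul_const (hld q) _
  have hl1d : Differentiable ℝ (deriv l) := by
    have := (contDiff_infty_iff_deriv.1 hl).2
    exact this.differentiable (by simp)
  have hφd : ∀ s ∈ Icc 0 t, ∀ x, deriv (fun q => φ q x) s = deriv l s * ψ x := by
    intro s hs x
    rw [(hφ1 s hs x).deriv_eq, hdl]
  have hφdd : ∀ s ∈ Icc 0 t, ∀ x, deriv (deriv (fun q => φ q x)) s = deriv (deriv l) s * ψ x := by
    intro s hs x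
    rw [(hφ1 s hs x).deriv.deriv_eq, hdl]
    exact deriv_mul_const (hl1d s) _
  have m0 : (0:ℝ) ∈ Icc 0 t := ⟨le_rfl, ht0.le⟩
  have mt : t ∈ Icc 0 t := ⟨ht0.le, le_rfl⟩
  have T1 : (∫ x, vt t x * φ t x) = 0 := by simp [hφe t mt, hlt]
  have T3 : (∫ x, v t x * φ t x) = 0 := by simp [hφe t mt, hlt]
  have T2 : (∫ x, v t x * deriv (fun s => φ s x) t) = - ∫ x, v t x * phi n x := by
    rw [← integral_neg]
    congr 1
    ext x
    rw [hφd t mt, hlt']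
    by_cases hv : v t x = 0
    · simp [hv]
    · have := h.supp t ⟨ht0, htT⟩ x hv
      rw [hψe x (lt_of_le_of_lt this (by simp only [hr]; linarith))]
      ring
  have T4 : (∫ s in (0:ℝ)..t, ∫ x, v s x *
            (deriv (deriv (fun r => φ r x)) s
              - c ^ 2 * exp (2 * H * s) * lapl (fun y => φ s y) x
              - b * deriv (fun r => φ r x) s + m2 * φ s x)) = 0 := by
    apply intervalIntegral.integral_zero_ae
    refine Filter.Eventually.of_forall fun s hs => ?_
    rw [uIoc_of_le ht0.le] at hs
    have hs' : s ∈ Icc 0 t := ⟨hs.1.le, hs.2⟩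
    rw [← integral_zero (Eucl n) ℝ (μ := volume)]
    congr 1
    ext x
    by_cases hv : v s x = 0
    · simp [hv]
    · have h1 := h.supp s ⟨hs.1, lt_of_le_of_lt hs.2 htT⟩ x hv
      have hx : ‖x‖ < r t + 1 := by
        have := hrmono s hs.2
        simp only [hr] at this ⊢
        linarith
      have hL : lapl (fun y => φ s y) x = l s * phi n x := by
        have : (fun y => φ s y) =ᶠ[nhds x] fun y => l s * phi n y := by
          filter_upwards [hψ1 x hx] with y hy
          rw [hφe s hs', hy]
        rw [lapl_congr this, lapl_const_mul (phi_contDiff n hn), phi_lapl n hn]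
      rw [hL, hφdd s hs', hφd s hs', hφe s hs', hψe x hx]
      have e := hode s
      have : deriv (deriv l) s * phi n x - c^2 * exp (2*H*s) * (l s * phi n x)
          - b * (deriv l s * phi n x) + m2 * (l s * phi n x) =
          (deriv (deriv l) s - c^2 * exp (2*H*s) * l s - b * deriv l s + m2 * l s) * phi n x := by
        ring
      rw [this, e]; simp
  have N0 : 0 ≤ ∫ s in (0:ℝ)..t, Γ s * (∫ y, |v s y| ^ p) ^ β * (∫ x, |v s x| ^ p * φ s x) := by
    apply intervalIntegral.integral_nonneg ht0.le
    intro s hs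
    have i1 : 0 ≤ ∫ y, |v s y| ^ p := integral_nonneg fun y => by positivity
    have i2 : 0 ≤ ∫ x, |v s x| ^ p * φ s x := integral_nonneg fun x => by
      simp only [hφe s hs]
      have := hl0 s hs
      have := hψnn x
      positivity
    have := hΓ s
    positivity
  have D1 : (∫ x, v1 x * φ 0 x) = (∫ x, v1 x * ψ x) * l 0 := by
    rw [← integral_mul_const]
    congr 1; ext x
    rw [hφe 0 m0]; ring
  have D0 : (∫ x, v0 x * (b * φ 0 x - deriv (fun s => φ s x) 0)) =
      (∫ x, v0 x * ψ x) * (b * l 0 - deriv l 0) := by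
    rw [← integral_mul_const]
    congr 1; ext x
    rw [hφe 0 m0, hφd 0 m0]; ring
  rw [T1, T2, T3, T4, D1, D0] at hid
  have hge : ∀ x : Eucl n, ‖x‖ ≤ R → 1 ≤ ψ x := by
    intro x hx
    rw [hψe x (by linarith)]
    exact phi_one_le n hn x
  have L1 := data_lower hv1 hv1i hψd.continuous hψc (fun x hx => hge x (hv1s x hx))
  have L0 := data_lower hv0 hv0i hψd.continuous hψc (fun x hx => hge x (hv0s x hx))
  have e1 := mul_le_mul_of_nonneg_right L1 (hl0 0 m0)
  have e0 := mul_le_mul_of_nonneg_right L0 hdat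
  have := mul_le_mul_of_nonneg_left (add_le_add e1 e0) hε.le
  linarith

theorem holder_phi (n : ℕ) (hn : 1 ≤ n) (p q r : ℝ) (hpq : p.HolderConjugate q) (u : Eucl n → ℝ)
    (hu : Integrable u) (hup : Integrable (fun x => |u x|^p)) (hs : ∀ x, u x ≠ 0 → ‖x‖ ≤ r) :
    ∫ x, u x * phi n x ≤
      (∫ x, |u x|^p)^(1/p) * (∫ x in Metric.closedBall (0 : Eucl n) r, (phi n x)^q)^(1/q) := by
  set g : Eucl n → ℝ := (Metric.closedBall (0 : Eucl n) r).indicator (phi n) with hg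
  have hms : MeasurableSet (Metric.closedBall (0 : Eucl n) r) :=
    Metric.isClosed_closedBall.measurableSet
  have hgm : AEStronglyMeasurable g volume :=
    ((phi_contDiff n hn).continuous.aestronglyMeasurable).indicator hms
  have hp0 := hpq.pos
  have hq0 := hpq.symm.pos
  have hgq : (fun x => ‖g x‖^q) =
      (Metric.closedBall (0 : Eucl n) r).indicator (fun x => (phi n x)^q) := by
    ext x
    by_cases hx : x ∈ Metric.closedBall (0 : Eucl n) r
    · rw [hg, indicator_of_mem hx, indicator_of_mem hx, Real.norm_eq_abs,
        abs_of_nonneg (zero_le_one.trans (phi_one_le n hn x))]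
    · rw [hg, indicator_of_notMem hx, indicator_of_notMem hx, norm_zero, Real.zero_rpow hq0.ne']
  have hgi : Integrable (fun x => ‖g x‖^q) := by
    rw [hgq, integrable_indicator_iff hms]
    exact ((phi_contDiff n hn).continuous.rpow_const
      (fun x => Or.inr hq0.le)).continuousOn.integrableOn_compact (isCompact_closedBall _ _)
  have mu : MemLp u (ENNReal.ofReal p) volume := by
    rw [← integrable_norm_rpow_iff hu.aestronglyMeasurable (by simpa using hp0) (by simp)]
    rw [ENNReal.toReal_ofReal hp0.le]
    exact hup
  have mg : MemLp g (ENNReal.ofReal q) volume := by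
    rw [← integrable_norm_rpow_iff hgm (by simpa using hq0) (by simp)]
    rw [ENNReal.toReal_ofReal hq0.le]
    exact hgi
  have hH := integral_mul_norm_le_Lp_mul_Lq hpq mu mg
  rw [hgq, integral_indicator hms] at hH
  refine le_trans ?_ hH
  have e : (fun x => u x * phi n x) = fun x => u x * g x := by
    ext x
    by_cases hx : u x = 0
    · simp [hx]
    · rw [hg, indicator_of_mem (by simpa using hs x hx)]
  rw [e]
  calc ∫ x, u x * g x ≤ ‖∫ x, u x * g x‖ := Real.le_norm_self _
    _ ≤ ∫ x, ‖u x * g x‖ := norm_integral_le_integral_norm _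
    _ = _ := by simp only [norm_mul]

/-- **Lower bound for the nonlinearity in anti-de Sitter spacetime.**
If `v` is a weak solution of the anti-de Sitter problem with nonnegative, nontrivial data
supported in `B_R`, then there is a constant `C > 0`, independent of `ε`, such that for all
`t ∈ (0,T)`:
`∫ |v(t,x)|^p dx ≥ C ε^p e^{−½(b+H)pt} (R + (c/H)(e^{Ht} − 1))^{(n−1)(1−p/2)}`. -/
theorem antiDeSitter_nonlinearity_lower_bound
    (n : ℕ) (hn : 1 ≤ n) (c H b m2 β p R : ℝ)
    (hc : 0 < c) (hH : 0 < H) (hb : 0 ≤ b) (hm2 : 0 ≤ m2) (hdom : 4 * m2 ≤ b ^ 2)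
    (hβ : 0 ≤ β) (hp : 1 < p) (hR : 0 < R)
    (Γ : ℝ → ℝ) (hΓc : Continuous Γ) (hΓ : ∀ t, 0 ≤ Γ t)
    (v0 v1 : Eucl n → ℝ)
    (hv0 : ∀ x, 0 ≤ v0 x) (hv1 : ∀ x, 0 ≤ v1 x)
    (hv0i : Integrable v0) (hv1i : Integrable v1)
    (hv0s : ∀ x, v0 x ≠ 0 → ‖x‖ ≤ R) (hv1s : ∀ x, v1 x ≠ 0 → ‖x‖ ≤ R)
    (hv0nt : 0 < ∫ x, v0 x) (hv1nt : 0 < ∫ x, v1 x) :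
    ∃ C > 0, ∀ ε : ℝ, 0 < ε → ∀ T : ℝ, 0 < T → ∀ v vt : ℝ → Eucl n → ℝ,
      IsWeakSolADS n c H b m2 p β Γ ε v0 v1 R T v vt →
      ∀ t ∈ Ioo (0:ℝ) T,
        C * ε ^ p * exp (-((1/2) * (b + H) * p * t)) *
            (R + (c / H) * (exp (H * t) - 1)) ^ (((n : ℝ) - 1) * (1 - p / 2))
          ≤ ∫ x, |v t x| ^ p := by
  have hp0 : 0 < p := by linarith
  set q := p / (p-1) with hq
  have hpm : 0 < p - 1 := by linarith
  have hpq : p.HolderConjugate q := (Real.holderConjugate_iff_eq_conjExponent hp).2 rfl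
  have hq1 : 1 < q := hpq.symm.lt
  obtain ⟨K, hK, htime⟩ := time_fn c H b m2 (∫ x, v1 x) (∫ x, v0 x) hc hH hb hdom hv1nt hv0nt
  obtain ⟨C2, hC2, hint⟩ := phi_int n hn q R hq1 hR
  set K' := K * exp (c/H - R) with hK'
  have hK'0 : 0 < K' := by positivity
  refine ⟨K'^p / C2^(p-1), by positivity, ?_⟩
  intro ε hε T hT v vt h t ht
  obtain ⟨l, hl, hode, hlt, hlt', hl0, hdat, hlow⟩ := htime t ht.1
  have hW := weak_lower n hn c H b m2 β p R hc hH hR Γ hΓ v0 v1 hv0 hv1 hv0i hv1i hv0s hv1s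
    ε hε T v vt h t ht l hl hode hlt hlt' hl0 hdat
  have htI : t ∈ Ico (0:ℝ) T := ⟨ht.1.le, ht.2⟩
  set r := R + (c / H) * (exp (H * t) - 1) with hr
  have hRr : R ≤ r := by
    have h1 : 1 ≤ exp (H*t) := one_le_exp (mul_nonneg hH.le ht.1.le)
    have h2 : 0 < c/H := by positivity
    rw [hr]
    nlinarith
  have hr0 : 0 < r := by linarith
  have hHo := holder_phi n hn p q r hpq (v t) (h.integ_v t htI) (h.integ_pow t htI) (h.supp t ht)
  have hI := hint r hRr
  set I := ∫ x, |v t x|^p with hIdef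
  have hI0 : 0 ≤ I := integral_nonneg fun x => by positivity
  set J := ∫ x in Metric.closedBall (0 : Eucl n) r, (phi n x)^q with hJ
  have hJ0 : 0 ≤ J := integral_nonneg fun x => Real.rpow_nonneg (zero_le_one.trans (phi_one_le n hn x)) _
  have e1 : exp (c/H * exp (H*t)) = exp (c/H - R) * exp r := by
    rw [← exp_add, hr]; ring_nf
  have low : ε * (K' * exp (-((b+H)*t/2)) * exp r) ≤ I^(1/p) * J^(1/q) := by
    refine le_trans ?_ (hW.trans hHo)
    apply mul_le_mul_of_nonneg_left _ hε.le
    refine le_trans (le_of_eq ?_) hlow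
    rw [e1, hK']; ring
  have hpow := Real.rpow_le_rpow (by positivity) low hp0.le
  have hqp : 1/q*p = p-1 := by rw [hq]; field_simp
  rw [Real.mul_rpow hε.le (by positivity),
    Real.mul_rpow (x := K' * exp (-((b+H)*t/2))) (by positivity) (by positivity),
    Real.mul_rpow (x := K') (by positivity) (by positivity), ← exp_mul, ← exp_mul,
    Real.mul_rpow (x := I^(1/p)) (Real.rpow_nonneg hI0 _) (Real.rpow_nonneg hJ0 _),
    ← Real.rpow_mul hI0, ← Real.rpow_mul hJ0,
    one_div_mul_cancel hp0.ne', Real.rpow_one, hqp] at hpow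
  have hJp : J^(p-1) ≤ C2^(p-1) * r^(-(((n : ℝ) - 1) * (1 - p / 2))) * exp (r*p) := by
    refine (Real.rpow_le_rpow hJ0 hI hpm.le).trans (le_of_eq ?_)
    rw [Real.mul_rpow (by positivity) (by positivity), Real.mul_rpow (by positivity) (by positivity),
      ← Real.rpow_mul hr0.le, ← exp_mul]
    congr 2
    · congr 1
      rw [hq]; field_simp; ring
    · rw [hq]; field_simp
  have hfin := hpow.trans (mul_le_mul_of_nonneg_left hJp hI0)
  rw [Real.rpow_neg hr0.le] at hfin
  have hX : 0 < r^(((n : ℝ) - 1) * (1 - p / 2)) := by positivity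
  have hE : 0 < exp (r*p) := exp_pos _
  have hC : 0 < C2^(p-1) := by positivity
  have e2 : -((1/2) * (b + H) * p * t) = -((b+H)*t/2)*p := by ring
  rw [e2]
  generalize r^(((n : ℝ) - 1) * (1 - p / 2)) = X at *
  generalize exp (r*p) = E at *
  generalize C2^(p-1) = D at *
  generalize exp (-((b+H)*t/2)*p) = F at *
  generalize K'^p = G at *
  generalize ε^p = e at *
  have h3 : (e * (G * F)) * E ≤ (I * (D * X⁻¹)) * E := by linarith
  have h4 := le_of_mul_le_mul_right h3 hE
  have h5 := mul_le_mul_of_nonneg_right h4 (div_pos hX hC).le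
  have h6 : I * (D * X⁻¹) * (X / D) = I := by field_simp
  rw [h6] at h5
  refine le_trans (le_of_eq ?_) h5
  ring
end
end
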